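/- arXiv:2507.13535 — 2 statements merged into one kernel-verified Lean document; each statement's English description precedes it below -/
import Mathlib

section
/- (Kato–Ponce commutator estimate.) Let s > 0. There exists a constant c_s > 0 such that for all Schwartz functions f, g : ℝ → ℂ, ‖Λ^s(fg) - f·Λ^s g‖_{L²(ℝ)} ≤ c_s ( ‖Λ^s f‖_{L²(ℝ)} ‖g‖_{L^∞(ℝ)} + ‖∂_x f‖_{L^∞(ℝ)} ‖Λ^{s-1} g‖_{L²(ℝ)} ). -/
open MeasureTheory SchwartzMap Complex

/-- The Fourier transform `𝓕f(ξ) = ∫_ℝ e^{-iξx} f(x) dx`. -/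
noncomputable def fourierT (f : ℝ → ℂ) (ξ : ℝ) : ℂ :=
  ∫ x : ℝ, Complex.exp (-(Complex.I * ξ * x)) * f x

/-- The inverse Fourier transform `𝓕⁻¹g(x) = (1/2π) ∫_ℝ e^{iξx} g(ξ) dξ`. -/
noncomputable def invFourierT (g : ℝ → ℂ) (x : ℝ) : ℂ :=
  (1 / (2 * Real.pi)) * ∫ ξ : ℝ, Complex.exp (Complex.I * ξ * x) * g ξ

/-- The Bessel potential operator `Λ^σ f = 𝓕⁻¹((1+ξ²)^{σ/2} 𝓕f)`. -/
noncomputable def bessel (σ : ℝ) (f : ℝ → ℂ) : ℝ → ℂ :=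
  invFourierT fun ξ => (((1 + ξ ^ 2) ^ (σ / 2) : ℝ) : ℂ) * fourierT f ξ

/-- The `L²(ℝ)` norm. -/
noncomputable def L2Norm (f : ℝ → ℂ) : ℝ := Real.sqrt (∫ x : ℝ, ‖f x‖ ^ 2)

/-- The `L^∞(ℝ)` (sup) norm. -/
noncomputable def supNorm (f : ℝ → ℂ) : ℝ := ⨆ x : ℝ, ‖f x‖

namespace KatoPonce

open scoped FourierTransform ComplexConjugate ContDiff

/-- The Fourier multiplier with symbol `m`. -/
noncomputable def mult (m : ℝ → ℂ) : 𝓢(ℝ, ℂ) →L[ℂ] 𝓢(ℝ, ℂ) := fourierMultiplierCLM ℂ m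

/-- The product of two Schwartz functions. -/
noncomputable def mulS (u v : 𝓢(ℝ, ℂ)) : 𝓢(ℝ, ℂ) :=
  SchwartzMap.pairing (ContinuousLinearMap.mul ℂ ℂ) u v

/-- The complex conjugate of a Schwartz function. -/
noncomputable def conjS (u : 𝓢(ℝ, ℂ)) : 𝓢(ℝ, ℂ) :=
  SchwartzMap.postcompCLM (𝕜 := ℝ) (Complex.conjCLE : ℂ →L[ℝ] ℂ) u

@[simp] theorem mulS_apply (u v : 𝓢(ℝ, ℂ)) (x : ℝ) : mulS u v x = u x * v x := by
  simp [mulS]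

@[simp] theorem conjS_apply (u : 𝓢(ℝ, ℂ)) (x : ℝ) : conjS u x = conj (u x) := by
  simp [conjS]

theorem fourier_mult {m : ℝ → ℂ} (hm : m.HasTemperateGrowth) (f : 𝓢(ℝ, ℂ)) (ξ : ℝ) :
    𝓕 (mult m f) ξ = m ξ * 𝓕 f ξ := by
  rw [mult, fourierMultiplierCLM_apply, FourierTransform.fourier_fourierInv_eq,
    smulLeftCLM_apply_apply hm, smul_eq_mul]

theorem eq_of_fourier_eq {f g : 𝓢(ℝ, ℂ)} (h : ∀ ξ, 𝓕 f ξ = 𝓕 g ξ) : f = g := by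
  have : 𝓕 f = 𝓕 g := SchwartzMap.ext h
  rw [← FourierTransform.fourierInv_fourier_eq (F := 𝓢(ℝ, ℂ)) f, this,
    FourierTransform.fourierInv_fourier_eq]

theorem mult_mult {m n : ℝ → ℂ} (hm : m.HasTemperateGrowth) (hn : n.HasTemperateGrowth)
    (f : 𝓢(ℝ, ℂ)) : mult m (mult n f) = mult (fun ξ => m ξ * n ξ) f :=
  fourierMultiplierCLM_fourierMultiplierCLM_apply hm hn f

theorem mult_comm {m n : ℝ → ℂ} (hm : m.HasTemperateGrowth) (hn : n.HasTemperateGrowth)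
    (f : 𝓢(ℝ, ℂ)) : mult m (mult n f) = mult n (mult m f) := by
  rw [mult_mult hm hn, mult_mult hn hm]
  simp_rw [mul_comm]

theorem fourier_sub (f g : 𝓢(ℝ, ℂ)) (ξ : ℝ) : 𝓕 (f - g) ξ = 𝓕 f ξ - 𝓕 g ξ := by
  have := map_sub (FourierTransform.fourierCLM ℂ 𝓢(ℝ, ℂ)) f g
  simpa using congrArg (fun h : 𝓢(ℝ, ℂ) => h ξ) this

theorem mult_sub {m n : ℝ → ℂ} (hm : m.HasTemperateGrowth) (hn : n.HasTemperateGrowth)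
    (f : 𝓢(ℝ, ℂ)) : mult (fun ξ => m ξ - n ξ) f = mult m f - mult n f := by
  apply eq_of_fourier_eq
  intro ξ
  have : (fun ξ => m ξ - n ξ).HasTemperateGrowth := hm.sub hn
  rw [fourier_mult this, fourier_sub, fourier_mult hm, fourier_mult hn]
  ring

theorem fourier_conjS (u : 𝓢(ℝ, ℂ)) (ξ : ℝ) : 𝓕 (conjS u) ξ = conj (𝓕 u (-ξ)) := by
  rw [SchwartzMap.fourier_coe, SchwartzMap.fourier_coe, Real.fourier_eq, Real.fourier_eq,
    ← integral_conj]
  congr 1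
  ext x
  simp [Circle.smul_def, ← Circle.coe_inv_eq_conj, AddChar.map_neg_eq_inv]

theorem conjS_mult {m : ℝ → ℂ} (hm : m.HasTemperateGrowth)
    (hm' : (fun ξ => conj (m (-ξ))).HasTemperateGrowth) (u : 𝓢(ℝ, ℂ)) :
    conjS (mult m u) = mult (fun ξ => conj (m (-ξ))) (conjS u) := by
  apply eq_of_fourier_eq
  intro ξ
  rw [fourier_conjS, fourier_mult hm, fourier_mult hm', fourier_conjS, map_mul]

theorem integral_mul_eq (u v : 𝓢(ℝ, ℂ)) : ∫ x, u x * v x = ∫ ξ, 𝓕 u ξ * 𝓕 v (-ξ) := by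
  have h := SchwartzMap.integral_fourier_mul_eq u (𝓕⁻ v)
  rw [FourierTransform.fourier_fourierInv_eq] at h
  rw [← h]
  congr 1

theorem integral_mult_mul {m : ℝ → ℂ} (hm : m.HasTemperateGrowth)
    (hm' : (fun ξ => m (-ξ)).HasTemperateGrowth) (u v : 𝓢(ℝ, ℂ)) :
    ∫ x, mult m u x * v x = ∫ x, u x * mult (fun ξ => m (-ξ)) v x := by
  rw [integral_mul_eq, integral_mul_eq]
  congr 1
  ext ξ
  rw [fourier_mult hm, fourier_mult hm', neg_neg]
  ring

theorem fourier_fourier (u : 𝓢(ℝ, ℂ)) (x : ℝ) : 𝓕 (𝓕 u) x = u (-x) := by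
  have h : 𝓕⁻ (𝓕 u) = u := FourierTransform.fourierInv_fourier_eq u
  have h2 : (𝓕⁻ (𝓕 u)) (-x) = u (-x) := by rw [h]
  rw [← h2, SchwartzMap.fourierInv_coe, SchwartzMap.fourier_coe (𝓕 u),
    Real.fourierInv_eq_fourier_neg, neg_neg]

theorem fourier_mulS (u v : 𝓢(ℝ, ℂ)) (ξ : ℝ) :
    𝓕 (mulS u v) ξ = ∫ η, 𝓕 u η * 𝓕 v (ξ - η) := by
  have h : 𝓕 (mulS u v) =
      SchwartzMap.convolution (ContinuousLinearMap.mul ℂ ℂ) (𝓕 u) (𝓕 v) := by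
    apply eq_of_fourier_eq
    intro x
    rw [SchwartzMap.fourier_convolution, SchwartzMap.pairing_apply_apply, fourier_fourier,
      fourier_fourier, fourier_fourier, mulS_apply]
    rfl
  rw [h, SchwartzMap.convolution_apply]
  simp [MeasureTheory.convolution]

/-- The product of two functions with frequencies in the supports of `p` and `q` is unchanged by
a multiplier equal to `1` on the sum of these supports. -/
theorem mult_mulS_mult {p q r : ℝ → ℂ} (hp : p.HasTemperateGrowth) (hq : q.HasTemperateGrowth)
    (hr : r.HasTemperateGrowth) (h : ∀ ξ η, p ξ ≠ 0 → q η ≠ 0 → r (ξ + η) = 1)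
    (u v : 𝓢(ℝ, ℂ)) : mult r (mulS (mult p u) (mult q v)) = mulS (mult p u) (mult q v) := by
  apply eq_of_fourier_eq
  intro ξ
  rw [fourier_mult hr, fourier_mulS, ← integral_const_mul]
  congr 1
  ext η
  rw [fourier_mult hp, fourier_mult hq]
  by_cases h1 : p η = 0
  · simp [h1]
  by_cases h2 : q (ξ - η) = 0
  · simp [h2]
  have := h _ _ h1 h2
  rw [add_sub_cancel] at this
  rw [this, one_mul]

theorem L2Norm_nonneg (f : ℝ → ℂ) : 0 ≤ L2Norm f := Real.sqrt_nonneg _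

theorem sq_L2Norm (f : ℝ → ℂ) : L2Norm f ^ 2 = ∫ x, ‖f x‖ ^ 2 :=
  Real.sq_sqrt (integral_nonneg fun _ => by positivity)

theorem supNorm_nonneg (f : ℝ → ℂ) : 0 ≤ supNorm f := Real.iSup_nonneg fun _ => norm_nonneg _

theorem bddAbove_norm (f : 𝓢(ℝ, ℂ)) : BddAbove (Set.range fun x => ‖f x‖) :=
  ⟨SchwartzMap.seminorm ℂ 0 0 f, by rintro _ ⟨x, rfl⟩; exact SchwartzMap.norm_le_seminorm ℂ f x⟩

theorem norm_le_supNorm (f : 𝓢(ℝ, ℂ)) (x : ℝ) : ‖f x‖ ≤ supNorm f := le_ciSup (bddAbove_norm f) x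

theorem supNorm_le {f : ℝ → ℂ} {c : ℝ} (h : ∀ x, ‖f x‖ ≤ c) : supNorm f ≤ c := ciSup_le h

@[simp] theorem L2Norm_conjS (f : 𝓢(ℝ, ℂ)) : L2Norm (conjS f) = L2Norm f := by simp [L2Norm]

@[simp] theorem supNorm_conjS (f : 𝓢(ℝ, ℂ)) : supNorm (conjS f) = supNorm f := by simp [supNorm]

theorem integrable_norm_sq (f : 𝓢(ℝ, ℂ)) : Integrable fun x => ‖f x‖ ^ 2 := by
  have := (f.memLp 2).integrable_norm_pow (by norm_num)
  simpa using this

theorem sq_L2Norm_fourier (f : 𝓢(ℝ, ℂ)) : L2Norm (𝓕 f : 𝓢(ℝ, ℂ)) ^ 2 = L2Norm f ^ 2 := by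
  rw [sq_L2Norm, sq_L2Norm, SchwartzMap.integral_norm_sq_fourier]

theorem sq_L2Norm_mult {m : ℝ → ℂ} (hm : m.HasTemperateGrowth) (f : 𝓢(ℝ, ℂ)) :
    L2Norm (mult m f) ^ 2 = ∫ ξ, ‖m ξ‖ ^ 2 * ‖𝓕 f ξ‖ ^ 2 := by
  rw [← sq_L2Norm_fourier, sq_L2Norm]
  congr 1
  ext ξ
  rw [fourier_mult hm, norm_mul, mul_pow]

theorem integrable_mult {m : ℝ → ℂ} (hm : m.HasTemperateGrowth) (f : 𝓢(ℝ, ℂ)) :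
    Integrable fun ξ => ‖m ξ‖ ^ 2 * ‖𝓕 f ξ‖ ^ 2 := by
  convert integrable_norm_sq (𝓕 (mult m f)) using 2 with ξ
  rw [fourier_mult hm, norm_mul, mul_pow]

/-- Square function estimates on `L²` follow from pointwise estimates of the symbols. -/
theorem sum_sq_L2Norm_mult_le {ι : Type*} (t : Finset ι) {m : ι → ℝ → ℂ} {n : ℝ → ℂ} {C : ℝ}
    (hm : ∀ i, (m i).HasTemperateGrowth) (hn : n.HasTemperateGrowth)
    (h : ∀ ξ, ∑ i ∈ t, ‖m i ξ‖ ^ 2 ≤ C * ‖n ξ‖ ^ 2) (f : 𝓢(ℝ, ℂ)) :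
    ∑ i ∈ t, L2Norm (mult (m i) f) ^ 2 ≤ C * L2Norm (mult n f) ^ 2 := by
  simp_rw [sq_L2Norm_mult (hm _), sq_L2Norm_mult hn]
  rw [← integral_finsetSum t fun i _ => integrable_mult (hm i) f, ← integral_const_mul]
  refine integral_mono (integrable_finsetSum _ fun i _ => integrable_mult (hm i) f)
    ((integrable_mult hn f).const_mul C) fun ξ => ?_
  simp only [← Finset.sum_mul]
  nlinarith [h ξ, sq_nonneg ‖𝓕 f ξ‖]

theorem L2Norm_mult_le {m n : ℝ → ℂ} {C : ℝ} (hC : 0 ≤ C)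
    (hm : m.HasTemperateGrowth) (hn : n.HasTemperateGrowth)
    (h : ∀ ξ, ‖m ξ‖ ≤ C * ‖n ξ‖) (f : 𝓢(ℝ, ℂ)) :
    L2Norm (mult m f) ≤ C * L2Norm (mult n f) := by
  have := sum_sq_L2Norm_mult_le (C := C ^ 2) {()} (m := fun _ => m) (fun _ => hm) hn
    (fun ξ => by simpa [mul_pow] using pow_le_pow_left₀ (norm_nonneg _) (h ξ) 2) f
  simp only [Finset.sum_const, Finset.card_singleton, one_smul, ← mul_pow] at this
  exact (sq_le_sq₀ (L2Norm_nonneg _) (mul_nonneg hC (L2Norm_nonneg _))).1 this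

theorem L2Norm_le_of_sq_integrable {u v : ℝ → ℝ} (hu : MemLp u 2) (hv : MemLp v 2) :
    ∫ x, |u x| * |v x| ≤ √(∫ x, u x ^ 2) * √(∫ x, v x ^ 2) := by
  have := integral_mul_norm_le_Lp_mul_Lq (μ := volume) (f := u) (g := v) (p := 2) (q := 2)
    Real.HolderConjugate.two_two (by simpa using hu) (by simpa using hv)
  simpa [Real.sqrt_eq_rpow] using this

theorem integral_norm_mul_le (u v : 𝓢(ℝ, ℂ)) :
    ∫ x, ‖u x‖ * ‖v x‖ ≤ L2Norm u * L2Norm v := by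
  have := L2Norm_le_of_sq_integrable (u.memLp 2).norm (v.memLp 2).norm
  simpa [L2Norm] using this

theorem integrable_mulS (u v : 𝓢(ℝ, ℂ)) : Integrable fun x => u x * v x := by
  simpa only [← mulS_apply] using (mulS u v).integrable (μ := volume)

theorem integrable_norm_mul (u v : 𝓢(ℝ, ℂ)) : Integrable fun x => ‖u x‖ * ‖v x‖ := by
  simpa using (integrable_mulS u v).norm

theorem integrable_mul_mul (u v w : 𝓢(ℝ, ℂ)) : Integrable fun x => u x * v x * w x := by
  simpa only [← mulS_apply] using (mulS (mulS u v) w).integrable (μ := volume)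

theorem norm_integral_mul_mul_le (u v w : 𝓢(ℝ, ℂ)) :
    ‖∫ x, u x * v x * w x‖ ≤ supNorm u * (L2Norm v * L2Norm w) := by
  calc ‖∫ x, u x * v x * w x‖ ≤ ∫ x, ‖u x * v x * w x‖ := norm_integral_le_integral_norm _
    _ ≤ ∫ x, supNorm u * (‖v x‖ * ‖w x‖) := by
        refine integral_mono (integrable_mul_mul u v w).norm
          ((integrable_norm_mul v w).const_mul _) fun x => ?_
        simp only [norm_mul, mul_assoc]
        gcongr
        exact norm_le_supNorm u x
    _ ≤ _ := by
        rw [integral_const_mul]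
        exact mul_le_mul_of_nonneg_left (integral_norm_mul_le v w) (supNorm_nonneg _)

theorem norm_integral_mul_mul_le' (u v w : 𝓢(ℝ, ℂ)) :
    ‖∫ x, u x * v x * w x‖ ≤ supNorm v * (L2Norm u * L2Norm w) := by
  simpa [mul_comm (u _)] using norm_integral_mul_mul_le v u w

/-- Frequency localization of the third factor of a trilinear form. -/
theorem integral_localize {p q r : ℝ → ℂ} (hp : p.HasTemperateGrowth) (hq : q.HasTemperateGrowth)
    (hr : r.HasTemperateGrowth) (hr' : ∀ ξ, r (-ξ) = r ξ)
    (h : ∀ ξ η, p ξ ≠ 0 → q η ≠ 0 → r (ξ + η) = 1) (u v w : 𝓢(ℝ, ℂ)) :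
    ∫ x, mult p u x * mult q v x * w x = ∫ x, mult p u x * mult q v x * mult r w x := by
  have h1 := integral_mult_mul hr (by simpa only [hr'] using hr) (mulS (mult p u) (mult q v)) w
  rw [mult_mulS_mult hp hq hr h] at h1
  simpa only [mulS_apply, hr'] using h1

theorem sum_mul_le_of_sq {ι : Type*} (t : Finset ι) {a b : ι → ℝ} {A B : ℝ}
    (hA : 0 ≤ A) (hB : 0 ≤ B) (ha : ∑ i ∈ t, a i ^ 2 ≤ A ^ 2) (hb : ∑ i ∈ t, b i ^ 2 ≤ B ^ 2) :
    ∑ i ∈ t, a i * b i ≤ A * B := by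
  refine (Real.sum_mul_le_sqrt_mul_sqrt t a b).trans ?_
  gcongr
  · exact (Real.sqrt_le_sqrt ha).trans_eq (Real.sqrt_sq hA)
  · exact (Real.sqrt_le_sqrt hb).trans_eq (Real.sqrt_sq hB)

/-- The dilated Fourier transform of a kernel, used as a symbol. -/
noncomputable def dil (κ : 𝓢(ℝ, ℂ)) (δ : ℝ) (ξ : ℝ) : ℂ := 𝓕 κ (δ * ξ)

theorem hasTemperateGrowth_comp_mul {m : ℝ → ℂ} (hm : m.HasTemperateGrowth) (δ : ℝ) :
    (fun ξ => m (δ * ξ)).HasTemperateGrowth := by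
  have : (fun ξ : ℝ => δ * ξ).HasTemperateGrowth := by fun_prop
  exact hm.comp this

theorem hasTemperateGrowth_dil (κ : 𝓢(ℝ, ℂ)) (δ : ℝ) : (dil κ δ).HasTemperateGrowth :=
  hasTemperateGrowth_comp_mul (𝓕 κ : 𝓢(ℝ, ℂ)).hasTemperateGrowth δ

theorem fourierInv_fourier_apply (f : 𝓢(ℝ, ℂ)) (x : ℝ) :
    ∫ ξ : ℝ, (Real.fourierChar (ξ * x) : ℂ) * 𝓕 f ξ = f x := by
  have h : (𝓕⁻ (𝓕 f) : 𝓢(ℝ, ℂ)) x = f x := by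
    rw [FourierTransform.fourierInv_fourier_eq f]
  rw [← h, SchwartzMap.fourierInv_coe, Real.fourierInv_eq]
  simp [Circle.smul_def, mul_comm]

theorem fourier_apply (f : 𝓢(ℝ, ℂ)) (ξ : ℝ) :
    𝓕 f ξ = ∫ x : ℝ, (Real.fourierChar (-(x * ξ)) : ℂ) * f x := by
  rw [SchwartzMap.fourier_coe, Real.fourier_eq]
  simp [Circle.smul_def, mul_comm]

theorem mult_dil_apply (κ f : 𝓢(ℝ, ℂ)) (δ x : ℝ) :
    mult (dil κ δ) f x = ∫ z, κ z * f (x - δ * z) := by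
  rw [← fourierInv_fourier_apply (mult (dil κ δ) f) x]
  simp_rw [fourier_mult (hasTemperateGrowth_dil κ δ), dil, fourier_apply κ, 
    ← fourierInv_fourier_apply f (x - _)]
  simp_rw [← integral_const_mul, ← integral_mul_const, ← integral_const_mul]
  rw [integral_integral_swap]
  · congr 1
    ext z
    congr 1
    ext ξ
    have : (Real.fourierChar (ξ * (x - δ * z)) : ℂ) =
        Real.fourierChar (ξ * x) * Real.fourierChar (-(z * (δ * ξ))) := by
      rw [← Circle.coe_mul, ← AddChar.map_add_eq_mul]
      congr 2
      ring
    rw [this]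
    ring
  · have h := ((𝓕 f : 𝓢(ℝ, ℂ)).integrable (μ := volume)).mul_prod (κ.integrable (μ := volume))
    refine h.mono ?_ (Filter.Eventually.of_forall fun p => ?_)
    · have hc : Continuous (Function.uncurry fun (ξ z : ℝ) => (Real.fourierChar (ξ * x) : ℂ) *
          ((Real.fourierChar (-(z * (δ * ξ))) : ℂ) * κ z * 𝓕 f ξ)) := by
        have h1 := κ.continuous
        have h2 := (𝓕 f : 𝓢(ℝ, ℂ)).continuous
        have h3 : Continuous fun y : ℝ => (Real.fourierChar y : ℂ) :=
          continuous_subtype_val.comp Real.continuous_fourierChar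
        unfold Function.uncurry
        dsimp only
        fun_prop
      exact hc.aestronglyMeasurable
    · simp only [Function.uncurry, norm_mul, Circle.norm_coe, one_mul]
      rw [mul_comm]

theorem norm_mult_dil_le (κ f : 𝓢(ℝ, ℂ)) (δ x : ℝ) :
    ‖mult (dil κ δ) f x‖ ≤ (∫ z, ‖κ z‖) * supNorm f := by
  rw [mult_dil_apply, ← integral_mul_const]
  refine (norm_integral_le_integral_norm _).trans ?_
  refine integral_mono_of_nonneg (Filter.Eventually.of_forall fun _ => norm_nonneg _)
    (κ.integrable.norm.mul_const _) (Filter.Eventually.of_forall fun z => ?_)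
  simp only [norm_mul]
  gcongr
  exact norm_le_supNorm f _

theorem supNorm_mult_dil_le (κ f : 𝓢(ℝ, ℂ)) (δ : ℝ) :
    supNorm (mult (dil κ δ) f) ≤ (∫ z, ‖κ z‖) * supNorm f :=
  supNorm_le fun x => norm_mult_dil_le κ f δ x

/-- The derivative of a Schwartz function. -/
noncomputable def derivS (f : 𝓢(ℝ, ℂ)) : 𝓢(ℝ, ℂ) := SchwartzMap.derivCLM ℂ ℂ f

@[simp] theorem coe_derivS (f : 𝓢(ℝ, ℂ)) : ⇑(derivS f) = deriv f := by
  ext x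
  simp [derivS]

/-- The symbol of the derivative. -/
noncomputable def derivSymb (ξ : ℝ) : ℂ := 2 * Real.pi * Complex.I * ξ

theorem hasTemperateGrowth_derivSymb : derivSymb.HasTemperateGrowth := by
  unfold derivSymb
  fun_prop

theorem fourier_derivS (f : 𝓢(ℝ, ℂ)) (ξ : ℝ) : 𝓕 (derivS f) ξ = derivSymb ξ * 𝓕 f ξ := by
  rw [SchwartzMap.fourier_coe, coe_derivS, Real.fourier_deriv f.integrable f.differentiable]
  · simp [derivSymb, SchwartzMap.fourier_coe]
  · rw [← coe_derivS]
    exact (derivS f).integrable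

theorem derivS_eq_mult (f : 𝓢(ℝ, ℂ)) : derivS f = mult derivSymb f :=
  eq_of_fourier_eq fun ξ => by rw [fourier_derivS, fourier_mult hasTemperateGrowth_derivSymb]

theorem derivS_mult {m : ℝ → ℂ} (hm : m.HasTemperateGrowth) (f : 𝓢(ℝ, ℂ)) :
    derivS (mult m f) = mult m (derivS f) := by
  rw [derivS_eq_mult, derivS_eq_mult, mult_comm hasTemperateGrowth_derivSymb hm]

/-- Translation of a Schwartz function. -/
noncomputable def transS (y : ℝ) (f : 𝓢(ℝ, ℂ)) : 𝓢(ℝ, ℂ) := SchwartzMap.compSubConstCLM ℂ y f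

@[simp] theorem transS_apply (y : ℝ) (f : 𝓢(ℝ, ℂ)) (x : ℝ) : transS y f x = f (x - y) := by
  simp [transS]

theorem fourier_transS (y : ℝ) (f : 𝓢(ℝ, ℂ)) (ξ : ℝ) :
    𝓕 (transS y f) ξ = Real.fourierChar (-(y * ξ)) * 𝓕 f ξ := by
  rw [fourier_apply, fourier_apply]
  simp_rw [transS_apply]
  rw [← integral_const_mul, ← integral_sub_right_eq_self
    (fun x => (Real.fourierChar (-(y * ξ)) : ℂ) * (Real.fourierChar (-(x * ξ)) * f x)) y]
  congr 1
  ext x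
  rw [← mul_assoc, ← Circle.coe_mul, ← AddChar.map_add_eq_mul]
  congr 4
  ring

@[simp] theorem L2Norm_transS (y : ℝ) (f : 𝓢(ℝ, ℂ)) : L2Norm (transS y f) = L2Norm f := by
  simp only [L2Norm, transS_apply]
  rw [integral_sub_right_eq_self (fun x => ‖f x‖ ^ 2) y]

theorem norm_fourierChar_sub_one_le (t : ℝ) :
    ‖(Real.fourierChar t : ℂ) - 1‖ ≤ 2 * Real.pi * |t| := by
  rw [Real.fourierChar_apply, mul_comm _ Complex.I]
  refine (Real.norm_exp_I_mul_ofReal_sub_one_le).trans ?_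
  simp [abs_of_pos Real.pi_pos]

theorem L2Norm_transS_sub_le (y : ℝ) (f : 𝓢(ℝ, ℂ)) :
    L2Norm (transS y f - f : 𝓢(ℝ, ℂ)) ≤ |y| * L2Norm (derivS f) := by
  rw [← sq_le_sq₀ (L2Norm_nonneg _) (mul_nonneg (abs_nonneg _) (L2Norm_nonneg _)), mul_pow,
    ← sq_L2Norm_fourier, ← sq_L2Norm_fourier (derivS f), sq_L2Norm, sq_L2Norm,
    ← integral_const_mul]
  refine integral_mono (integrable_norm_sq _) ((integrable_norm_sq _).const_mul _) fun ξ => ?_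
  simp only [fourier_sub, fourier_transS, fourier_derivS]
  rw [← sub_one_mul, norm_mul, norm_mul, mul_pow, mul_pow, ← mul_assoc]
  gcongr
  rw [← mul_pow]
  gcongr
  refine (norm_fourierChar_sub_one_le _).trans_eq ?_
  simp [derivSymb, abs_mul, abs_of_pos Real.pi_pos]
  ring

theorem norm_sub_le_supNorm_deriv (f : 𝓢(ℝ, ℂ)) (x y : ℝ) :
    ‖f (x - y) - f x‖ ≤ |y| * supNorm (derivS f) := by
  have := Convex.norm_image_sub_le_of_norm_deriv_le (f := f) (C := supNorm (derivS f))
    (s := Set.univ) (x := x) (y := x - y) (fun x _ => f.differentiable x) (fun x _ => by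
      rw [← coe_derivS]; exact norm_le_supNorm _ x) convex_univ trivial trivial
  simpa [mul_comm] using this

theorem mult_dil_commutator_apply (κ F h : 𝓢(ℝ, ℂ)) (δ x : ℝ) :
    mult (dil κ δ) (mulS F h) x - F x * mult (dil κ δ) h x =
      ∫ z, κ z * (h (x - δ * z) * (F (x - δ * z) - F x)) := by
  have hi : ∀ u : 𝓢(ℝ, ℂ), Integrable fun z => κ z * u (x - δ * z) := by
    intro u
    refine κ.integrable.mul_bdd (c := supNorm u) ?_
      (Filter.Eventually.of_forall fun z => norm_le_supNorm u _)
    have := u.continuous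
    exact Continuous.aestronglyMeasurable (by fun_prop)
  rw [mult_dil_apply, mult_dil_apply, ← integral_const_mul,
    ← integral_sub (hi _) ((hi _).const_mul _)]
  congr 1
  ext z
  rw [mulS_apply]
  ring

/-- The commutator of a frequency cut-off with multiplication by `F`, tested against `ψ`. -/
theorem norm_integral_commutator_le (κ F h ψ : 𝓢(ℝ, ℂ)) {δ A : ℝ} (hδ : 0 ≤ δ)
    (hA : ∀ y, ‖∫ x, h (x - y) * (F (x - y) - F x) * ψ x‖ ≤ |y| * A) :
    ‖∫ x, (mult (dil κ δ) (mulS F h) x - F x * mult (dil κ δ) h x) * ψ x‖ ≤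
      δ * (∫ z, |z| * ‖κ z‖) * A := by
  simp_rw [mult_dil_commutator_apply, ← integral_mul_const]
  have hswap := integral_integral_swap (μ := volume) (ν := volume)
    (f := fun x z => κ z * (h (x - δ * z) * (F (x - δ * z) - F x)) * ψ x) (by
      have hb := ((ψ.integrable (μ := volume)).mul_prod (κ.integrable (μ := volume))).norm.const_mul
        (supNorm h * (2 * supNorm F))
      refine hb.mono' ?_ (Filter.Eventually.of_forall fun p => ?_)
      · have h1 := κ.continuous
        have h2 := h.continuous
        have h3 := F.continuous
        have h4 := ψ.continuous
        refine Continuous.aestronglyMeasurable ?_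
        unfold Function.uncurry
        dsimp only
        fun_prop
      · simp only [Function.uncurry, norm_mul]
        have h1 := norm_le_supNorm h (p.1 - δ * p.2)
        have h2 : ‖F (p.1 - δ * p.2) - F p.1‖ ≤ 2 * supNorm F := by
          have := norm_sub_le (F (p.1 - δ * p.2)) (F p.1)
          linarith [norm_le_supNorm F (p.1 - δ * p.2), norm_le_supNorm F p.1]
        have h3 := supNorm_nonneg h
        calc ‖κ p.2‖ * (‖h (p.1 - δ * p.2)‖ * ‖F (p.1 - δ * p.2) - F p.1‖) * ‖ψ p.1‖
            ≤ ‖κ p.2‖ * (supNorm h * (2 * supNorm F)) * ‖ψ p.1‖ := by gcongr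
          _ = _ := by ring)
  rw [hswap]
  have h_integrable : Integrable fun z : ℝ => |z| * ‖κ z‖ := by
    simpa using κ.integrable_pow_mul volume 1
  calc _ ≤ ∫ z, ‖∫ x, κ z * (h (x - δ * z) * (F (x - δ * z) - F x)) * ψ x‖ :=
        norm_integral_le_integral_norm _
    _ ≤ ∫ z, δ * A * (|z| * ‖κ z‖) := by
        refine integral_mono_of_nonneg (Filter.Eventually.of_forall fun _ => norm_nonneg _)
          (h_integrable.const_mul _) (Filter.Eventually.of_forall fun z => ?_)
        simp only [mul_assoc]
        rw [integral_const_mul, norm_mul]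
        have := hA (δ * z)
        simp only [mul_assoc, abs_mul, abs_of_nonneg hδ] at this
        nlinarith [mul_le_mul_of_nonneg_left this (norm_nonneg (κ z))]
    _ = _ := by
        rw [integral_const_mul]
        ring

theorem norm_integral_commutator_le_sup (κ F h ψ : 𝓢(ℝ, ℂ)) {δ : ℝ} (hδ : 0 ≤ δ) :
    ‖∫ x, (mult (dil κ δ) (mulS F h) x - F x * mult (dil κ δ) h x) * ψ x‖ ≤
      δ * (∫ z, |z| * ‖κ z‖) * (supNorm (derivS F) * (L2Norm h * L2Norm ψ)) := by
  refine norm_integral_commutator_le κ F h ψ hδ fun y => ?_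
  calc ‖∫ x, h (x - y) * (F (x - y) - F x) * ψ x‖
      = ‖∫ x, (transS y F - F : 𝓢(ℝ, ℂ)) x * transS y h x * ψ x‖ := by
        simp [mul_comm]
    _ ≤ supNorm (transS y F - F : 𝓢(ℝ, ℂ)) * (L2Norm (transS y h) * L2Norm ψ) :=
        norm_integral_mul_mul_le _ _ _
    _ ≤ |y| * supNorm (derivS F) * (L2Norm h * L2Norm ψ) := by
        rw [L2Norm_transS]
        refine mul_le_mul_of_nonneg_right (supNorm_le fun x => ?_)
          (mul_nonneg (L2Norm_nonneg _) (L2Norm_nonneg _))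
        simpa using norm_sub_le_supNorm_deriv F x y
    _ = _ := by ring

theorem norm_integral_commutator_le_L2 (κ F h ψ : 𝓢(ℝ, ℂ)) {δ : ℝ} (hδ : 0 ≤ δ) :
    ‖∫ x, (mult (dil κ δ) (mulS F h) x - F x * mult (dil κ δ) h x) * ψ x‖ ≤
      δ * (∫ z, |z| * ‖κ z‖) * (supNorm h * (L2Norm (derivS F) * L2Norm ψ)) := by
  refine norm_integral_commutator_le κ F h ψ hδ fun y => ?_
  calc ‖∫ x, h (x - y) * (F (x - y) - F x) * ψ x‖
      = ‖∫ x, transS y h x * (transS y F - F : 𝓢(ℝ, ℂ)) x * ψ x‖ := by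
        simp
    _ ≤ supNorm (transS y h) * (L2Norm (transS y F - F : 𝓢(ℝ, ℂ)) * L2Norm ψ) :=
        norm_integral_mul_mul_le _ _ _
    _ ≤ supNorm h * (|y| * L2Norm (derivS F) * L2Norm ψ) := by
        have h1 : supNorm (transS y h) ≤ supNorm h := supNorm_le fun x => by
          simpa using norm_le_supNorm h (x - y)
        have h2 := L2Norm_transS_sub_le y F
        have h3 := L2Norm_nonneg ψ
        have h4 := L2Norm_nonneg (transS y F - F : 𝓢(ℝ, ℂ))
        have h5 := supNorm_nonneg h
        gcongr
    _ = _ := by ring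

theorem norm_fourier_le_of_support {u : 𝓢(ℝ, ℂ)} {R M : ℝ} (hR : 0 ≤ R)
    (h0 : ∀ x, R < |x| → u x = 0) (hM : ∀ x, ‖u x‖ ≤ M) (z : ℝ) : ‖𝓕 u z‖ ≤ 2 * R * M := by
  rw [fourier_apply]
  refine (norm_integral_le_integral_norm _).trans ?_
  simp only [norm_mul, Circle.norm_coe, one_mul]
  have h1 : ∫ x, ‖u x‖ = ∫ x in Set.Icc (-R) R, ‖u x‖ := by
    rw [setIntegral_eq_integral_of_forall_compl_eq_zero]
    intro x hx
    rw [h0 x, norm_zero]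
    by_contra! hc
    exact hx (abs_le.1 hc)
  rw [h1]
  have := norm_setIntegral_le_of_norm_le_const (μ := volume) (s := Set.Icc (-R) R)
    (f := fun x => ‖u x‖) (C := M) (by simp) (fun x _ => by simpa using hM x)
  refine (le_abs_self _).trans (this.trans_eq ?_)
  simp [hR, Real.volume_real_Icc]
  ring

/-- The partial derivative in the second variable. -/
noncomputable def partialSnd (G : ℝ × ℝ → ℂ) (p : ℝ × ℝ) : ℂ := fderiv ℝ G p (0, 1)

theorem contDiff_partialSnd {G : ℝ × ℝ → ℂ} (hG : ContDiff ℝ ∞ G) :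
    ContDiff ℝ ∞ (partialSnd G) := by
  unfold partialSnd
  exact (hG.fderiv_right (m := ∞) (by simp)).clm_apply contDiff_const

theorem partialSnd_eq_deriv {G : ℝ × ℝ → ℂ} (hG : ContDiff ℝ ∞ G) (δ η : ℝ) :
    deriv (fun η => G (δ, η)) η = partialSnd G (δ, η) := by
  have h1 : HasFDerivAt G (fderiv ℝ G (δ, η)) (δ, η) :=
    (hG.differentiable (by simp) _).hasFDerivAt
  have h2 : HasDerivAt (fun η : ℝ => ((δ, η) : ℝ × ℝ)) (0, 1) η :=
    (hasDerivAt_const η δ).prodMk (hasDerivAt_id η)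
  exact (h1.comp_hasDerivAt η h2).deriv

theorem partialSnd_eq_zero {G : ℝ × ℝ → ℂ} {R : ℝ} (h0 : ∀ δ η, R < |η| → G (δ, η) = 0)
    (δ η : ℝ) (h : R < |η|) : partialSnd G (δ, η) = 0 := by
  have hev : G =ᶠ[nhds (δ, η)] fun _ => 0 := by
    have : {p : ℝ × ℝ | R < |p.2|} ∈ nhds (δ, η) :=
      (isOpen_lt continuous_const (by fun_prop)).mem_nhds h
    filter_upwards [this] with p hp using h0 _ _ hp
  simp [partialSnd, hev.fderiv_eq]

/-- A family of smooth symbols depending smoothly on a parameter in a compact set has uniformly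
decaying kernels. -/
theorem exists_kernel_bound {G : ℝ × ℝ → ℂ} (hG : ContDiff ℝ ∞ G) {R : ℝ} (hR : 0 ≤ R)
    (h0 : ∀ δ η, R < |η| → G (δ, η) = 0) :
    ∃ B : ℝ, 0 ≤ B ∧ ∀ δ ∈ Set.Icc (0 : ℝ) 1, ∃ κ : 𝓢(ℝ, ℂ),
      (∀ η, 𝓕 κ η = G (δ, η)) ∧ ∀ z, ‖κ z‖ ≤ B * ((1 + z ^ 2) ^ 2)⁻¹ := by
  have hbd : ∀ F : ℝ × ℝ → ℂ, ContDiff ℝ ∞ F → (∀ δ η, R < |η| → F (δ, η) = 0) →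
      ∃ M : ℝ, 0 ≤ M ∧ ∀ δ ∈ Set.Icc (0 : ℝ) 1, ∀ η, ‖F (δ, η)‖ ≤ M := by
    intro F hF hF0
    obtain ⟨M, hM⟩ := (isCompact_Icc.prod isCompact_Icc :
      IsCompact (Set.Icc (0 : ℝ) 1 ×ˢ Set.Icc (-R) R)).exists_bound_of_continuousOn
        hF.continuous.continuousOn
    refine ⟨max M 0, le_max_right _ _, fun δ hδ η => ?_⟩
    by_cases h : R < |η|
    · simp [hF0 δ η h]
    · exact (hM (δ, η) ⟨hδ, abs_le.1 (not_lt.1 h)⟩).trans (le_max_left _ _)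
  have h1 := contDiff_partialSnd hG
  have h2 := contDiff_partialSnd h1
  have h3 := contDiff_partialSnd h2
  have h4 := contDiff_partialSnd h3
  have z1 := partialSnd_eq_zero h0
  have z2 := partialSnd_eq_zero z1
  have z3 := partialSnd_eq_zero z2
  have z4 := partialSnd_eq_zero z3
  obtain ⟨M, hM0, hM⟩ := hbd _ hG h0
  obtain ⟨M', hM0', hM'⟩ := hbd _ h4 z4
  refine ⟨2 * (2 * R * M + 2 * R * M'), by positivity, fun δ hδ => ?_⟩
  have hcs : HasCompactSupport fun η => G (δ, η) :=
    HasCompactSupport.intro (isCompact_Icc (a := -R) (b := R)) fun η hη => by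
      apply h0
      by_contra! hc
      exact hη (abs_le.1 hc)
  have hsm : ContDiff ℝ ∞ fun η => G (δ, η) := hG.comp (contDiff_prodMk_right δ)
  let h : 𝓢(ℝ, ℂ) := hcs.toSchwartzMap hsm
  have hh : ⇑h = fun η => G (δ, η) := rfl
  have hd : ⇑(derivS (derivS (derivS (derivS h)))) =
      fun η => partialSnd (partialSnd (partialSnd (partialSnd G))) (δ, η) := by
    simp only [coe_derivS, hh]
    rw [funext (partialSnd_eq_deriv hG δ), funext (partialSnd_eq_deriv h1 δ),
      funext (partialSnd_eq_deriv h2 δ), funext (partialSnd_eq_deriv h3 δ)]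
  refine ⟨𝓕⁻ h, fun η => ?_, fun z => ?_⟩
  · rw [FourierTransform.fourier_fourierInv_eq, hh]
  have e1 : (𝓕⁻ h : 𝓢(ℝ, ℂ)) z = 𝓕 h (-z) := by
    rw [SchwartzMap.fourierInv_coe, SchwartzMap.fourier_coe, Real.fourierInv_eq_fourier_neg]
  have b0 := norm_fourier_le_of_support hR (u := h) (fun x hx => by rw [hh]; exact h0 δ x hx)
    (fun x => by rw [hh]; exact hM δ hδ x) (-z)
  have b4 := norm_fourier_le_of_support hR (u := derivS (derivS (derivS (derivS h))))
    (fun x hx => by rw [hd]; exact z4 δ x hx) (fun x => by rw [hd]; exact hM' δ hδ x) (-z)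
  simp only [fourier_derivS, norm_mul] at b4
  rw [e1, ← div_eq_mul_inv, le_div_iff₀ (by positivity)]
  have hn : ‖derivSymb (-z)‖ = 2 * Real.pi * |z| := by
    simp [derivSymb, abs_of_pos Real.pi_pos]
  rw [hn] at b4
  have hpi : |z| ≤ 2 * Real.pi * |z| := by nlinarith [Real.pi_gt_three, abs_nonneg z]
  have h5 : z ^ 4 * ‖𝓕 h (-z)‖ ≤ 2 * R * M' := by
    refine le_trans ?_ b4
    have : z ^ 4 = |z| * (|z| * (|z| * |z|)) := by
      rw [← Even.pow_abs (by decide : Even 4) z]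
      ring
    rw [this]
    simp only [mul_assoc |z|]
    gcongr
  nlinarith [norm_nonneg (𝓕 h (-z)), sq_nonneg (z ^ 2 - 1)]

theorem exists_bessel_kernel (s : ℝ) {ρ : ℝ → ℂ} (hρ : ContDiff ℝ ∞ ρ) {r R : ℝ} (hr : 0 < r)
    (hR : 0 ≤ R) (h0 : ∀ η, |η| ≤ r → ρ η = 0) (h1 : ∀ η, R < |η| → ρ η = 0) :
    ∃ B : ℝ, 0 ≤ B ∧ ∀ k : ℕ, ∃ κ : 𝓢(ℝ, ℂ), (∀ z, ‖κ z‖ ≤ B * ((1 + z ^ 2) ^ 2)⁻¹) ∧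
      ∀ ξ, (((1 + (2 * Real.pi * ξ) ^ 2) ^ (s / 2) : ℝ) : ℂ) * ρ ((1 / 2) ^ k * ξ) =
        ((((2 : ℝ) ^ k) ^ s : ℝ) : ℂ) * dil κ ((1 / 2) ^ k) ξ := by
  let G : ℝ × ℝ → ℂ := fun p =>
    (((p.1 ^ 2 + (2 * Real.pi * p.2) ^ 2) ^ (s / 2) : ℝ) : ℂ) * ρ p.2
  have hG : ContDiff ℝ ∞ G := by
    rw [contDiff_iff_contDiffAt]
    rintro ⟨δ, η⟩
    by_cases hη : |η| < r
    · have : {p : ℝ × ℝ | |p.2| < r} ∈ nhds (δ, η) :=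
        (isOpen_lt (by fun_prop) continuous_const).mem_nhds hη
      refine (contDiffAt_const (c := (0 : ℂ))).congr_of_eventuallyEq ?_
      filter_upwards [this] with p hp
      simp [G, h0 p.2 (le_of_lt hp)]
    · have hη' : η ≠ 0 := by
        rintro rfl
        simp [hr] at hη
      have hne : δ ^ 2 + (2 * Real.pi * η) ^ 2 ≠ 0 := by
        have : 0 < (2 * Real.pi * η) ^ 2 := by positivity
        positivity
      have hb : ContDiffAt ℝ ∞ (fun p : ℝ × ℝ => (p.1 ^ 2 + (2 * Real.pi * p.2) ^ 2) ^ (s / 2))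
          (δ, η) := ContDiffAt.rpow_const_of_ne (by fun_prop) hne
      exact (Complex.ofRealCLM.contDiff.contDiffAt.comp _ hb).mul
        (hρ.contDiffAt.comp _ contDiffAt_snd)
  obtain ⟨B, hB, H⟩ := exists_kernel_bound hG hR (fun δ η h => by simp [G, h1 η h])
  refine ⟨B, hB, fun k => ?_⟩
  obtain ⟨κ, hκ, hκB⟩ := H ((1 / 2) ^ k) ⟨by positivity, pow_le_one₀ (by norm_num) (by norm_num)⟩
  refine ⟨κ, hκB, fun ξ => ?_⟩
  rw [dil, hκ]
  simp only [G]
  rw [← mul_assoc, ← Complex.ofReal_mul]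
  congr 2
  have : (1 + (2 * Real.pi * ξ) ^ 2) = ((2 : ℝ) ^ k) ^ (2 : ℝ) *
      (((1 / 2) ^ k) ^ 2 + (2 * Real.pi * ((1 / 2) ^ k * ξ)) ^ 2) := by
    rw [Real.rpow_two, one_div, inv_pow]
    field_simp
  rw [this, Real.mul_rpow (by positivity) (by positivity), ← Real.rpow_mul (by positivity)]
  congr 2
  ring

theorem exists_kernel {ρ : ℝ → ℂ} (hρ : ContDiff ℝ ∞ ρ) {R : ℝ}
    (h1 : ∀ η, R < |η| → ρ η = 0) : ∃ κ : 𝓢(ℝ, ℂ), ∀ η, 𝓕 κ η = ρ η := by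
  have hcs : HasCompactSupport ρ :=
    HasCompactSupport.intro (isCompact_Icc (a := -R) (b := R)) fun η hη => by
      apply h1
      by_contra! hc
      exact hη (abs_le.1 hc)
  refine ⟨𝓕⁻ (hcs.toSchwartzMap hρ : 𝓢(ℝ, ℂ)), fun η => ?_⟩
  rw [FourierTransform.fourier_fourierInv_eq]
  rfl

/-- The angle used to build a smooth partition of unity. -/
noncomputable def cutAngle (x : ℝ) : ℝ := Real.pi / 2 * Real.smoothTransition ((x ^ 2 - 1) / 3)

theorem contDiff_cutAngle : ContDiff ℝ ∞ cutAngle := by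
  unfold cutAngle
  exact contDiff_const.mul (Real.smoothTransition.contDiff.comp (by fun_prop))

theorem cutAngle_neg (x : ℝ) : cutAngle (-x) = cutAngle x := by simp [cutAngle]

theorem cutAngle_of_le {x : ℝ} (h : |x| ≤ 1) : cutAngle x = 0 := by
  have : x ^ 2 ≤ 1 := by rwa [sq_le_one_iff_abs_le_one]
  simp [cutAngle, Real.smoothTransition.zero_of_nonpos (x := (x ^ 2 - 1) / 3) (by linarith)]

theorem cutAngle_of_ge {x : ℝ} (h : 2 ≤ |x|) : cutAngle x = Real.pi / 2 := by
  have : 4 ≤ x ^ 2 := by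
    rw [← sq_abs]
    nlinarith
  simp [cutAngle, Real.smoothTransition.one_of_one_le (x := (x ^ 2 - 1) / 3) (by linarith)]

/-- A smooth even cut-off function, equal to `1` on `[-1, 1]` and to `0` off `[-2, 2]`. -/
noncomputable def cut (x : ℝ) : ℝ := Real.cos (cutAngle x) ^ 2

/-- A smooth square root of `cut (x / 2) - cut x`. -/
noncomputable def bump (x : ℝ) : ℝ := Real.sin (cutAngle x) * Real.cos (cutAngle (x / 2))

theorem contDiff_cut : ContDiff ℝ ∞ cut := by
  unfold cut
  exact (contDiff_cutAngle.cos).pow 2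

theorem contDiff_bump : ContDiff ℝ ∞ bump := by
  unfold bump
  exact contDiff_cutAngle.sin.mul
    (contDiff_cutAngle.comp (by fun_prop : ContDiff ℝ ∞ fun x : ℝ => x / 2)).cos

theorem cut_neg (x : ℝ) : cut (-x) = cut x := by simp [cut, cutAngle_neg]

theorem bump_neg (x : ℝ) : bump (-x) = bump x := by simp [bump, cutAngle_neg, neg_div]

theorem cut_of_le {x : ℝ} (h : |x| ≤ 1) : cut x = 1 := by simp [cut, cutAngle_of_le h]

theorem cut_of_ge {x : ℝ} (h : 2 ≤ |x|) : cut x = 0 := by simp [cut, cutAngle_of_ge h]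

theorem cut_nonneg (x : ℝ) : 0 ≤ cut x := by unfold cut; positivity

theorem cut_le_one (x : ℝ) : cut x ≤ 1 := Real.cos_sq_le_one _

theorem bump_sq (x : ℝ) : bump x ^ 2 = cut (x / 2) - cut x := by
  have h : cut x * cut (x / 2) = cut x := by
    rcases le_total 2 |x| with h | h
    · simp [cut_of_ge h]
    · rw [cut_of_le (x := x / 2), mul_one]
      rw [abs_div, abs_two]
      linarith
  rw [bump, mul_pow, Real.sin_sq]
  simp only [cut] at h ⊢
  linarith

theorem bump_of_le {x : ℝ} (h : |x| ≤ 1) : bump x = 0 := by simp [bump, cutAngle_of_le h]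

theorem bump_of_ge {x : ℝ} (h : 4 ≤ |x|) : bump x = 0 := by
  rw [bump, cutAngle_of_ge (x := x / 2) (by rw [abs_div, abs_two]; linarith)]
  simp

theorem norm_bump_le (x : ℝ) : |bump x| ≤ 1 := by
  rw [bump, abs_mul]
  exact mul_le_one₀ (Real.abs_sin_le_one _) (abs_nonneg _) (Real.abs_cos_le_one _)

theorem exists_cutKernel : ∃ κ : 𝓢(ℝ, ℂ), ∀ η, 𝓕 κ η = (cut η : ℂ) :=
  exists_kernel (Complex.ofRealCLM.contDiff.comp contDiff_cut) (R := 2) fun η h => by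
    simp [cut_of_ge h.le]

theorem exists_bumpKernel : ∃ κ : 𝓢(ℝ, ℂ), ∀ η, 𝓕 κ η = (bump η : ℂ) :=
  exists_kernel (Complex.ofRealCLM.contDiff.comp contDiff_bump) (R := 4) fun η h => by
    simp [bump_of_ge h.le]

/-- The kernel of the cut-off function. -/
noncomputable def cutKernel : 𝓢(ℝ, ℂ) := exists_cutKernel.choose

/-- The kernel of the annular bump function. -/
noncomputable def bumpKernel : 𝓢(ℝ, ℂ) := exists_bumpKernel.choose

theorem fourier_bumpKernel (η : ℝ) : 𝓕 bumpKernel η = (bump η : ℂ) :=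
  exists_bumpKernel.choose_spec η

/-- The symbol of the projection to frequencies at most about `2 ^ k`. -/
noncomputable def low (k : ℕ) : ℝ → ℂ := dil cutKernel ((1 / 2) ^ k)

/-- The symbol of the projection to frequencies between about `2 ^ j` and `2 ^ k`. -/
noncomputable def band (j k : ℕ) (ξ : ℝ) : ℂ := low k ξ - low j ξ

/-- The symbol `J ^ s` of the Bessel potential, `J = (1 + (2πξ)²) ^ (1/2)`. -/
noncomputable def jap (s : ℝ) (ξ : ℝ) : ℂ := (((1 + (2 * Real.pi * ξ) ^ 2) ^ (s / 2) : ℝ) : ℂ)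

theorem low_apply (k : ℕ) (ξ : ℝ) : low k ξ = (cut ((1 / 2) ^ k * ξ) : ℂ) :=
  exists_cutKernel.choose_spec _

theorem dil_bumpKernel (k : ℕ) (ξ : ℝ) :
    dil bumpKernel ((1 / 2) ^ k) ξ = (bump ((1 / 2) ^ k * ξ) : ℂ) :=
  exists_bumpKernel.choose_spec _

theorem hasTemperateGrowth_low (k : ℕ) : (low k).HasTemperateGrowth := hasTemperateGrowth_dil _ _

theorem hasTemperateGrowth_band (j k : ℕ) : (band j k).HasTemperateGrowth :=
  (hasTemperateGrowth_low k).sub (hasTemperateGrowth_low j)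

theorem hasTemperateGrowth_jap (s : ℝ) : (jap s).HasTemperateGrowth := by
  have h1 := Function.hasTemperateGrowth_one_add_norm_sq_rpow (H := ℝ) (s / 2)
  have h2 : (fun ξ : ℝ => 2 * Real.pi * ξ).HasTemperateGrowth := by fun_prop
  have h3 := Function.Complex.hasTemperateGrowth_ofReal.comp (h1.comp h2)
  have h4 : jap s = Complex.ofReal ∘ (fun x : ℝ => (1 + ‖x‖ ^ 2) ^ (s / 2)) ∘
      fun ξ : ℝ => 2 * Real.pi * ξ := by
    ext ξ
    simp [jap]
  rwa [h4]

theorem abs_pow_mul (k : ℕ) (ξ : ℝ) : |(1 / 2 : ℝ) ^ k * ξ| = |ξ| / 2 ^ k := by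
  rw [abs_mul, abs_of_pos (by positivity), one_div, inv_pow]
  ring

theorem low_of_le {k : ℕ} {ξ : ℝ} (h : |ξ| ≤ 2 ^ k) : low k ξ = 1 := by
  rw [low_apply, cut_of_le, ofReal_one]
  rw [abs_pow_mul]
  exact div_le_one_of_le₀ h (by positivity)

theorem low_of_ge {k : ℕ} {ξ : ℝ} (h : 2 ^ (k + 1) ≤ |ξ|) : low k ξ = 0 := by
  rw [low_apply, cut_of_ge, ofReal_zero]
  rw [abs_pow_mul, le_div_iff₀ (by positivity)]
  rw [pow_succ] at h
  linarith

theorem lt_of_low_ne_zero {k : ℕ} {ξ : ℝ} (h : low k ξ ≠ 0) : |ξ| < 2 ^ (k + 1) := by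
  contrapose! h
  exact low_of_ge h

theorem norm_low_le (k : ℕ) (ξ : ℝ) : ‖low k ξ‖ ≤ 1 := by
  rw [low_apply, norm_real, Real.norm_of_nonneg (cut_nonneg _)]
  exact cut_le_one _

theorem low_neg (k : ℕ) (ξ : ℝ) : low k (-ξ) = low k ξ := by
  rw [low_apply, low_apply, mul_neg, cut_neg]

theorem band_neg (j k : ℕ) (ξ : ℝ) : band j k (-ξ) = band j k ξ := by
  rw [band, band, low_neg, low_neg]

theorem jap_neg (s ξ : ℝ) : jap s (-ξ) = jap s ξ := by simp [jap]

theorem band_of_le {j k : ℕ} (hjk : j ≤ k) {ξ : ℝ} (h : |ξ| ≤ 2 ^ j) : band j k ξ = 0 := by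
  rw [band, low_of_le h, low_of_le (h.trans (pow_le_pow_right₀ one_le_two hjk)), sub_self]

theorem band_of_ge {j k : ℕ} (hjk : j ≤ k) {ξ : ℝ} (h : 2 ^ (k + 1) ≤ |ξ|) : band j k ξ = 0 := by
  rw [band, low_of_ge h,
    low_of_ge ((pow_le_pow_right₀ one_le_two (by omega)).trans h), sub_self]

theorem band_of_mem {j k : ℕ} {ξ : ℝ} (h : 2 ^ (j + 1) ≤ |ξ|) (h' : |ξ| ≤ 2 ^ k) :
    band j k ξ = 1 := by
  rw [band, low_of_le h', low_of_ge h, sub_zero]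

theorem mem_of_band_ne_zero {j k : ℕ} (hjk : j ≤ k) {ξ : ℝ} (h : band j k ξ ≠ 0) :
    2 ^ j < |ξ| ∧ |ξ| < 2 ^ (k + 1) := by
  contrapose! h
  by_cases h1 : |ξ| ≤ 2 ^ j
  · exact band_of_le hjk h1
  · exact band_of_ge hjk (h (not_le.1 h1))

theorem norm_band_le (j k : ℕ) (ξ : ℝ) : ‖band j k ξ‖ ≤ 1 := by
  rw [band, low_apply, low_apply, ← ofReal_sub, norm_real, Real.norm_eq_abs, abs_le]
  have h1 := cut_nonneg ((1 / 2) ^ k * ξ)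
  have h2 := cut_nonneg ((1 / 2) ^ j * ξ)
  have h3 := cut_le_one ((1 / 2) ^ k * ξ)
  have h4 := cut_le_one ((1 / 2) ^ j * ξ)
  constructor <;> linarith

theorem band_succ (k : ℕ) (ξ : ℝ) :
    band k (k + 1) ξ = dil bumpKernel ((1 / 2) ^ k) ξ * dil bumpKernel ((1 / 2) ^ k) ξ := by
  rw [dil_bumpKernel, ← ofReal_mul, ← sq, bump_sq, band, low_apply, low_apply, ← ofReal_sub]
  congr 3
  rw [pow_succ]
  ring_nf

theorem mult_band (j k : ℕ) (f : 𝓢(ℝ, ℂ)) : mult (band j k) f = mult (low k) f - mult (low j) f :=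
  mult_sub (hasTemperateGrowth_low k) (hasTemperateGrowth_low j) f

theorem supNorm_mult_low_le : ∃ C : ℝ, 0 ≤ C ∧ ∀ (k : ℕ) (f : 𝓢(ℝ, ℂ)),
    supNorm (mult (low k) f) ≤ C * supNorm f :=
  ⟨∫ z, ‖cutKernel z‖, integral_nonneg fun _ => norm_nonneg _,
    fun _ f => supNorm_mult_dil_le cutKernel f _⟩

theorem norm_jap (s ξ : ℝ) : ‖jap s ξ‖ = (1 + (2 * Real.pi * ξ) ^ 2) ^ (s / 2) := by
  rw [jap, norm_real, Real.norm_of_nonneg (by positivity)]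

theorem norm_jap_sq (s ξ : ℝ) : ‖jap s ξ‖ ^ 2 = (1 + (2 * Real.pi * ξ) ^ 2) ^ s := by
  rw [norm_jap, ← Real.rpow_mul_natCast (by positivity)]
  congr 1
  push_cast
  ring

theorem sum_geom_le_of_one_lt {ρ : ℝ} (hρ : 1 < ρ) {t : ℝ} (ht : 0 ≤ t) (K : ℕ) :
    ∑ k ∈ Finset.range K, (if ρ ^ k ≤ t then ρ ^ k else 0) ≤ ρ / (ρ - 1) * t := by
  have h1 : 0 < ρ - 1 := by linarith
  have h2 : ∀ K : ℕ, ∑ k ∈ Finset.range K, (if ρ ^ k ≤ t then ρ ^ k else 0) ≤ ρ ^ K / (ρ - 1) := by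
    intro K
    rw [le_div_iff₀ h1]
    calc _ ≤ (∑ k ∈ Finset.range K, ρ ^ k) * (ρ - 1) := by
          gcongr with k
          split_ifs
          · exact le_rfl
          · positivity
      _ ≤ ρ ^ K := by
          rw [geom_sum_mul]
          linarith
  induction K with
  | zero => simpa using by positivity
  | succ K ih =>
    rw [Finset.sum_range_succ]
    split_ifs with h
    · calc _ ≤ ρ ^ K / (ρ - 1) + ρ ^ K := by gcongr; exact h2 K
        _ = ρ / (ρ - 1) * ρ ^ K := by field_simp; ring
        _ ≤ _ := by gcongr
    · simpa using ih

theorem sum_geom_le_of_lt_one {ρ : ℝ} (h0 : 0 < ρ) (hρ : ρ < 1) {t : ℝ} (ht : 0 ≤ t) (K : ℕ) :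
    ∑ k ∈ Finset.range K, (if ρ ^ k ≤ t then ρ ^ k else 0) ≤ (1 - ρ)⁻¹ * t := by
  have h1 : 0 < 1 - ρ := by linarith
  induction K generalizing t with
  | zero => simpa using by positivity
  | succ K ih =>
    by_cases h : 1 ≤ t
    · calc _ ≤ ∑ k ∈ Finset.range (K + 1), ρ ^ k := by
            gcongr with k
            split_ifs
            · exact le_rfl
            · positivity
        _ ≤ (1 - ρ)⁻¹ * 1 := by
            rw [mul_one, ← one_div, le_div_iff₀ h1, geom_sum_mul_neg]
            linarith [pow_pos h0 (K + 1)]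
        _ ≤ _ := by gcongr
    · rw [Finset.sum_range_succ', pow_zero, if_neg h, add_zero]
      calc _ = ρ * ∑ k ∈ Finset.range K, (if ρ ^ k ≤ t / ρ then ρ ^ k else 0) := by
            rw [Finset.mul_sum]
            refine Finset.sum_congr rfl fun k _ => ?_
            simp only [le_div_iff₀ h0, ← pow_succ]
            split_ifs
            · ring
            · simp
        _ ≤ ρ * ((1 - ρ)⁻¹ * (t / ρ)) := by gcongr; exact ih (by positivity)
        _ = _ := by field_simp

theorem exists_sum_geom_le {ρ : ℝ} (h0 : 0 < ρ) (h1 : ρ ≠ 1) : ∃ C : ℝ, 0 ≤ C ∧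
    ∀ (t : ℝ) (K : ℕ) (a : ℕ → ℝ), 0 ≤ t → (∀ k, a k ≤ ρ ^ k) → (∀ k, t < ρ ^ k → a k ≤ 0) →
      ∑ k ∈ Finset.range K, a k ≤ C * t := by
  have key : ∃ C : ℝ, 0 ≤ C ∧ ∀ (t : ℝ) (K : ℕ), 0 ≤ t →
      ∑ k ∈ Finset.range K, (if ρ ^ k ≤ t then ρ ^ k else 0) ≤ C * t := by
    rcases lt_or_gt_of_ne h1 with h | h
    · exact ⟨(1 - ρ)⁻¹, inv_nonneg.2 (by linarith), fun t K ht => sum_geom_le_of_lt_one h0 h ht K⟩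
    · exact ⟨ρ / (ρ - 1), div_nonneg h0.le (by linarith),
        fun t K ht => sum_geom_le_of_one_lt h ht K⟩
  obtain ⟨C, hC, h⟩ := key
  refine ⟨C, hC, fun t K a ht ha ha' => (Finset.sum_le_sum fun k _ => ?_).trans (h t K ht)⟩
  split_ifs with hk
  · exact ha k
  · exact ha' k (not_le.1 hk)

/-- A sum of minima of an increasing and a decreasing geometric sequence. -/
theorem exists_sum_min_le {ρ : ℝ} (h0 : 0 < ρ) (h1 : ρ ≠ 1) : ∃ C : ℝ, 0 ≤ C ∧
    ∀ (X Y : ℝ) (K : ℕ) (a : ℕ → ℝ), 0 ≤ X → 0 ≤ Y → (∀ k < K, a k ≤ X * ρ ^ k) →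
      (∀ k < K, a k ≤ Y * (ρ ^ k)⁻¹) → ∑ k ∈ Finset.range K, a k ≤ C * √(X * Y) := by
  obtain ⟨C₁, hC₁, H₁⟩ := exists_sum_geom_le h0 h1
  obtain ⟨C₂, hC₂, H₂⟩ := exists_sum_geom_le (inv_pos.2 h0) (by simpa using h1)
  refine ⟨C₁ + C₂, by positivity, fun X Y K a hX hY ha hb => ?_⟩
  rcases hX.eq_or_lt with rfl | hX
  · have : ∑ k ∈ Finset.range K, a k ≤ 0 := Finset.sum_nonpos fun k hk => by
      simpa using ha k (Finset.mem_range.1 hk)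
    simpa using this
  rcases hY.eq_or_lt with rfl | hY
  · have : ∑ k ∈ Finset.range K, a k ≤ 0 := Finset.sum_nonpos fun k hk => by
      simpa using hb k (Finset.mem_range.1 hk)
    simpa using this
  have e1 : X * √(Y / X) = √(X * Y) := by
    rw [← sq_eq_sq₀ (by positivity) (by positivity), mul_pow, Real.sq_sqrt (by positivity),
      Real.sq_sqrt (by positivity)]
    field_simp
  have e2 : Y * √(X / Y) = √(X * Y) := by
    rw [← sq_eq_sq₀ (by positivity) (by positivity), mul_pow, Real.sq_sqrt (by positivity),
      Real.sq_sqrt (by positivity)]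
    field_simp
  have g1 := H₁ (√(Y / X)) K (fun k => if ρ ^ k ≤ √(Y / X) then ρ ^ k else 0) (by positivity)
    (fun k => by split_ifs; exacts [le_rfl, by positivity])
    (fun k hk => by rw [if_neg (not_le.2 hk)])
  have g2 := H₂ (√(X / Y)) K (fun k => if ρ⁻¹ ^ k ≤ √(X / Y) then ρ⁻¹ ^ k else 0) (by positivity)
    (fun k => by split_ifs; exacts [le_rfl, by positivity])
    (fun k hk => by rw [if_neg (not_le.2 hk)])
  calc ∑ k ∈ Finset.range K, a k
      ≤ ∑ k ∈ Finset.range K, (X * (if ρ ^ k ≤ √(Y / X) then ρ ^ k else 0) +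
          Y * (if ρ⁻¹ ^ k ≤ √(X / Y) then ρ⁻¹ ^ k else 0)) := by
        refine Finset.sum_le_sum fun k hkK => ?_
        rw [Finset.mem_range] at hkK
        by_cases hk : ρ ^ k ≤ √(Y / X)
        · rw [if_pos hk]
          have : 0 ≤ Y * (if ρ⁻¹ ^ k ≤ √(X / Y) then ρ⁻¹ ^ k else 0) := by positivity
          linarith [ha k hkK]
        · rw [if_neg hk, if_pos]
          · simpa using hb k hkK
          · rw [inv_pow, ← inv_div, Real.sqrt_inv]
            exact inv_anti₀ (by positivity) (not_le.1 hk).le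
    _ ≤ X * (C₁ * √(Y / X)) + Y * (C₂ * √(X / Y)) := by
        rw [Finset.sum_add_distrib, ← Finset.mul_sum, ← Finset.mul_sum]
        gcongr
    _ = (C₁ + C₂) * √(X * Y) := by
        rw [mul_left_comm, e1, mul_left_comm, e2]
        ring

theorem sum_weight_sq_L2Norm_mult_le {ι : Type*} (t : Finset ι) {w : ι → ℝ} {m : ι → ℝ → ℂ}
    {n : ℝ → ℂ} {C : ℝ} (hm : ∀ i, (m i).HasTemperateGrowth) (hn : n.HasTemperateGrowth)
    (h : ∀ ξ, ∑ i ∈ t, w i ^ 2 * ‖m i ξ‖ ^ 2 ≤ C * ‖n ξ‖ ^ 2) (f : 𝓢(ℝ, ℂ)) :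
    ∑ i ∈ t, (w i * L2Norm (mult (m i) f)) ^ 2 ≤ C * L2Norm (mult n f) ^ 2 := by
  simp_rw [mul_pow, sq_L2Norm_mult (hm _), sq_L2Norm_mult hn]
  simp_rw [← integral_const_mul]
  rw [← integral_finsetSum t fun i _ => (integrable_mult (hm i) f).const_mul _]
  refine integral_mono (integrable_finsetSum _ fun i _ => (integrable_mult (hm i) f).const_mul _)
    ((integrable_mult hn f).const_mul C) fun ξ => ?_
  have := mul_le_mul_of_nonneg_right (h ξ) (sq_nonneg ‖𝓕 f ξ‖)
  simpa [Finset.sum_mul, mul_assoc] using this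

theorem sq_two_pow_rpow (k : ℕ) (σ : ℝ) : (((2 : ℝ) ^ k) ^ σ) ^ 2 = ((4 : ℝ) ^ σ) ^ k := by
  rw [← Real.rpow_natCast, ← Real.rpow_mul (by positivity), ← Real.rpow_natCast 2,
    ← Real.rpow_mul (by positivity), ← Real.rpow_natCast, ← Real.rpow_mul (by positivity),
    show (4 : ℝ) = 2 ^ (2 : ℝ) by norm_num, ← Real.rpow_mul (by positivity)]
  congr 1
  push_cast
  ring

theorem four_rpow_pow (k : ℕ) (σ : ℝ) : ((4 : ℝ) ^ σ) ^ k = ((4 : ℝ) ^ k) ^ σ := by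
  rw [← Real.rpow_natCast, ← Real.rpow_mul (by positivity), ← Real.rpow_natCast 4,
    ← Real.rpow_mul (by positivity), mul_comm]

theorem four_rpow_ne_one {σ : ℝ} (h : σ ≠ 0) : (4 : ℝ) ^ σ ≠ 1 := by
  rcases lt_or_gt_of_ne h with h | h
  · exact (Real.rpow_lt_one_of_one_lt_of_neg (by norm_num) h).ne
  · exact (Real.one_lt_rpow (by norm_num) h).ne'

theorem four_pow_le_of_le {k : ℕ} {ξ : ℝ} (h : 2 ^ k ≤ |ξ|) :
    (4 : ℝ) ^ k ≤ 1 + (2 * Real.pi * ξ) ^ 2 := by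
  have h1 : ((2 : ℝ) ^ k) ^ 2 ≤ |ξ| ^ 2 := by gcongr
  rw [sq_abs, ← pow_mul, mul_comm k 2, pow_mul] at h1
  norm_num at h1
  nlinarith [Real.pi_gt_three, sq_nonneg ξ, mul_pow (2 * Real.pi) ξ 2, Real.pi_pos,
    mul_nonneg (sq_nonneg ξ) (by nlinarith [Real.pi_gt_three] : 0 ≤ 4 * Real.pi ^ 2 - 1)]

theorem le_four_pow_of_le {k n : ℕ} {ξ : ℝ} (h : |ξ| ≤ 2 ^ (k + n)) :
    1 + (2 * Real.pi * ξ) ^ 2 ≤ (100 * 4 ^ n) * 4 ^ k := by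
  have h1 : |ξ| ^ 2 ≤ ((2 : ℝ) ^ (k + n)) ^ 2 := by gcongr
  rw [sq_abs, ← pow_mul, mul_comm _ 2, pow_mul, pow_add] at h1
  norm_num at h1
  have h2 : (1 : ℝ) ≤ 4 ^ k := one_le_pow₀ (by norm_num)
  have h3 : (1 : ℝ) ≤ 4 ^ n := one_le_pow₀ (by norm_num)
  have h4 : Real.pi ^ 2 ≤ 16 := by nlinarith [Real.pi_lt_four, Real.pi_pos]
  have h5 : (1 : ℝ) ≤ 4 ^ k * 4 ^ n := one_le_mul_of_one_le_of_one_le h2 h3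
  nlinarith [mul_le_mul h4 h1 (sq_nonneg ξ) (by norm_num)]

/-- Pointwise form of the weighted square function estimates. -/
theorem exists_sum_weight_le {σ : ℝ} (hσ : σ ≠ 0) {c : ℝ} (hc : 0 < c) : ∃ C : ℝ, 0 ≤ C ∧
    ∀ (τ ξ : ℝ) (K : ℕ) (m : ℕ → ℂ), (∀ k, ‖m k‖ ≤ ‖jap τ ξ‖) →
      (∀ k, m k ≠ 0 → ((4 : ℝ) ^ k) ^ σ ≤ (c * (1 + (2 * Real.pi * ξ) ^ 2)) ^ σ) →
      ∑ k ∈ Finset.range K, (((2 : ℝ) ^ k) ^ σ) ^ 2 * ‖m k‖ ^ 2 ≤ C * ‖jap (τ + σ) ξ‖ ^ 2 := by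
  obtain ⟨C, hC, H⟩ := exists_sum_geom_le (ρ := (4 : ℝ) ^ σ) (by positivity) (four_rpow_ne_one hσ)
  refine ⟨C * c ^ σ, by positivity, fun τ ξ K m hm hm' => ?_⟩
  have h := H ((c * (1 + (2 * Real.pi * ξ) ^ 2)) ^ σ) K
    (fun k => if m k = 0 then 0 else (4 ^ σ) ^ k)
    (by positivity) (fun k => by split_ifs; exacts [by positivity, le_rfl]) (fun k hk => by
      by_cases h0 : m k = 0
      · simp [h0]
      · rw [four_rpow_pow] at hk
        exact absurd (hm' k h0) (not_le.2 hk))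
  calc _ ≤ ∑ k ∈ Finset.range K, (if m k = 0 then 0 else ((4 : ℝ) ^ σ) ^ k) * ‖jap τ ξ‖ ^ 2 := by
        refine Finset.sum_le_sum fun k _ => ?_
        split_ifs with h0
        · simp [h0]
        · rw [sq_two_pow_rpow]
          gcongr
          exact hm k
    _ ≤ C * (c * (1 + (2 * Real.pi * ξ) ^ 2)) ^ σ * ‖jap τ ξ‖ ^ 2 := by
        rw [← Finset.sum_mul]
        gcongr
    _ = _ := by
        rw [norm_jap_sq, norm_jap_sq, Real.mul_rpow hc.le (by positivity),
          Real.rpow_add (by positivity)]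
        ring

theorem sum_le_of_high {σ : ℝ} (hσ : 0 < σ) : ∃ C : ℝ, 0 ≤ C ∧
    ∀ (τ : ℝ) (m : ℕ → ℝ → ℂ), (∀ k, (m k).HasTemperateGrowth) →
      (∀ k ξ, ‖m k ξ‖ ≤ ‖jap τ ξ‖) → (∀ k ξ, m k ξ ≠ 0 → 2 ^ k ≤ |ξ|) →
      ∀ (f : 𝓢(ℝ, ℂ)) (K : ℕ),
        ∑ k ∈ Finset.range K, (((2 : ℝ) ^ k) ^ σ * L2Norm (mult (m k) f)) ^ 2 ≤
        (C * L2Norm (mult (jap (τ + σ)) f)) ^ 2 := by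
  obtain ⟨C, hC, H⟩ := exists_sum_weight_le hσ.ne' one_pos
  refine ⟨√C, by positivity, fun τ m hm h h' f K => ?_⟩
  rw [mul_pow, Real.sq_sqrt hC]
  refine sum_weight_sq_L2Norm_mult_le _ hm (hasTemperateGrowth_jap _) (fun ξ => ?_) f
  refine H τ ξ K (fun k => m k ξ) (fun k => h k ξ) fun k hk => ?_
  rw [one_mul]
  gcongr
  exact four_pow_le_of_le (h' k ξ hk)

theorem sum_le_of_low {σ : ℝ} (hσ : σ < 0) (n : ℕ) : ∃ C : ℝ, 0 ≤ C ∧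
    ∀ (τ : ℝ) (m : ℕ → ℝ → ℂ), (∀ k, (m k).HasTemperateGrowth) →
      (∀ k ξ, ‖m k ξ‖ ≤ ‖jap τ ξ‖) → (∀ k ξ, m k ξ ≠ 0 → |ξ| ≤ 2 ^ (k + n)) →
      ∀ (f : 𝓢(ℝ, ℂ)) (K : ℕ),
        ∑ k ∈ Finset.range K, (((2 : ℝ) ^ k) ^ σ * L2Norm (mult (m k) f)) ^ 2 ≤
        (C * L2Norm (mult (jap (τ + σ)) f)) ^ 2 := by
  obtain ⟨C, hC, H⟩ := exists_sum_weight_le hσ.ne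
    (inv_pos.2 (by positivity : (0 : ℝ) < 100 * 4 ^ n))
  refine ⟨√C, by positivity, fun τ m hm h h' f K => ?_⟩
  rw [mul_pow, Real.sq_sqrt hC]
  refine sum_weight_sq_L2Norm_mult_le _ hm (hasTemperateGrowth_jap _) (fun ξ => ?_) f
  refine H τ ξ K (fun k => m k ξ) (fun k => h k ξ) fun k hk => ?_
  refine Real.rpow_le_rpow_of_nonpos (by positivity) ?_ hσ.le
  rw [inv_mul_le_iff₀ (by positivity)]
  exact le_four_pow_of_le (h' k ξ hk)

theorem sum_le_of_annular (σ : ℝ) (n : ℕ) : ∃ C : ℝ, 0 ≤ C ∧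
    ∀ (τ : ℝ) (m : ℕ → ℝ → ℂ), (∀ k, (m k).HasTemperateGrowth) →
      (∀ k ξ, ‖m k ξ‖ ≤ ‖jap τ ξ‖) → (∀ k ξ, m k ξ ≠ 0 → 2 ^ k ≤ |ξ| ∧ |ξ| ≤ 2 ^ (k + n)) →
      ∀ (f : 𝓢(ℝ, ℂ)) (K : ℕ),
        ∑ k ∈ Finset.range K, (((2 : ℝ) ^ k) ^ σ * L2Norm (mult (m k) f)) ^ 2 ≤
        (C * L2Norm (mult (jap (τ + σ)) f)) ^ 2 := by
  rcases lt_trichotomy σ 0 with hσ | rfl | hσ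
  · obtain ⟨C, hC, H⟩ := sum_le_of_low hσ n
    exact ⟨C, hC, fun τ m hm h h' => H τ m hm h fun k ξ hk => (h' k ξ hk).2⟩
  · obtain ⟨C, hC, H⟩ := exists_sum_weight_le one_ne_zero one_pos
    refine ⟨√(100 * 4 ^ n * C), by positivity, fun τ m hm h h' f K => ?_⟩
    rw [mul_pow, Real.sq_sqrt (by positivity)]
    refine sum_weight_sq_L2Norm_mult_le _ hm (hasTemperateGrowth_jap _) (fun ξ => ?_) f
    have h1 := H τ ξ K (fun k => m k ξ) (fun k => h k ξ) fun k hk => by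
      rw [one_mul]
      gcongr
      exact four_pow_le_of_le (h' k ξ hk).1
    have hJ : 0 < 1 + (2 * Real.pi * ξ) ^ 2 := by positivity
    rw [norm_jap_sq, Real.rpow_add hJ, Real.rpow_one, ← norm_jap_sq] at h1
    rw [add_zero, ← mul_le_mul_iff_of_pos_right hJ]
    calc _ ≤ 100 * 4 ^ n * ∑ k ∈ Finset.range K, (((2 : ℝ) ^ k) ^ (1 : ℝ)) ^ 2 * ‖m k ξ‖ ^ 2 := by
          rw [Finset.sum_mul, Finset.mul_sum]
          refine Finset.sum_le_sum fun k _ => ?_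
          by_cases hk : m k ξ = 0
          · simp [hk]
          · have h2 := mul_le_mul_of_nonneg_left (le_four_pow_of_le (h' k ξ hk).2)
              (sq_nonneg ‖m k ξ‖)
            rw [sq_two_pow_rpow, sq_two_pow_rpow, Real.rpow_zero, one_pow, one_mul, Real.rpow_one]
            linarith
      _ ≤ 100 * 4 ^ n * (C * (‖jap τ ξ‖ ^ 2 * (1 + (2 * Real.pi * ξ) ^ 2))) := by gcongr
      _ = _ := by ring
  · obtain ⟨C, hC, H⟩ := sum_le_of_high hσ
    exact ⟨C, hC, fun τ m hm h h' => H τ m hm h fun k ξ hk => (h' k ξ hk).1⟩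

theorem jap_zero : jap 0 = fun _ => 1 := by
  ext ξ
  simp [jap]

theorem mult_jap_zero (f : 𝓢(ℝ, ℂ)) : mult (jap 0) f = f :=
  eq_of_fourier_eq fun ξ => by
    rw [fourier_mult (hasTemperateGrowth_jap 0), jap_zero, one_mul]

theorem norm_derivSymb_le (ξ : ℝ) : ‖derivSymb ξ‖ ≤ ‖jap 1 ξ‖ := by
  rw [norm_jap, ← Real.sqrt_eq_rpow]
  refine Real.le_sqrt_of_sq_le ?_
  simp [derivSymb, mul_pow]

theorem exists_sum_band_le (σ : ℝ) {a b : ℕ} (hab : a ≤ b) : ∃ C : ℝ, 0 ≤ C ∧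
    ∀ (f : 𝓢(ℝ, ℂ)) (K : ℕ),
      ∑ k ∈ Finset.range K, (((2 : ℝ) ^ k) ^ σ * L2Norm (mult (band (k + a) (k + b)) f)) ^ 2 ≤
        (C * L2Norm (mult (jap σ) f)) ^ 2 := by
  obtain ⟨C, hC, H⟩ := sum_le_of_annular σ (b + 1)
  refine ⟨C, hC, fun f K => ?_⟩
  simpa using H 0 (fun k => band (k + a) (k + b)) (fun k => hasTemperateGrowth_band _ _)
    (fun k ξ => by simpa [jap_zero] using norm_band_le _ _ ξ) (fun k ξ h => by
      obtain ⟨h1, h2⟩ := mem_of_band_ne_zero (by omega) h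
      exact ⟨(pow_le_pow_right₀ one_le_two (by omega)).trans h1.le, h2.le⟩) f K

theorem exists_sum_band_zero_le {a b : ℕ} (hab : a ≤ b) : ∃ C : ℝ, 0 ≤ C ∧
    ∀ (f : 𝓢(ℝ, ℂ)) (K : ℕ),
      ∑ k ∈ Finset.range K, L2Norm (mult (band (k + a) (k + b)) f) ^ 2 ≤ (C * L2Norm f) ^ 2 := by
  simpa [mult_jap_zero] using exists_sum_band_le 0 hab

theorem exists_sum_mul_low_le {σ : ℝ} (hσ : σ < 0) (a : ℕ) : ∃ C : ℝ, 0 ≤ C ∧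
    ∀ (τ : ℝ) (m : ℝ → ℂ), m.HasTemperateGrowth → (∀ ξ, ‖m ξ‖ ≤ ‖jap τ ξ‖) →
    ∀ (f : 𝓢(ℝ, ℂ)) (K : ℕ),
      ∑ k ∈ Finset.range K, (((2 : ℝ) ^ k) ^ σ * L2Norm (mult m (mult (low (k + a)) f))) ^ 2 ≤
        (C * L2Norm (mult (jap (τ + σ)) f)) ^ 2 := by
  obtain ⟨C, hC, H⟩ := sum_le_of_low hσ (a + 1)
  refine ⟨C, hC, fun τ m hm hmn f K => ?_⟩
  simp_rw [mult_mult hm (hasTemperateGrowth_low _)]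
  refine H τ (fun k ξ => m ξ * low (k + a) ξ) (fun k => hm.mul (hasTemperateGrowth_low _))
    (fun k ξ => ?_) (fun k ξ h => (lt_of_low_ne_zero (right_ne_zero_of_mul h)).le) f K
  rw [norm_mul, ← mul_one ‖jap τ ξ‖]
  gcongr
  exacts [hmn ξ, norm_low_le _ _]

theorem exists_sum_deriv_low_le (a : ℕ) : ∃ C : ℝ, 0 ≤ C ∧ ∀ (f : 𝓢(ℝ, ℂ)) (K : ℕ),
      ∑ k ∈ Finset.range K, ((1 / 2) ^ k * L2Norm (derivS (mult (low (k + a)) f))) ^ 2 ≤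
        (C * L2Norm f) ^ 2 := by
  obtain ⟨C, hC, H⟩ := exists_sum_mul_low_le (σ := -1) (by norm_num) a
  refine ⟨C, hC, fun f K => ?_⟩
  simpa [derivS_eq_mult, Real.rpow_neg_one, mult_jap_zero] using
    H 1 derivSymb hasTemperateGrowth_derivSymb norm_derivSymb_le f K

theorem lt_of_dil_bump_ne_zero {k : ℕ} {ξ : ℝ} (h : bump ((1 / 2) ^ k * ξ) ≠ 0) :
    2 ^ k < |ξ| ∧ |ξ| < 2 ^ (k + 2) := by
  contrapose! h
  by_cases h1 : |ξ| ≤ 2 ^ k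
  · apply bump_of_le
    rw [abs_pow_mul]
    exact div_le_one_of_le₀ h1 (by positivity)
  · apply bump_of_ge
    have := h (not_le.1 h1)
    rw [abs_pow_mul, le_div_iff₀ (by positivity)]
    rw [pow_add] at this
    linarith

/-- If the kernel `κ` has symbol of modulus `bump`, its dilates form a bounded square function. -/
theorem exists_sum_dil_bump_le : ∃ C : ℝ, 0 ≤ C ∧
    ∀ κ : 𝓢(ℝ, ℂ), (∀ ξ, ‖𝓕 κ ξ‖ = |bump ξ|) → ∀ (f : 𝓢(ℝ, ℂ)) (K : ℕ),
      ∑ k ∈ Finset.range K, L2Norm (mult (dil κ ((1 / 2) ^ k)) f) ^ 2 ≤ (C * L2Norm f) ^ 2 := by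
  obtain ⟨C, hC, H⟩ := sum_le_of_annular 0 2
  refine ⟨C, hC, fun κ hκ f K => ?_⟩
  simpa [mult_jap_zero] using H 0 (fun k => dil κ ((1 / 2) ^ k))
    (fun k => hasTemperateGrowth_dil _ _)
    (fun k ξ => by simpa [jap_zero, dil, hκ] using norm_bump_le _) (fun k ξ h => by
      have h1 : bump ((1 / 2) ^ k * ξ) ≠ 0 := by
        rwa [dil, ← norm_ne_zero_iff, hκ, abs_ne_zero] at h
      exact ⟨(lt_of_dil_bump_ne_zero h1).1.le, (lt_of_dil_bump_ne_zero h1).2.le⟩) f K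

/-- Paraproduct estimate with the low frequencies on `F` and `w`. -/
theorem exists_paraproduct_le : ∃ C : ℝ, 0 ≤ C ∧ ∀ (F G w : 𝓢(ℝ, ℂ)) (K : ℕ),
    ‖∑ k ∈ Finset.range K,
      ∫ x, mult (low (k + 4)) w x * mult (band k (k + 1)) F x * G x‖ ≤
        C * (supNorm F * (L2Norm w * L2Norm G)) := by
  obtain ⟨C₁, hC₁, H₁⟩ := supNorm_mult_low_le
  obtain ⟨C₂, hC₂, H₂⟩ := exists_sum_band_zero_le (a := 4) (b := 5) (by norm_num)
  obtain ⟨C₃, hC₃, H₃⟩ := exists_sum_band_zero_le (a := 2) (b := 7) (by norm_num)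
  refine ⟨2 * C₁ + C₁ * (C₂ * C₃), by positivity, fun F G w K => ?_⟩
  have habel : ∑ k ∈ Finset.range K,
      ∫ x, mult (low (k + 4)) w x * mult (band k (k + 1)) F x * G x =
      (∫ x, mult (low (K + 4)) w x * mult (low K) F x * G x) -
      (∫ x, mult (low 4) w x * mult (low 0) F x * G x) -
      ∑ k ∈ Finset.range K,
        ∫ x, mult (low (k + 1)) F x * mult (band (k + 4) (k + 5)) w x *
          mult (band (k + 2) (k + 7)) G x := by
    rw [eq_sub_iff_add_eq, ← Finset.sum_add_distrib]
    have h := Finset.sum_range_sub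
      (fun k => ∫ x, mult (low (k + 4)) w x * mult (low k) F x * G x) K
    rw [zero_add] at h
    rw [← h]
    refine Finset.sum_congr rfl fun k _ => ?_
    rw [← integral_localize (hasTemperateGrowth_low (k + 1))
      (hasTemperateGrowth_band (k + 4) (k + 5))
      (hasTemperateGrowth_band (k + 2) (k + 7)) (band_neg _ _)]
    · rw [← integral_add (integrable_mul_mul _ _ _) (integrable_mul_mul _ _ _),
        ← integral_sub (integrable_mul_mul _ _ _) (integrable_mul_mul _ _ _)]
      congr 1
      ext x
      rw [mult_band, mult_band, show k + 1 + 4 = k + 5 by ring]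
      simp only [sub_apply]
      ring
    · intro ξ η hξ hη
      have h1 := lt_of_low_ne_zero hξ
      obtain ⟨h2, h3⟩ := mem_of_band_ne_zero (by omega) hη
      have h4 : |η| ≤ |ξ + η| + |ξ| := by simpa using abs_sub (ξ + η) ξ
      have h5 := abs_add_le ξ η
      have h6 : (0 : ℝ) < 2 ^ k := by positivity
      apply band_of_mem
      · simp only [pow_add] at *
        linarith
      · simp only [pow_add] at *
        linarith
  have hB : ∀ j k : ℕ, ‖∫ x, mult (low j) w x * mult (low k) F x * G x‖ ≤
      C₁ * (supNorm F * (L2Norm w * L2Norm G)) := fun j k => by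
    have h1 := norm_integral_mul_mul_le' (mult (low j) w) (mult (low k) F) G
    have h2 := H₁ k F
    have h3 := L2Norm_mult_le zero_le_one (hasTemperateGrowth_low j) (hasTemperateGrowth_jap 0)
      (fun ξ => by simpa [jap_zero] using norm_low_le j ξ) w
    rw [mult_jap_zero, one_mul] at h3
    have h4 := supNorm_nonneg (mult (low k) F)
    have h5 := L2Norm_nonneg G
    have h6 := L2Norm_nonneg w
    have h7 := mul_nonneg (L2Norm_nonneg (mult (low j) w)) h5
    have h8 := mul_nonneg hC₁ (supNorm_nonneg F)
    calc _ ≤ _ := h1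
      _ ≤ (C₁ * supNorm F) * (L2Norm w * L2Norm G) := by gcongr
      _ = _ := by ring
  have hS : ‖∑ k ∈ Finset.range K,
        ∫ x, mult (low (k + 1)) F x * mult (band (k + 4) (k + 5)) w x *
          mult (band (k + 2) (k + 7)) G x‖ ≤
      C₁ * (C₂ * C₃) * (supNorm F * (L2Norm w * L2Norm G)) := by
    calc _ ≤ ∑ k ∈ Finset.range K, (C₁ * supNorm F) * (L2Norm (mult (band (k + 4) (k + 5)) w) *
          L2Norm (mult (band (k + 2) (k + 7)) G)) := by
          refine (norm_sum_le _ _).trans (Finset.sum_le_sum fun k _ => ?_)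
          refine (norm_integral_mul_mul_le _ _ _).trans ?_
          exact mul_le_mul_of_nonneg_right (H₁ _ _)
            (mul_nonneg (L2Norm_nonneg _) (L2Norm_nonneg _))
      _ ≤ (C₁ * supNorm F) * ((C₂ * L2Norm w) * (C₃ * L2Norm G)) := by
          rw [← Finset.mul_sum]
          refine mul_le_mul_of_nonneg_left ?_ (mul_nonneg hC₁ (supNorm_nonneg _))
          exact sum_mul_le_of_sq _ (mul_nonneg hC₂ (L2Norm_nonneg _))
            (mul_nonneg hC₃ (L2Norm_nonneg _)) (H₂ w K) (H₃ G K)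
      _ = _ := by ring
  rw [habel]
  refine (norm_sub_le _ _).trans ((add_le_add ((norm_sub_le _ _).trans
    (add_le_add (hB _ _) (hB _ _))) hS).trans_eq ?_)
  ring

theorem conjS_mult_dil (κ F : 𝓢(ℝ, ℂ)) (δ : ℝ) :
    conjS (mult (dil κ δ) F) = mult (dil (conjS κ) δ) (conjS F) := by
  have h : (fun ξ => conj (dil κ δ (-ξ))) = dil (conjS κ) δ := by
    ext ξ
    rw [dil, dil, fourier_conjS, mul_neg]
  rw [conjS_mult (hasTemperateGrowth_dil κ δ) (by rw [h]; exact hasTemperateGrowth_dil _ _), h]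

theorem integrable_abs_mul_norm (κ : 𝓢(ℝ, ℂ)) : Integrable fun z => |z| * ‖κ z‖ := by
  simpa using κ.integrable_pow_mul volume 1

/-- Quadratic expressions in the pieces of `F` behave like a function of bounded mean oscillation:
the twisted bump operators paired against an `L²` function. -/
theorem exists_quadratic_le : ∃ C : ℝ, 0 ≤ C ∧ ∀ (y : ℝ) (F w : 𝓢(ℝ, ℂ)) (K : ℕ),
    ‖∑ k ∈ Finset.range K, ∫ x, mult (dil (transS y bumpKernel) ((1 / 2) ^ k)) F x *
      conj (mult (dil (transS y bumpKernel) ((1 / 2) ^ k)) F x) * w x‖ ≤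
        C * (1 + |y|) * (L2Norm F * supNorm F * L2Norm w) := by
  obtain ⟨C₁, hC₁, H₁⟩ := exists_paraproduct_le
  obtain ⟨C₂, hC₂, H₂⟩ := exists_sum_deriv_low_le 4
  obtain ⟨C₃, hC₃, H₃⟩ := exists_sum_dil_bump_le
  set A := (∫ z, |z| * ‖bumpKernel z‖) + ∫ z, ‖bumpKernel z‖ with hA
  have hA0 : 0 ≤ A := add_nonneg (integral_nonneg fun z => by positivity)
    (integral_nonneg fun z => by positivity)
  refine ⟨C₁ + A * (C₂ * C₃), by positivity, fun y F w K => ?_⟩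
  set κ := transS y bumpKernel with hκ
  have hκn : ∀ ξ, ‖𝓕 κ ξ‖ = |bump ξ| := fun ξ => by
    rw [hκ, fourier_transS, norm_mul, Circle.norm_coe, one_mul, fourier_bumpKernel, norm_real,
      Real.norm_eq_abs]
  have hker : ∫ z, |z| * ‖conjS κ z‖ ≤ A * (1 + |y|) := by
    have h1 : ∫ z, |z| * ‖conjS κ z‖ = ∫ z, |z + y| * ‖bumpKernel z‖ := by
      rw [← integral_sub_right_eq_self (fun z => |z + y| * ‖bumpKernel z‖) y]
      simp [hκ]
    have h2 := (integrable_abs_mul_norm bumpKernel).add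
      ((bumpKernel.integrable (μ := volume)).norm.const_mul |y|)
    calc _ = _ := h1
      _ ≤ ∫ z, (|z| * ‖bumpKernel z‖ + |y| * ‖bumpKernel z‖) := by
          refine integral_mono_of_nonneg (Filter.Eventually.of_forall fun z => by positivity) h2
            (Filter.Eventually.of_forall fun z => ?_)
          simp only
          rw [← add_mul]
          gcongr
          exact abs_add_le z y
      _ = (∫ z, |z| * ‖bumpKernel z‖) + |y| * ∫ z, ‖bumpKernel z‖ := by
          rw [integral_add (integrable_abs_mul_norm bumpKernel)
            ((bumpKernel.integrable (μ := volume)).norm.const_mul |y|), integral_const_mul]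
      _ ≤ _ := by
          have h3 : 0 ≤ ∫ z, |z| * ‖bumpKernel z‖ := integral_nonneg fun z => by positivity
          have h4 : 0 ≤ ∫ z, ‖bumpKernel z‖ := integral_nonneg fun z => by positivity
          rw [hA]
          nlinarith [mul_nonneg h3 (abs_nonneg y), abs_nonneg y]
  set W : ℕ → 𝓢(ℝ, ℂ) := fun k => mult (low (k + 4)) w with hW
  set U : ℕ → 𝓢(ℝ, ℂ) := fun k => mult (dil κ ((1 / 2) ^ k)) F with hU
  have hterm : ∀ k : ℕ, ∫ x, U k x * conj (U k x) * w x =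
      (∫ x, W k x * mult (band k (k + 1)) F x * conjS F x) -
      ∫ x, (mult (dil (conjS κ) ((1 / 2) ^ k)) (mulS (W k) (conjS F)) x -
        W k x * mult (dil (conjS κ) ((1 / 2) ^ k)) (conjS F) x) * U k x := by
    intro k
    have e1 : ∫ x, U k x * conj (U k x) * w x =
        ∫ x, U k x * mult (dil (conjS κ) ((1 / 2) ^ k)) (conjS F) x * W k x := by
      rw [hU, hW]
      simp only
      rw [← integral_localize (hasTemperateGrowth_dil κ _) (hasTemperateGrowth_dil (conjS κ) _)
        (hasTemperateGrowth_low (k + 4)) (low_neg _)]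
      · rw [← conjS_mult_dil]
        simp
      · intro ξ η hξ hη
        have h1 : bump ((1 / 2) ^ k * ξ) ≠ 0 := by
          rwa [dil, ← norm_ne_zero_iff, hκn, abs_ne_zero] at hξ
        have h2 : bump ((1 / 2) ^ k * η) ≠ 0 := by
          rwa [dil, ← norm_ne_zero_iff, fourier_conjS, RCLike.norm_conj, hκn, bump_neg,
            abs_ne_zero] at hη
        have h3 := lt_of_dil_bump_ne_zero h1
        have h4 := lt_of_dil_bump_ne_zero h2
        have h5 := abs_add_le ξ η
        have h6 : (0 : ℝ) < 2 ^ k := by positivity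
        apply low_of_le
        simp only [pow_add] at *
        linarith
    have e2 : ∫ x, mult (dil (conjS κ) ((1 / 2) ^ k)) (mulS (W k) (conjS F)) x * U k x =
        ∫ x, W k x * mult (band k (k + 1)) F x * conjS F x := by
      have hn : (fun ξ => dil (conjS κ) ((1 / 2) ^ k) (-ξ)).HasTemperateGrowth := by
        simpa using hasTemperateGrowth_comp_mul
          (hasTemperateGrowth_dil (conjS κ) ((1 / 2) ^ k)) (-1)
      rw [integral_mult_mul (hasTemperateGrowth_dil _ _) hn]
      have h1 : mult (fun ξ => dil (conjS κ) ((1 / 2) ^ k) (-ξ)) (U k) =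
          mult (band k (k + 1)) F := by
        rw [hU]
        simp only
        rw [mult_mult hn (hasTemperateGrowth_dil κ _)]
        congr 2
        ext ξ
        rw [band_succ, dil, fourier_conjS, mul_neg, neg_neg, dil, mul_comm, Complex.mul_conj,
          Complex.normSq_eq_norm_sq, hκn, dil_bumpKernel, sq_abs, sq, ofReal_mul]
      rw [h1]
      congr 1
      ext x
      simp only [mulS_apply]
      ring
    rw [e1, ← e2, ← integral_sub (integrable_mulS _ _)]
    · congr 1
      ext x
      ring
    · convert (integrable_mulS
        (mult (dil (conjS κ) ((1 / 2) ^ k)) (mulS (W k) (conjS F))) (U k)).sub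
        (integrable_mul_mul (W k) (mult (dil (conjS κ) ((1 / 2) ^ k)) (conjS F)) (U k)) using 2
      simp
      ring
  simp only [hU] at hterm
  simp_rw [hterm]
  rw [Finset.sum_sub_distrib]
  have hmain := H₁ F (conjS F) w K
  have herr : ‖∑ k ∈ Finset.range K,
      ∫ x, (mult (dil (conjS κ) ((1 / 2) ^ k)) (mulS (W k) (conjS F)) x -
        W k x * mult (dil (conjS κ) ((1 / 2) ^ k)) (conjS F) x) * U k x‖ ≤
      A * (1 + |y|) * (supNorm F * ((C₂ * L2Norm w) * (C₃ * L2Norm F))) := by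
    calc _ ≤ ∑ k ∈ Finset.range K, A * (1 + |y|) * (supNorm F *
          (((1 / 2) ^ k * L2Norm (derivS (W k))) * L2Norm (U k))) := by
          refine (norm_sum_le _ _).trans (Finset.sum_le_sum fun k _ => ?_)
          refine (norm_integral_commutator_le_L2 _ _ _ _ (by positivity)).trans ?_
          rw [supNorm_conjS]
          have h1 := supNorm_nonneg F
          have h2 := L2Norm_nonneg (derivS (W k))
          have h3 := L2Norm_nonneg (U k)
          calc _ = (∫ z, |z| * ‖conjS κ z‖) * (supNorm F *
                (((1 / 2) ^ k * L2Norm (derivS (W k))) * L2Norm (U k))) := by ring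
            _ ≤ _ := by gcongr
      _ ≤ _ := by
          rw [← Finset.mul_sum, ← Finset.mul_sum]
          refine mul_le_mul_of_nonneg_left (mul_le_mul_of_nonneg_left ?_ (supNorm_nonneg _))
            (by positivity)
          exact sum_mul_le_of_sq _ (mul_nonneg hC₂ (L2Norm_nonneg _))
            (mul_nonneg hC₃ (L2Norm_nonneg _)) (H₂ w K) (H₃ κ hκn F K)
  refine (norm_sub_le _ _).trans ((add_le_add hmain herr).trans ?_)
  rw [L2Norm_conjS]
  have h1 : 0 ≤ C₁ * |y| * (L2Norm F * supNorm F * L2Norm w) := by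
    have := supNorm_nonneg F
    have := L2Norm_nonneg F
    have := L2Norm_nonneg w
    positivity
  linarith

theorem mult_dil_transS_apply (κ f : 𝓢(ℝ, ℂ)) (δ y x : ℝ) :
    mult (dil (transS y κ) δ) f x = mult (dil κ δ) f (x - δ * y) := by
  rw [mult_dil_apply, mult_dil_apply,
    ← integral_sub_right_eq_self (fun z => κ z * f (x - δ * y - δ * z)) y]
  congr 1
  ext z
  rw [transS_apply]
  congr 2
  ring

theorem continuous_inv_one_add_sq : Continuous fun z : ℝ => (1 + z ^ 2)⁻¹ :=
  (by fun_prop : Continuous fun z : ℝ => 1 + z ^ 2).inv₀ fun z => by positivity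

theorem inv_one_add_sq_sq_le (z : ℝ) : ((1 + z ^ 2) ^ 2)⁻¹ ≤ (1 + z ^ 2)⁻¹ := by
  refine inv_anti₀ (by positivity) ?_
  nlinarith [sq_nonneg z, sq_nonneg (z ^ 2)]

theorem integrable_inv_one_add_sq_sq : Integrable fun z : ℝ => ((1 + z ^ 2) ^ 2)⁻¹ := by
  refine integrable_inv_one_add_sq.mono'
    ((by fun_prop : Continuous fun z : ℝ => (1 + z ^ 2) ^ 2).inv₀
      fun z => by positivity).aestronglyMeasurable
    (Filter.Eventually.of_forall fun z => ?_)
  rw [Real.norm_of_nonneg (by positivity)]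
  exact inv_one_add_sq_sq_le z

theorem memLp_inv_one_add_sq_mul {h : ℝ → ℝ} (hh : Continuous h) {M : ℝ} (hM : ∀ z, |h z| ≤ M) :
    MemLp (fun z : ℝ => (1 + z ^ 2)⁻¹ * h z) 2 := by
  refine (memLp_two_iff_integrable_sq (f := fun z : ℝ => (1 + z ^ 2)⁻¹ * h z)
    (continuous_inv_one_add_sq.mul hh).aestronglyMeasurable).2 ?_
  refine (integrable_inv_one_add_sq_sq.mul_const (M ^ 2)).mono'
    ((continuous_inv_one_add_sq.mul hh).pow 2).aestronglyMeasurable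
    (Filter.Eventually.of_forall fun z => ?_)
  rw [Real.norm_of_nonneg (by positivity), mul_pow, inv_pow]
  refine mul_le_mul_of_nonneg_left ?_ (by positivity)
  rw [← sq_abs]
  have := hM z
  gcongr

theorem sq_integral_inv_mul_le {h : ℝ → ℝ} (hh : Continuous h) {M : ℝ} (hM : ∀ z, |h z| ≤ M)
    (h0 : ∀ z, 0 ≤ h z) :
    (∫ z, ((1 + z ^ 2) ^ 2)⁻¹ * h z) ^ 2 ≤ Real.pi * ∫ z, ((1 + z ^ 2) ^ 2)⁻¹ * h z ^ 2 := by
  have h1 := L2Norm_le_of_sq_integrable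
    (memLp_inv_one_add_sq_mul (h := fun _ => 1) continuous_const (M := 1) (by simp))
    (memLp_inv_one_add_sq_mul hh hM)
  have e1 : ∀ z : ℝ, |(1 + z ^ 2)⁻¹ * 1| * |(1 + z ^ 2)⁻¹ * h z| = ((1 + z ^ 2) ^ 2)⁻¹ * h z := by
    intro z
    have := h0 z
    rw [abs_of_nonneg (by positivity), abs_of_nonneg (by positivity)]
    field_simp
  have e2 : ∀ z : ℝ, ((1 + z ^ 2)⁻¹ * h z) ^ 2 = ((1 + z ^ 2) ^ 2)⁻¹ * h z ^ 2 := fun z => by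
    rw [mul_pow, inv_pow]
  simp_rw [e1, e2] at h1
  have h2 : ∫ z : ℝ, ((1 + z ^ 2)⁻¹ * 1) ^ 2 ≤ Real.pi := by
    rw [← integral_univ_inv_one_add_sq]
    refine integral_mono (by simpa using integrable_inv_one_add_sq_sq) integrable_inv_one_add_sq
      fun z => ?_
    simpa using inv_one_add_sq_sq_le z
  have h3 : 0 ≤ ∫ z, ((1 + z ^ 2) ^ 2)⁻¹ * h z := integral_nonneg fun z => by
    have := h0 z
    positivity
  have h4 : 0 ≤ ∫ z : ℝ, ((1 + z ^ 2) ^ 2)⁻¹ * h z ^ 2 := integral_nonneg fun z => by positivity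
  calc _ ≤ (√(∫ z : ℝ, ((1 + z ^ 2)⁻¹ * 1) ^ 2) * √(∫ z, ((1 + z ^ 2) ^ 2)⁻¹ * h z ^ 2)) ^ 2 := by
        gcongr
    _ ≤ _ := by
        rw [mul_pow, Real.sq_sqrt (integral_nonneg fun z => by positivity), Real.sq_sqrt h4]
        gcongr

theorem sq_norm_mult_dil_le {κ : 𝓢(ℝ, ℂ)} {B : ℝ} (hκ : ∀ z, ‖κ z‖ ≤ B * ((1 + z ^ 2) ^ 2)⁻¹)
    (E : 𝓢(ℝ, ℂ)) (δ x : ℝ) : ‖mult (dil κ δ) E x‖ ^ 2 ≤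
      B ^ 2 * Real.pi * ∫ z, ((1 + z ^ 2) ^ 2)⁻¹ * ‖E (x - δ * z)‖ ^ 2 := by
  have hc : Continuous fun z => ‖E (x - δ * z)‖ := by fun_prop
  have h1 : ‖mult (dil κ δ) E x‖ ≤ B * ∫ z, ((1 + z ^ 2) ^ 2)⁻¹ * ‖E (x - δ * z)‖ := by
    rw [mult_dil_apply, ← integral_const_mul]
    refine (norm_integral_le_integral_norm _).trans ?_
    refine integral_mono_of_nonneg (Filter.Eventually.of_forall fun _ => norm_nonneg _) ?_
      (Filter.Eventually.of_forall fun z => ?_)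
    · refine Integrable.const_mul ?_ _
      refine integrable_inv_one_add_sq_sq.mul_bdd (c := supNorm E) hc.aestronglyMeasurable
        (Filter.Eventually.of_forall fun z => ?_)
      rw [norm_norm]
      exact norm_le_supNorm _ _
    · simp only [norm_mul]
      rw [← mul_assoc]
      gcongr
      exact hκ z
  calc _ ≤ (B * ∫ z, ((1 + z ^ 2) ^ 2)⁻¹ * ‖E (x - δ * z)‖) ^ 2 := by gcongr
    _ ≤ _ := by
      rw [mul_pow, mul_assoc]
      gcongr
      exact sq_integral_inv_mul_le hc (fun z => by
        rw [abs_norm]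
        exact norm_le_supNorm E _) fun z => norm_nonneg _

theorem integrable_prod_aux (E : 𝓢(ℝ, ℂ)) (δ : ℝ) {N : ℝ → ℝ} (hN : Integrable N) :
    Integrable (fun p : ℝ × ℝ => ((1 + p.2 ^ 2) ^ 2)⁻¹ * ‖E (p.1 - δ * p.2)‖ ^ 2 * N p.1)
      (volume.prod volume) := by
  have h1 := hN.mul_prod integrable_inv_one_add_sq_sq
  have hc : Continuous fun p : ℝ × ℝ => ‖E (p.1 - δ * p.2)‖ ^ 2 := by fun_prop
  have h2 := h1.mul_bdd (c := supNorm E ^ 2) hc.aestronglyMeasurable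
    (Filter.Eventually.of_forall fun p => by
      rw [norm_pow, norm_norm]
      gcongr
      exact norm_le_supNorm _ _)
  refine h2.congr (Filter.Eventually.of_forall fun p => ?_)
  simp only
  ring

/-- The square function of a family of pieces of `F`, with a further averaging against
uniformly decaying kernels, satisfies an `L⁴` bound in terms of `L²` and `L^∞`. -/
theorem exists_L2Norm_sum_sq_le (B : ℝ) : ∃ C : ℝ, 0 ≤ C ∧ ∀ κ : ℕ → 𝓢(ℝ, ℂ),
    (∀ k z, ‖κ k z‖ ≤ B * ((1 + z ^ 2) ^ 2)⁻¹) → ∀ (F : 𝓢(ℝ, ℂ)) (K : ℕ),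
    L2Norm (fun x => ((∑ k ∈ Finset.range K, ‖mult (dil (κ k) ((1 / 2) ^ k))
      (mult (dil bumpKernel ((1 / 2) ^ k)) F) x‖ ^ 2 : ℝ) : ℂ)) ≤ C * (L2Norm F * supNorm F) := by
  obtain ⟨C, hC, H⟩ := exists_quadratic_le
  refine ⟨B ^ 2 * Real.pi * (2 * C * Real.pi), by positivity, fun κ hκ F K => ?_⟩
  set E : ℕ → 𝓢(ℝ, ℂ) := fun k => mult (dil bumpKernel ((1 / 2) ^ k)) F with hE
  set V : ℕ → 𝓢(ℝ, ℂ) := fun k => mult (dil (κ k) ((1 / 2) ^ k)) (E k) with hV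
  set w : 𝓢(ℝ, ℂ) := ∑ k ∈ Finset.range K, mulS (V k) (conjS (V k)) with hw
  set N : ℝ → ℝ := fun x => ∑ k ∈ Finset.range K, ‖V k x‖ ^ 2 with hN
  have hwN : ∀ x, w x = (N x : ℂ) := fun x => by
    simp [hw, hN, Complex.mul_conj, Complex.normSq_eq_norm_sq]
  have hN0 : ∀ x, 0 ≤ N x := fun x => Finset.sum_nonneg fun k _ => by positivity
  have hwN' : ∀ x, ‖w x‖ = N x := fun x => by
    rw [hwN, norm_real, Real.norm_of_nonneg (hN0 x)]
  have hNi : Integrable N := by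
    have := (w.integrable (μ := volume)).norm
    simpa only [hwN'] using this
  have hgoal : L2Norm (fun x => (N x : ℂ)) = L2Norm w := by
    congr 1
    ext x
    rw [hwN]
  change L2Norm (fun x => (N x : ℂ)) ≤ _
  rw [hgoal]
  set P : ℕ → ℝ → ℝ := fun k z => ∫ x, ‖E k (x - (1 / 2) ^ k * z)‖ ^ 2 * N x with hP
  have hP0 : ∀ k z, 0 ≤ P k z := fun k z => integral_nonneg fun x =>
    mul_nonneg (by positivity) (hN0 x)
  have hPsum : ∀ z, ∑ k ∈ Finset.range K, P k z ≤
      C * (1 + |z|) * (L2Norm F * supNorm F * L2Norm w) := by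
    intro z
    refine le_trans (le_of_eq ?_) (H z F w K)
    have h1 : ∑ k ∈ Finset.range K, ∫ x, mult (dil (transS z bumpKernel) ((1 / 2) ^ k)) F x *
        conj (mult (dil (transS z bumpKernel) ((1 / 2) ^ k)) F x) * w x =
        ((∑ k ∈ Finset.range K, P k z : ℝ) : ℂ) := by
      rw [ofReal_sum]
      refine Finset.sum_congr rfl fun k _ => ?_
      rw [hP, ← integral_complex_ofReal]
      congr 1
      ext x
      rw [mult_dil_transS_apply, hwN, Complex.mul_conj, Complex.normSq_eq_norm_sq]
      push_cast
      rfl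
    rw [h1, norm_real, Real.norm_of_nonneg (Finset.sum_nonneg fun k _ => hP0 k z)]
  have h_integrable := fun k => integrable_prod_aux (E k) ((1 / 2) ^ k) hNi
  have hPe : ∀ k z, ((1 + z ^ 2) ^ 2)⁻¹ * P k z =
      ∫ x, ((1 + z ^ 2) ^ 2)⁻¹ * ‖E k (x - (1 / 2) ^ k * z)‖ ^ 2 * N x := fun k z => by
    rw [hP, ← integral_const_mul]
    simp_rw [mul_assoc]
  have hPi : ∀ k, Integrable fun z : ℝ => ((1 + z ^ 2) ^ 2)⁻¹ * P k z := fun k => by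
    simp_rw [hPe]
    exact (h_integrable k).integral_prod_right
  have hVk : ∀ k, ∫ x, ‖V k x‖ ^ 2 * N x ≤
      B ^ 2 * Real.pi * ∫ z, ((1 + z ^ 2) ^ 2)⁻¹ * P k z := by
    intro k
    simp_rw [hPe]
    rw [← integral_integral_swap (h_integrable k), ← integral_const_mul]
    refine integral_mono_of_nonneg (Filter.Eventually.of_forall fun x =>
      mul_nonneg (by positivity) (hN0 x)) ((h_integrable k).integral_prod_left.const_mul _)
      (Filter.Eventually.of_forall fun x => ?_)
    simp only
    rw [integral_mul_const, ← mul_assoc]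
    exact mul_le_mul_of_nonneg_right (sq_norm_mult_dil_le (hκ k) (E k) _ x) (hN0 x)
  have hVi : ∀ k, Integrable fun x => ‖V k x‖ ^ 2 * N x := fun k => by
    have := (integrable_mul_mul (V k) (V k) w).norm
    simpa [hwN', sq] using this
  have hfin : L2Norm w ^ 2 ≤ B ^ 2 * Real.pi * (2 * C * Real.pi) * (L2Norm F * supNorm F) *
      L2Norm w := by
    calc L2Norm w ^ 2 = ∑ k ∈ Finset.range K, ∫ x, ‖V k x‖ ^ 2 * N x := by
          rw [sq_L2Norm, ← integral_finsetSum _ fun k _ => hVi k]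
          congr 1
          ext x
          rw [hwN', ← Finset.sum_mul, sq]
      _ ≤ ∑ k ∈ Finset.range K, B ^ 2 * Real.pi * ∫ z, ((1 + z ^ 2) ^ 2)⁻¹ * P k z :=
          Finset.sum_le_sum fun k _ => hVk k
      _ = B ^ 2 * Real.pi * ∫ z, ((1 + z ^ 2) ^ 2)⁻¹ * ∑ k ∈ Finset.range K, P k z := by
          rw [← Finset.mul_sum, ← integral_finsetSum _ fun k _ => hPi k]
          simp_rw [Finset.mul_sum]
      _ ≤ B ^ 2 * Real.pi *
          ∫ z, (2 * C * (L2Norm F * supNorm F * L2Norm w)) * (1 + z ^ 2)⁻¹ := by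
          refine mul_le_mul_of_nonneg_left ?_ (by positivity)
          refine integral_mono_of_nonneg (Filter.Eventually.of_forall fun z =>
            mul_nonneg (by positivity) (Finset.sum_nonneg fun k _ => hP0 k z))
            (integrable_inv_one_add_sq.const_mul _) (Filter.Eventually.of_forall fun z => ?_)
          have hX : 0 ≤ L2Norm F * supNorm F * L2Norm w :=
            mul_nonneg (mul_nonneg (L2Norm_nonneg _) (supNorm_nonneg _)) (L2Norm_nonneg _)
          have hz : 1 + |z| ≤ 2 * (1 + z ^ 2) := by
            rw [← sq_abs]
            nlinarith [sq_nonneg (|z| - 1), abs_nonneg z]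
          calc _ ≤ ((1 + z ^ 2) ^ 2)⁻¹ *
                (C * (2 * (1 + z ^ 2)) * (L2Norm F * supNorm F * L2Norm w)) := by
                refine mul_le_mul_of_nonneg_left ((hPsum z).trans ?_) (by positivity)
                gcongr
            _ = _ := by field_simp
      _ = _ := by
          rw [integral_const_mul, integral_univ_inv_one_add_sq]
          ring
  rcases (L2Norm_nonneg w).eq_or_lt with h | h
  · rw [← h]
    have := supNorm_nonneg F
    have := L2Norm_nonneg F
    positivity
  · rw [sq] at hfin
    exact le_of_mul_le_mul_right hfin h

theorem mult_const_mul (c : ℂ) {m : ℝ → ℂ} (hm : m.HasTemperateGrowth) (f : 𝓢(ℝ, ℂ)) :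
    mult (fun ξ => c * m ξ) f = c • mult m f := by
  apply eq_of_fourier_eq
  intro ξ
  have h : (fun ξ => c * m ξ).HasTemperateGrowth := by fun_prop
  have h1 : 𝓕 (c • mult m f) ξ = c • 𝓕 (mult m f) ξ := by
    rw [FourierTransform.fourier_smul]
    rfl
  rw [h1, fourier_mult h, fourier_mult hm, smul_eq_mul, mul_assoc]

theorem supNorm_smul (c : ℂ) (f : 𝓢(ℝ, ℂ)) : supNorm (c • f : 𝓢(ℝ, ℂ)) = ‖c‖ * supNorm f := by
  simp only [supNorm, smul_apply, norm_smul]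
  rw [Real.mul_iSup_of_nonneg (norm_nonneg c)]

theorem exists_decay (κ : 𝓢(ℝ, ℂ)) : ∃ B : ℝ, 0 ≤ B ∧ ∀ z, ‖κ z‖ ≤ B * ((1 + z ^ 2) ^ 2)⁻¹ := by
  set B := 2 ^ 4 * (Finset.Iic ((4, 0) : ℕ × ℕ)).sup
    (fun m => SchwartzMap.seminorm ℝ (E := ℝ) (F := ℂ) m.1 m.2) κ
  have hB : ∀ z, ‖κ z‖ ≤ B * ((1 + z ^ 2) ^ 2)⁻¹ := fun z => by
    rw [← div_eq_mul_inv, le_div_iff₀ (by positivity), mul_comm]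
    have h := SchwartzMap.one_add_le_sup_seminorm_apply (𝕜 := ℝ) (m := (4, 0)) (k := 4) (n := 0)
      le_rfl le_rfl κ z
    rw [norm_iteratedFDeriv_zero, Real.norm_eq_abs] at h
    refine le_trans ?_ h
    gcongr
    calc (1 + z ^ 2) ^ 2 ≤ ((1 + |z|) ^ 2) ^ 2 := by
          gcongr
          rw [← sq_abs]
          nlinarith [abs_nonneg z]
      _ = _ := by ring
  refine ⟨B, ?_, hB⟩
  have := (norm_nonneg _).trans (hB 0)
  simpa using this

theorem integral_norm_le_of_decay {κ : 𝓢(ℝ, ℂ)} {B : ℝ}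
    (hκ : ∀ z, ‖κ z‖ ≤ B * ((1 + z ^ 2) ^ 2)⁻¹) : ∫ z, ‖κ z‖ ≤ B * Real.pi := by
  have hB : 0 ≤ B := by
    have := (norm_nonneg _).trans (hκ 0)
    simpa using this
  rw [← integral_univ_inv_one_add_sq, ← integral_const_mul]
  refine integral_mono κ.integrable.norm (integrable_inv_one_add_sq.const_mul B) fun z => ?_
  refine (hκ z).trans ?_
  exact mul_le_mul_of_nonneg_left (inv_one_add_sq_sq_le z) hB

theorem integral_abs_mul_norm_le_of_decay {κ : 𝓢(ℝ, ℂ)} {B : ℝ}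
    (hκ : ∀ z, ‖κ z‖ ≤ B * ((1 + z ^ 2) ^ 2)⁻¹) : ∫ z, |z| * ‖κ z‖ ≤ B * Real.pi := by
  have hB : 0 ≤ B := by
    have := (norm_nonneg _).trans (hκ 0)
    simpa using this
  rw [← integral_univ_inv_one_add_sq, ← integral_const_mul]
  refine integral_mono (integrable_abs_mul_norm κ) (integrable_inv_one_add_sq.const_mul B)
    fun z => ?_
  have h1 : |z| ≤ 1 + z ^ 2 := by
    rw [← sq_abs]
    nlinarith [sq_nonneg (|z| - 1), abs_nonneg z]
  calc |z| * ‖κ z‖ ≤ (1 + z ^ 2) * (B * ((1 + z ^ 2) ^ 2)⁻¹) := by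
        gcongr
        exact hκ z
    _ = B * (1 + z ^ 2)⁻¹ := by field_simp

/-- The kernel of the symbol `bump ξ / (2πiξ)`. -/
theorem exists_primitiveKernel : ∃ α : 𝓢(ℝ, ℂ), ∀ η, 𝓕 α η * derivSymb η = (bump η : ℂ) := by
  have hd : ∀ η : ℝ, η ≠ 0 → derivSymb η ≠ 0 := fun η hη => by
    simp [derivSymb, hη, Real.pi_ne_zero]
  have h : ContDiff ℝ ∞ fun η : ℝ => (bump η : ℂ) / derivSymb η := by
    rw [contDiff_iff_contDiffAt]
    intro η
    rcases eq_or_ne η 0 with rfl | hη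
    · refine (contDiffAt_const (c := (0 : ℂ))).congr_of_eventuallyEq ?_
      filter_upwards [Metric.ball_mem_nhds (0 : ℝ) one_pos] with η hη
      have : |η| ≤ 1 := by simpa using (Metric.mem_ball.1 hη).le
      simp [bump_of_le this]
    · simp_rw [div_eq_mul_inv]
      exact (Complex.ofRealCLM.contDiff.comp contDiff_bump).contDiffAt.mul
        (hasTemperateGrowth_derivSymb.1.contDiffAt.inv (hd η hη))
  obtain ⟨α, hα⟩ := exists_kernel h (R := 4) fun η hη => by simp [bump_of_ge hη.le]
  refine ⟨α, fun η => ?_⟩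
  rw [hα]
  rcases eq_or_ne η 0 with rfl | hη
  · simp [derivSymb, bump_of_le]
  · rw [div_mul_cancel₀ _ (hd η hη)]

theorem mult_band_succ_eq {α : 𝓢(ℝ, ℂ)} (hα : ∀ η, 𝓕 α η * derivSymb η = (bump η : ℂ)) (k : ℕ)
    (f : 𝓢(ℝ, ℂ)) : mult (band k (k + 1)) f = ((1 / 2 : ℂ) ^ k) •
      mult (dil α ((1 / 2) ^ k)) (mult (dil bumpKernel ((1 / 2) ^ k)) (derivS f)) := by
  apply eq_of_fourier_eq
  intro ξ
  rw [FourierTransform.fourier_smul, smul_apply, fourier_mult (hasTemperateGrowth_band _ _),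
    fourier_mult (hasTemperateGrowth_dil _ _), fourier_mult (hasTemperateGrowth_dil _ _),
    fourier_derivS, band_succ]
  have h := hα ((1 / 2) ^ k * ξ)
  have h1 : dil bumpKernel ((1 / 2) ^ k) ξ =
      𝓕 α ((1 / 2) ^ k * ξ) * ((1 / 2) ^ k * derivSymb ξ) := by
    rw [dil_bumpKernel, ← h]
    congr 1
    simp [derivSymb]
    ring
  nth_rewrite 1 [h1]
  rw [smul_eq_mul, dil]
  simp only [dil]
  ring

theorem exists_supNorm_mult_band_succ_le : ∃ C : ℝ, 0 ≤ C ∧ ∀ (k : ℕ) (f : 𝓢(ℝ, ℂ)),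
    supNorm (mult (band k (k + 1)) f) ≤ C * ((2 : ℝ) ^ k)⁻¹ * supNorm (derivS f) := by
  obtain ⟨α, hα⟩ := exists_primitiveKernel
  have h1 : 0 ≤ ∫ z, ‖α z‖ := integral_nonneg fun z => norm_nonneg _
  have h2 : 0 ≤ ∫ z, ‖bumpKernel z‖ := integral_nonneg fun z => norm_nonneg _
  refine ⟨(∫ z, ‖α z‖) * ∫ z, ‖bumpKernel z‖, by positivity, fun k f => ?_⟩
  rw [mult_band_succ_eq hα, supNorm_smul]
  calc _ ≤ ‖(1 / 2 : ℂ) ^ k‖ * ((∫ z, ‖α z‖) * ((∫ z, ‖bumpKernel z‖) * supNorm (derivS f))) := by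
        gcongr
        refine (supNorm_mult_dil_le _ _ _).trans ?_
        gcongr
        exact supNorm_mult_dil_le _ _ _
    _ = _ := by
        simp
        ring

theorem contDiff_cut_mul (n : ℕ) : ContDiff ℝ ∞ fun η : ℝ => cut ((1 / 2) ^ n * η) :=
  contDiff_cut.comp (by fun_prop)

/-- On an annulus, the Bessel potential is a dilated averaging operator. -/
theorem exists_bessel_band_kernel (s : ℝ) {a b : ℕ} (hab : a ≤ b) : ∃ B : ℝ, 0 ≤ B ∧
    ∀ k : ℕ, ∃ κ : 𝓢(ℝ, ℂ), (∀ z, ‖κ z‖ ≤ B * ((1 + z ^ 2) ^ 2)⁻¹) ∧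
      ∀ ξ, jap s ξ * band (k + a) (k + b) ξ =
        ((((2 : ℝ) ^ k) ^ s : ℝ) : ℂ) * dil κ ((1 / 2) ^ k) ξ := by
  have hz : ∀ (n : ℕ) (ξ : ℝ), (cut ((1 / 2) ^ n * ξ) : ℂ) = low n ξ :=
    fun n ξ => (low_apply n ξ).symm
  obtain ⟨B, hB, H⟩ := exists_bessel_kernel s
    (ρ := fun η => ((cut ((1 / 2) ^ b * η) - cut ((1 / 2) ^ a * η) : ℝ) : ℂ))
    (Complex.ofRealCLM.contDiff.comp ((contDiff_cut_mul b).sub (contDiff_cut_mul a)))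
    (r := 2 ^ a) (R := 2 ^ (b + 1)) (by positivity) (by positivity)
    (fun η hη => by
      rw [ofReal_sub, hz, hz]
      exact band_of_le hab hη)
    (fun η hη => by
      rw [ofReal_sub, hz, hz]
      exact band_of_ge hab hη.le)
  refine ⟨B, hB, fun k => ?_⟩
  obtain ⟨κ, h1, h2⟩ := H k
  refine ⟨κ, h1, fun ξ => ?_⟩
  rw [← h2 ξ, jap, band, low_apply, low_apply, pow_add, pow_add]
  push_cast
  ring_nf

theorem exists_supNorm_jap_band_le (s : ℝ) {a b : ℕ} (hab : a ≤ b) : ∃ C : ℝ, 0 ≤ C ∧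
    ∀ (k : ℕ) (g : 𝓢(ℝ, ℂ)), supNorm (mult (jap s) (mult (band (k + a) (k + b)) g)) ≤
      C * ((2 : ℝ) ^ k) ^ s * supNorm g := by
  obtain ⟨B, hB, H⟩ := exists_bessel_band_kernel s hab
  refine ⟨B * Real.pi, by positivity, fun k g => ?_⟩
  obtain ⟨κ, h1, h2⟩ := H k
  rw [mult_mult (hasTemperateGrowth_jap s) (hasTemperateGrowth_band _ _), funext h2,
    mult_const_mul _ (hasTemperateGrowth_dil _ _), supNorm_smul, norm_real,
    Real.norm_of_nonneg (by positivity)]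
  calc _ ≤ ((2 : ℝ) ^ k) ^ s * (B * Real.pi * supNorm g) := by
        gcongr
        refine (supNorm_mult_dil_le _ _ _).trans ?_
        exact mul_le_mul_of_nonneg_right (integral_norm_le_of_decay h1) (supNorm_nonneg g)
    _ = _ := by ring

theorem exists_supNorm_jap_low_le (s : ℝ) (n : ℕ) : ∃ C : ℝ, 0 ≤ C ∧
    ∀ g : 𝓢(ℝ, ℂ), supNorm (mult (jap s) (mult (low n) g)) ≤ C * supNorm g := by
  obtain ⟨κ, hκ⟩ := exists_kernel (ρ := fun η => jap s η * low n η)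
    ((hasTemperateGrowth_jap s).1.mul (hasTemperateGrowth_low n).1) (R := 2 ^ (n + 1))
    fun η hη => by rw [low_of_ge hη.le, mul_zero]
  refine ⟨∫ z, ‖κ z‖, integral_nonneg fun z => norm_nonneg _, fun g => ?_⟩
  have h : (fun ξ => jap s ξ * low n ξ) = dil κ 1 := by
    ext ξ
    rw [dil, one_mul, hκ]
  rw [mult_mult (hasTemperateGrowth_jap s) (hasTemperateGrowth_low _), h]
  exact supNorm_mult_dil_le _ _ _

theorem exists_sum_mul_band_le (σ : ℝ) {a b : ℕ} (hab : a ≤ b) : ∃ C : ℝ, 0 ≤ C ∧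
    ∀ (τ : ℝ) (m : ℝ → ℂ), m.HasTemperateGrowth → (∀ ξ, ‖m ξ‖ ≤ ‖jap τ ξ‖) →
    ∀ (f : 𝓢(ℝ, ℂ)) (K : ℕ),
      ∑ k ∈ Finset.range K,
        (((2 : ℝ) ^ k) ^ σ * L2Norm (mult m (mult (band (k + a) (k + b)) f))) ^ 2 ≤
        (C * L2Norm (mult (jap (τ + σ)) f)) ^ 2 := by
  obtain ⟨C, hC, H⟩ := sum_le_of_annular σ (b + 1)
  refine ⟨C, hC, fun τ m hm hmn f K => ?_⟩
  simp_rw [mult_mult hm (hasTemperateGrowth_band _ _)]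
  refine H τ (fun k ξ => m ξ * band (k + a) (k + b) ξ)
    (fun k => hm.mul (hasTemperateGrowth_band _ _))
    (fun k ξ => ?_) (fun k ξ h => ?_) f K
  · rw [norm_mul, ← mul_one ‖jap τ ξ‖]
    gcongr
    exacts [hmn ξ, norm_band_le _ _ _]
  · obtain ⟨h1, h2⟩ := mem_of_band_ne_zero (by omega) (right_ne_zero_of_mul h)
    exact ⟨(pow_le_pow_right₀ one_le_two (by omega)).trans h1.le, h2.le⟩

theorem integral_mul_norm_le {p : ℝ → ℝ} (hp : Continuous p) (h0 : ∀ x, 0 ≤ p x)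
    (hi : Integrable fun x => p x ^ 2) (H : 𝓢(ℝ, ℂ)) :
    Integrable (fun x => p x * ‖H x‖) ∧ ∫ x, p x * ‖H x‖ ≤ √(∫ x, p x ^ 2) * L2Norm H := by
  have h1 : MemLp p 2 := (memLp_two_iff_integrable_sq hp.aestronglyMeasurable).2 hi
  have h2 := (H.memLp 2 (μ := volume)).norm
  refine ⟨h1.integrable_mul h2, ?_⟩
  simpa [abs_of_nonneg (h0 _), L2Norm] using L2Norm_le_of_sq_integrable h1 h2

theorem integral_sqrt_sum_mul_norm_le (t : ℕ → ℝ) (w : ℕ → 𝓢(ℝ, ℂ)) (K : ℕ) {M : ℝ} (hM : 0 ≤ M)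
    (h : ∑ k ∈ Finset.range K, (t k * L2Norm (w k)) ^ 2 ≤ M ^ 2) (H : 𝓢(ℝ, ℂ)) :
    Integrable (fun x => √(∑ k ∈ Finset.range K, (t k * ‖w k x‖) ^ 2) * ‖H x‖) ∧
      ∫ x, √(∑ k ∈ Finset.range K, (t k * ‖w k x‖) ^ 2) * ‖H x‖ ≤ M * L2Norm H := by
  have hs : ∀ x, √(∑ k ∈ Finset.range K, (t k * ‖w k x‖) ^ 2) ^ 2 =
      ∑ k ∈ Finset.range K, t k ^ 2 * ‖w k x‖ ^ 2 := fun x => by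
    rw [Real.sq_sqrt (Finset.sum_nonneg fun k _ => sq_nonneg _)]
    simp_rw [mul_pow]
  have hi : ∀ k ∈ Finset.range K, Integrable fun x => t k ^ 2 * ‖w k x‖ ^ 2 := fun k _ =>
    (integrable_norm_sq (w k)).const_mul _
  obtain ⟨h1, h2⟩ := integral_mul_norm_le
    (p := fun x => √(∑ k ∈ Finset.range K, (t k * ‖w k x‖) ^ 2))
    (Continuous.sqrt (by fun_prop)) (fun x => Real.sqrt_nonneg _) (by
      simp_rw [hs]
      exact integrable_finsetSum _ hi) H
  refine ⟨h1, h2.trans (mul_le_mul_of_nonneg_right ?_ (L2Norm_nonneg H))⟩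
  rw [Real.sqrt_le_left hM]
  simp_rw [hs]
  rw [integral_finsetSum _ hi]
  refine le_of_eq_of_le (Finset.sum_congr rfl fun k _ => ?_) h
  rw [integral_const_mul, mul_pow, sq_L2Norm]

theorem sqrt_mul_mul_le {P Q : ℝ} (hP : 0 ≤ P) (hQ : 0 ≤ Q) : √(P * Q) ≤ P + Q := by
  rw [Real.sqrt_le_left (by positivity)]
  nlinarith [mul_nonneg hP hQ, sq_nonneg P, sq_nonneg Q]

theorem sum_integral_mul_mul_eq (u v : ℕ → 𝓢(ℝ, ℂ)) (H : 𝓢(ℝ, ℂ)) (K : ℕ) :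
    ∑ k ∈ Finset.range K, ∫ x, ‖u k x‖ * ‖v k x‖ * ‖H x‖ =
      ∫ x, (∑ k ∈ Finset.range K, ‖u k x‖ * ‖v k x‖) * ‖H x‖ := by
  simp_rw [Finset.sum_mul]
  rw [integral_finsetSum]
  intro k _
  simpa using (integrable_mul_mul (u k) (v k) H).norm

/-- The high-high interactions, away from the critical exponent. -/
theorem exists_highHigh_le_of_ne {s : ℝ} (h1 : s ≠ 1) : ∃ C : ℝ, 0 ≤ C ∧
    ∀ (f g H : 𝓢(ℝ, ℂ)) (K : ℕ),
      ∑ k ∈ Finset.range K, ∫ x, ‖mult (band (k + 3) (k + 4)) f x‖ *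
        ‖mult (jap s) (mult (band k (k + 7)) g) x‖ * ‖H x‖ ≤
      C * (L2Norm (mult (jap s) f) * supNorm g +
        supNorm (derivS f) * L2Norm (mult (jap (s - 1)) g)) * L2Norm H := by
  obtain ⟨C₁, hC₁, H₁⟩ := exists_supNorm_mult_band_succ_le
  obtain ⟨C₂, hC₂, H₂⟩ := exists_supNorm_jap_band_le s (a := 0) (b := 7) (by norm_num)
  obtain ⟨C₃, hC₃, H₃⟩ := exists_sum_band_le s (a := 3) (b := 4) (by norm_num)
  obtain ⟨C₄, hC₄, H₄⟩ := exists_sum_mul_band_le (-1) (a := 0) (b := 7) (by norm_num)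
  obtain ⟨C₅, hC₅, H₅⟩ := exists_sum_min_le (ρ := 2 * (2 ^ s)⁻¹) (by positivity) (fun h => h1 (by
    have h3 : (2 : ℝ) ^ s = 2 ^ (1 : ℝ) := by
      rw [Real.rpow_one]
      field_simp at h
      exact h.symm
    exact (Real.rpow_right_inj (by norm_num) (by norm_num)).1 h3))
  have hρ : ∀ k : ℕ, (2 * ((2 : ℝ) ^ s)⁻¹) ^ k = 2 ^ k * (((2 : ℝ) ^ k) ^ s)⁻¹ := fun k => by
    rw [mul_pow, inv_pow, ← Real.rpow_natCast (2 ^ s), ← Real.rpow_mul (by norm_num), mul_comm s,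
      Real.rpow_mul (by norm_num), Real.rpow_natCast]
  refine ⟨C₅ * (C₃ + C₁ * C₂ * C₄), by positivity, fun f g H K => ?_⟩
  set u : ℕ → 𝓢(ℝ, ℂ) := fun k => mult (band (k + 3) (k + 4)) f with hu
  set v : ℕ → 𝓢(ℝ, ℂ) := fun k => mult (jap s) (mult (band k (k + 7)) g) with hv
  set b := supNorm g
  set c := supNorm (derivS f)
  have hb : 0 ≤ b := supNorm_nonneg g
  have hc : 0 ≤ c := supNorm_nonneg (derivS f)
  obtain ⟨i1, I1⟩ := integral_sqrt_sum_mul_norm_le (fun k => ((2 : ℝ) ^ k) ^ s) u K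
    (mul_nonneg hC₃ (L2Norm_nonneg _)) (H₃ f K) H
  obtain ⟨i2, I2⟩ := integral_sqrt_sum_mul_norm_le (fun k => ((2 : ℝ) ^ k) ^ (-1 : ℝ)) v K
    (mul_nonneg hC₄ (L2Norm_nonneg _))
    (H₄ s (jap s) (hasTemperateGrowth_jap s) (fun _ => le_rfl) g K) H
  set a : ℝ → ℝ := fun x => √(∑ k ∈ Finset.range K, (((2 : ℝ) ^ k) ^ s * ‖u k x‖) ^ 2)
  set d : ℝ → ℝ := fun x => √(∑ k ∈ Finset.range K, (((2 : ℝ) ^ k) ^ (-1 : ℝ) * ‖v k x‖) ^ 2)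
  have ha0 : ∀ x, 0 ≤ a x := fun x => Real.sqrt_nonneg _
  have hd0 : ∀ x, 0 ≤ d x := fun x => Real.sqrt_nonneg _
  have hle : ∀ x, ∀ k < K, ((2 : ℝ) ^ k) ^ s * ‖u k x‖ ≤ a x := fun x k hk =>
    Real.le_sqrt_of_sq_le (Finset.single_le_sum
      (f := fun k => (((2 : ℝ) ^ k) ^ s * ‖u k x‖) ^ 2) (fun _ _ => sq_nonneg _)
      (Finset.mem_range.2 hk))
  have hle' : ∀ x, ∀ k < K, ((2 : ℝ) ^ k)⁻¹ * ‖v k x‖ ≤ d x := fun x k hk => by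
    rw [← Real.rpow_neg_one]
    exact Real.le_sqrt_of_sq_le (Finset.single_le_sum
      (f := fun k => (((2 : ℝ) ^ k) ^ (-1 : ℝ) * ‖v k x‖) ^ 2) (fun _ _ => sq_nonneg _)
      (Finset.mem_range.2 hk))
  have hpt : ∀ x, ∑ k ∈ Finset.range K, ‖u k x‖ * ‖v k x‖ ≤
      C₅ * (b * a x + C₁ * C₂ * c * d x) := fun x => by
    have hax := ha0 x
    have hdx := hd0 x
    refine (H₅ (a x * d x) (C₁ * C₂ * (b * c)) K _ (by positivity) (by positivity)
      (fun k hk => ?_) fun k hk => ?_).trans ?_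
    · have h2 : (0 : ℝ) < (2 ^ k) ^ s := by positivity
      rw [hρ]
      calc ‖u k x‖ * ‖v k x‖ = (((2 : ℝ) ^ k) ^ s * ‖u k x‖) * (((2 : ℝ) ^ k)⁻¹ * ‖v k x‖) *
            (2 ^ k * (((2 : ℝ) ^ k) ^ s)⁻¹) := by field_simp
        _ ≤ _ := by
          gcongr
          exacts [hle x k hk, hle' x k hk]
    · have h2 : (0 : ℝ) < (2 ^ k) ^ s := by positivity
      have h3 : ‖u k x‖ ≤ C₁ * ((2 : ℝ) ^ k)⁻¹ * c := by
        refine (norm_le_supNorm _ x).trans ((H₁ (k + 3) f).trans ?_)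
        gcongr <;> norm_num
      have h4 : ‖v k x‖ ≤ C₂ * ((2 : ℝ) ^ k) ^ s * b := (norm_le_supNorm _ x).trans (H₂ k g)
      rw [hρ]
      calc ‖u k x‖ * ‖v k x‖ ≤ (C₁ * ((2 : ℝ) ^ k)⁻¹ * c) * (C₂ * ((2 : ℝ) ^ k) ^ s * b) := by
            gcongr
        _ = _ := by
          field_simp
    · gcongr
      rw [show a x * d x * (C₁ * C₂ * (b * c)) = (b * a x) * (C₁ * C₂ * c * d x) by ring]
      exact sqrt_mul_mul_le (by positivity) (by positivity)
  rw [sum_integral_mul_mul_eq]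
  calc _ ≤ ∫ x, (C₅ * b) * (a x * ‖H x‖) + (C₅ * (C₁ * C₂ * c)) * (d x * ‖H x‖) := by
        refine integral_mono_of_nonneg (Filter.Eventually.of_forall fun x => by positivity)
          ((i1.const_mul _).add (i2.const_mul _)) (Filter.Eventually.of_forall fun x => ?_)
        simp only
        calc _ ≤ C₅ * (b * a x + C₁ * C₂ * c * d x) * ‖H x‖ :=
              mul_le_mul_of_nonneg_right (hpt x) (norm_nonneg _)
          _ = _ := by ring
    _ = (C₅ * b) * (∫ x, a x * ‖H x‖) + (C₅ * (C₁ * C₂ * c)) * (∫ x, d x * ‖H x‖) := by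
        rw [integral_add (i1.const_mul _) (i2.const_mul _), integral_const_mul, integral_const_mul]
    _ ≤ (C₅ * b) * (C₃ * L2Norm (mult (jap s) f) * L2Norm H) +
        (C₅ * (C₁ * C₂ * c)) * (C₄ * L2Norm (mult (jap (s + -1)) g) * L2Norm H) := by gcongr
    _ ≤ _ := by
        rw [← sub_eq_add_neg]
        set A := L2Norm (mult (jap s) f)
        set D := L2Norm (mult (jap (s - 1)) g)
        have hA : 0 ≤ A := L2Norm_nonneg _
        have hD : 0 ≤ D := L2Norm_nonneg _
        have hH := L2Norm_nonneg H
        have e1 : 0 ≤ C₅ * C₃ * (c * D) * L2Norm H := by positivity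
        have e2 : 0 ≤ C₅ * (C₁ * C₂ * C₄) * (A * b) * L2Norm H := by positivity
        linarith

/-- The high-high interactions at the critical exponent. -/
theorem exists_highHigh_le_one : ∃ C : ℝ, 0 ≤ C ∧
    ∀ (f g H : 𝓢(ℝ, ℂ)) (K : ℕ),
      ∑ k ∈ Finset.range K, ∫ x, ‖mult (band (k + 3) (k + 4)) f x‖ *
        ‖mult (jap 1) (mult (band k (k + 7)) g) x‖ * ‖H x‖ ≤
      C * (L2Norm (mult (jap 1) f) * supNorm g +
        supNorm (derivS f) * L2Norm (mult (jap (1 - 1)) g)) * L2Norm H := by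
  obtain ⟨α, hα⟩ := exists_primitiveKernel
  obtain ⟨B, -, hB⟩ := exists_decay α
  obtain ⟨B', -, Hκ⟩ := exists_bessel_kernel 1 (ρ := fun η => (bump η : ℂ))
    (Complex.ofRealCLM.contDiff.comp contDiff_bump) (r := 1) (R := 4) one_pos (by norm_num)
    (fun η hη => by simp [bump_of_le hη]) (fun η hη => by simp [bump_of_ge hη.le])
  choose κ hκ hκ' using Hκ
  obtain ⟨C₁, hC₁, H₁⟩ := exists_L2Norm_sum_sq_le B
  obtain ⟨C₂, hC₂, H₂⟩ := exists_L2Norm_sum_sq_le B'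
  refine ⟨16 * √(C₁ * C₂), by positivity, fun f g H K => ?_⟩
  rw [sub_self, mult_jap_zero]
  set X : ℕ → 𝓢(ℝ, ℂ) := fun j =>
    mult (dil α ((1 / 2) ^ j)) (mult (dil bumpKernel ((1 / 2) ^ j)) (derivS f)) with hX
  set Y : ℕ → 𝓢(ℝ, ℂ) := fun j =>
    mult (dil (κ j) ((1 / 2) ^ j)) (mult (dil bumpKernel ((1 / 2) ^ j)) g) with hY
  have hfX : ∀ j, mult (band j (j + 1)) f = ((1 / 2 : ℂ) ^ j) • X j :=
    fun j => mult_band_succ_eq hα j f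
  have hgY : ∀ j, mult (jap 1) (mult (band j (j + 1)) g) = ((2 : ℂ) ^ j) • Y j := fun j => by
    apply eq_of_fourier_eq
    intro ξ
    have h := hκ' j ξ
    rw [Real.rpow_one, ← dil_bumpKernel] at h
    rw [FourierTransform.fourier_smul, smul_apply, fourier_mult (hasTemperateGrowth_jap _),
      fourier_mult (hasTemperateGrowth_band _ _), fourier_mult (hasTemperateGrowth_dil _ _),
      fourier_mult (hasTemperateGrowth_dil _ _), band_succ, jap, smul_eq_mul]
    push_cast at h ⊢
    linear_combination (dil bumpKernel ((1 / 2) ^ j) ξ * 𝓕 g ξ) * h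
  set N : (ℕ → 𝓢(ℝ, ℂ)) → 𝓢(ℝ, ℂ) := fun V => ∑ k ∈ Finset.range (K + 7), mulS (V k) (conjS (V k))
    with hN
  have hNa : ∀ V x, N V x = ((∑ k ∈ Finset.range (K + 7), ‖V k x‖ ^ 2 : ℝ) : ℂ) := fun V x => by
    simp [hN, sum_apply, Complex.mul_conj, Complex.normSq_eq_norm_sq]
  have hNn : ∀ V x, ‖N V x‖ = ∑ k ∈ Finset.range (K + 7), ‖V k x‖ ^ 2 := fun V x => by
    rw [hNa, norm_real, Real.norm_of_nonneg (Finset.sum_nonneg fun k _ => sq_nonneg _)]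
  have hX2 : L2Norm (N X) ≤ C₁ * (L2Norm (derivS f) * supNorm (derivS f)) := by
    rw [show ⇑(N X) = _ from funext (hNa X)]
    exact H₁ (fun _ => α) (fun _ => hB) (derivS f) (K + 7)
  have hY2 : L2Norm (N Y) ≤ C₂ * (L2Norm g * supNorm g) := by
    rw [show ⇑(N Y) = _ from funext (hNa Y)]
    exact H₂ κ hκ g (K + 7)
  obtain ⟨i1, I1⟩ := integral_mul_norm_le (p := fun x => √(‖N X x‖ * ‖N Y x‖))
    (Continuous.sqrt (by fun_prop)) (fun x => Real.sqrt_nonneg _) (by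
      simp_rw [Real.sq_sqrt (mul_nonneg (norm_nonneg (N X _)) (norm_nonneg (N Y _)))]
      exact integrable_norm_mul _ _) H
  simp_rw [Real.sq_sqrt (mul_nonneg (norm_nonneg (N X _)) (norm_nonneg (N Y _)))] at I1
  have hpt : ∀ x, ∑ k ∈ Finset.range K, ‖mult (band (k + 3) (k + 4)) f x‖ *
        ‖mult (jap 1) (mult (band k (k + 7)) g) x‖ ≤ 16 * √(‖N X x‖ * ‖N Y x‖) := fun x => by
    have hsum : ∀ (V : ℕ → 𝓢(ℝ, ℂ)), ∀ i ≤ 7,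
        ∑ k ∈ Finset.range K, ‖V (k + i) x‖ ^ 2 ≤ √‖N V x‖ ^ 2 := fun V i hi => by
      rw [Real.sq_sqrt (norm_nonneg _), hNn,
        ← Finset.sum_image (f := fun k => ‖V k x‖ ^ 2) (g := fun k => k + i) (by simp)]
      refine Finset.sum_le_sum_of_subset_of_nonneg (fun k hk => ?_) fun _ _ _ => sq_nonneg _
      simp only [Finset.mem_image, Finset.mem_range] at hk ⊢
      omega
    have hi : ∀ i ≤ 7, ∑ k ∈ Finset.range K, ‖X (k + 3) x‖ * ‖Y (k + i) x‖ ≤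
        √(‖N X x‖ * ‖N Y x‖) := fun i hi => by
      rw [Real.sqrt_mul (norm_nonneg _)]
      exact sum_mul_le_of_sq _ (Real.sqrt_nonneg _) (Real.sqrt_nonneg _)
        (hsum X 3 (by norm_num)) (hsum Y i hi)
    calc _ ≤ ∑ k ∈ Finset.range K, ∑ i ∈ Finset.range 7,
          (2 : ℝ) ^ i / 8 * (‖X (k + 3) x‖ * ‖Y (k + i) x‖) := by
          refine Finset.sum_le_sum fun k _ => ?_
          have e1 : mult (jap 1) (mult (band k (k + 7)) g) =
              ∑ i ∈ Finset.range 7, ((2 : ℂ) ^ (k + i)) • Y (k + i) := by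
            simp_rw [← hgY, ← map_sum]
            congr 1
            simp_rw [mult_band]
            exact (Finset.sum_range_sub (fun i => mult (low (k + i)) g) 7).symm
          rw [e1, hfX (k + 3), sum_apply]
          calc _ ≤ ‖((1 / 2 : ℂ) ^ (k + 3) • X (k + 3)) x‖ *
                ∑ i ∈ Finset.range 7, ‖((2 : ℂ) ^ (k + i) • Y (k + i)) x‖ := by
                gcongr
                exact norm_sum_le _ _
            _ = _ := by
                rw [Finset.mul_sum]
                refine Finset.sum_congr rfl fun i _ => ?_
                simp [pow_add]
                field_simp
                norm_num
                ring
      _ = ∑ i ∈ Finset.range 7, (2 : ℝ) ^ i / 8 *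
          ∑ k ∈ Finset.range K, ‖X (k + 3) x‖ * ‖Y (k + i) x‖ := by
          rw [Finset.sum_comm]
          simp_rw [Finset.mul_sum]
      _ ≤ ∑ i ∈ Finset.range 7, (2 : ℝ) ^ i / 8 * √(‖N X x‖ * ‖N Y x‖) := by
          refine Finset.sum_le_sum fun i hi' => ?_
          gcongr
          exact hi i (Finset.mem_range.1 hi').le
      _ ≤ _ := by
          rw [← Finset.sum_mul]
          gcongr
          norm_num [Finset.sum_range_succ]
  have hdf : L2Norm (derivS f) ≤ L2Norm (mult (jap 1) f) := by
    have := L2Norm_mult_le zero_le_one hasTemperateGrowth_derivSymb (hasTemperateGrowth_jap 1)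
      (fun ξ => by simpa using norm_derivSymb_le ξ) f
    rwa [one_mul, ← derivS_eq_mult] at this
  have hb : 0 ≤ supNorm g := supNorm_nonneg g
  have hc : 0 ≤ supNorm (derivS f) := supNorm_nonneg (derivS f)
  have hA : 0 ≤ L2Norm (mult (jap 1) f) := L2Norm_nonneg _
  have hD : 0 ≤ L2Norm g := L2Norm_nonneg _
  have hH := L2Norm_nonneg H
  rw [sum_integral_mul_mul_eq (fun k => mult (band (k + 3) (k + 4)) f)
    (fun k => mult (jap 1) (mult (band k (k + 7)) g))]
  calc _ ≤ ∫ x, 16 * (√(‖N X x‖ * ‖N Y x‖) * ‖H x‖) := by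
        refine integral_mono_of_nonneg (Filter.Eventually.of_forall fun x => by positivity)
          (i1.const_mul _) (Filter.Eventually.of_forall fun x => ?_)
        simp only
        rw [← mul_assoc]
        exact mul_le_mul_of_nonneg_right (hpt x) (norm_nonneg _)
    _ ≤ 16 * (√(∫ x, ‖N X x‖ * ‖N Y x‖) * L2Norm H) := by
        rw [integral_const_mul]
        gcongr
    _ ≤ 16 * (√((C₁ * (L2Norm (mult (jap 1) f) * supNorm (derivS f))) *
          (C₂ * (L2Norm g * supNorm g))) * L2Norm H) := by
        gcongr
        refine (integral_norm_mul_le _ _).trans ?_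
        refine mul_le_mul (hX2.trans ?_) hY2 (L2Norm_nonneg _) (by positivity)
        gcongr
    _ = 16 * √(C₁ * C₂) * √((L2Norm (mult (jap 1) f) * supNorm g) *
          (supNorm (derivS f) * L2Norm g)) * L2Norm H := by
        rw [mul_assoc 16, ← Real.sqrt_mul (by positivity)]
        ring_nf
    _ ≤ _ := by
        gcongr
        exact sqrt_mul_mul_le (by positivity) (by positivity)

theorem exists_highHigh_le (s : ℝ) : ∃ C : ℝ, 0 ≤ C ∧
    ∀ (f g H : 𝓢(ℝ, ℂ)) (K : ℕ),
      ∑ k ∈ Finset.range K, ∫ x, ‖mult (band (k + 3) (k + 4)) f x‖ *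
        ‖mult (jap s) (mult (band k (k + 7)) g) x‖ * ‖H x‖ ≤
      C * (L2Norm (mult (jap s) f) * supNorm g +
        supNorm (derivS f) * L2Norm (mult (jap (s - 1)) g)) * L2Norm H := by
  rcases eq_or_ne s 1 with rfl | h
  exacts [exists_highHigh_le_one, exists_highHigh_le_of_ne h]

/-- The right-hand side of the commutator estimate. -/
noncomputable def commBound (s : ℝ) (f g : 𝓢(ℝ, ℂ)) : ℝ :=
  L2Norm (mult (jap s) f) * supNorm g + supNorm (derivS f) * L2Norm (mult (jap (s - 1)) g)

/-- The commutator of the Bessel potential with multiplication by `a`, tested against `H`. -/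
noncomputable def commForm (s : ℝ) (a b H : 𝓢(ℝ, ℂ)) : ℂ :=
  (∫ x, a x * b x * mult (jap s) H x) - ∫ x, a x * mult (jap s) b x * H x

theorem left_le_commBound (s : ℝ) (f g : 𝓢(ℝ, ℂ)) :
    L2Norm (mult (jap s) f) * supNorm g ≤ commBound s f g :=
  le_add_of_nonneg_right (mul_nonneg (supNorm_nonneg _) (L2Norm_nonneg _))

theorem right_le_commBound (s : ℝ) (f g : 𝓢(ℝ, ℂ)) :
    supNorm (derivS f) * L2Norm (mult (jap (s - 1)) g) ≤ commBound s f g :=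
  le_add_of_nonneg_left (mul_nonneg (L2Norm_nonneg _) (supNorm_nonneg _))

theorem L2Norm_mult_le_self {m : ℝ → ℂ} (hm : m.HasTemperateGrowth) (h : ∀ ξ, ‖m ξ‖ ≤ 1)
    (f : 𝓢(ℝ, ℂ)) : L2Norm (mult m f) ≤ L2Norm f := by
  have := L2Norm_mult_le zero_le_one hm (hasTemperateGrowth_jap 0)
    (fun ξ => by simpa [jap_zero] using h ξ) f
  rwa [mult_jap_zero, one_mul] at this

theorem L2Norm_mult_low_le (k : ℕ) (f : 𝓢(ℝ, ℂ)) : L2Norm (mult (low k) f) ≤ L2Norm f :=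
  L2Norm_mult_le_self (hasTemperateGrowth_low k) (norm_low_le k) f

theorem le_L2Norm_mult_jap {s : ℝ} (hs : 0 ≤ s) (f : 𝓢(ℝ, ℂ)) :
    L2Norm f ≤ L2Norm (mult (jap s) f) := by
  have := L2Norm_mult_le zero_le_one (hasTemperateGrowth_jap 0) (hasTemperateGrowth_jap s)
    (fun ξ => by
      rw [jap_zero, norm_one, one_mul, norm_jap]
      exact Real.one_le_rpow (by nlinarith [sq_nonneg (2 * Real.pi * ξ)]) (by positivity)) f
  rwa [mult_jap_zero, one_mul] at this

theorem exists_L2Norm_jap_low_le (s : ℝ) (n : ℕ) : ∃ C : ℝ, 0 ≤ C ∧ ∀ f : 𝓢(ℝ, ℂ),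
    L2Norm (mult (jap s) (mult (low n) f)) ≤ C * L2Norm f := by
  have hc : Continuous fun ξ => ‖jap s ξ * low n ξ‖ :=
    ((hasTemperateGrowth_jap s).1.continuous.mul (hasTemperateGrowth_low n).1.continuous).norm
  obtain ⟨M, hM⟩ := (isCompact_closedBall (0 : ℝ) (2 ^ (n + 1))).exists_bound_of_continuousOn
    hc.continuousOn
  refine ⟨max M 0, le_max_right _ _, fun f => ?_⟩
  rw [mult_mult (hasTemperateGrowth_jap s) (hasTemperateGrowth_low n)]
  have := L2Norm_mult_le (C := max M 0) (le_max_right _ _)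
    ((hasTemperateGrowth_jap s).mul (hasTemperateGrowth_low n)) (hasTemperateGrowth_jap 0)
    (fun ξ => ?_) f
  · rwa [mult_jap_zero] at this
  · rw [jap_zero, norm_one, mul_one]
    by_cases h : |ξ| ≤ 2 ^ (n + 1)
    · have := hM ξ (by simpa using h)
      rw [norm_norm] at this
      exact this.trans (le_max_left _ _)
    · rw [Pi.mul_apply, low_of_ge (not_le.1 h).le, mul_zero, norm_zero]
      exact le_max_right _ _

theorem exists_commForm_low_le {s : ℝ} (hs : 0 < s) : ∃ C : ℝ, 0 ≤ C ∧ ∀ f g H : 𝓢(ℝ, ℂ),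
    ‖commForm s (mult (low 3) f) (mult (low 6) g) H‖ ≤ C * commBound s f g * L2Norm H := by
  obtain ⟨C₁, hC₁, H₁⟩ := supNorm_mult_low_le
  obtain ⟨C₂, hC₂, H₂⟩ := exists_L2Norm_jap_low_le s 8
  obtain ⟨C₃, hC₃, H₃⟩ := exists_supNorm_jap_low_le s 6
  refine ⟨C₁ * C₂ + C₃, by positivity, fun f g H => ?_⟩
  have hf := (L2Norm_mult_low_le 3 f).trans (le_L2Norm_mult_jap hs.le f)
  have hH := L2Norm_nonneg H
  have hA := L2Norm_nonneg (mult (jap s) f)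
  have hb := supNorm_nonneg g
  have hl : ∀ ξ η, low 3 ξ ≠ 0 → low 6 η ≠ 0 → low 8 (ξ + η) = 1 := fun ξ η hξ hη => by
    have h1 := lt_of_low_ne_zero hξ
    have h2 := lt_of_low_ne_zero hη
    have h3 := abs_add_le ξ η
    apply low_of_le
    norm_num at *
    linarith
  have e1 : ‖∫ x, mult (low 3) f x * mult (low 6) g x * mult (jap s) H x‖ ≤
      C₁ * C₂ * (L2Norm (mult (jap s) f) * supNorm g) * L2Norm H := by
    rw [integral_localize (hasTemperateGrowth_low 3) (hasTemperateGrowth_low 6)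
      (hasTemperateGrowth_low 8) (low_neg 8) hl,
      mult_comm (hasTemperateGrowth_low 8) (hasTemperateGrowth_jap s)]
    refine (norm_integral_mul_mul_le' _ _ _).trans ?_
    calc _ ≤ (C₁ * supNorm g) * (L2Norm (mult (jap s) f) * (C₂ * L2Norm H)) :=
          mul_le_mul (H₁ 6 g) (mul_le_mul hf (H₂ H) (L2Norm_nonneg _) hA)
            (mul_nonneg (L2Norm_nonneg _) (L2Norm_nonneg _)) (by positivity)
      _ = _ := by ring
  have e2 : ‖∫ x, mult (low 3) f x * mult (jap s) (mult (low 6) g) x * H x‖ ≤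
      C₃ * (L2Norm (mult (jap s) f) * supNorm g) * L2Norm H := by
    refine (norm_integral_mul_mul_le' _ _ _).trans ?_
    calc _ ≤ (C₃ * supNorm g) * (L2Norm (mult (jap s) f) * L2Norm H) :=
          mul_le_mul (H₃ g) (mul_le_mul_of_nonneg_right hf hH)
            (mul_nonneg (L2Norm_nonneg _) (L2Norm_nonneg _)) (by positivity)
      _ = _ := by ring
  have hE := mul_le_mul_of_nonneg_right
    (mul_le_mul_of_nonneg_left (left_le_commBound s f g) (by positivity : 0 ≤ C₁ * C₂ + C₃)) hH
  refine (norm_sub_le _ _).trans ((add_le_add e1 e2).trans (le_trans (le_of_eq ?_) hE))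
  ring

theorem exists_highLow_output_le {s : ℝ} (hs : 0 < s) : ∃ C : ℝ, 0 ≤ C ∧
    ∀ (f g H : 𝓢(ℝ, ℂ)) (K : ℕ), ∑ k ∈ Finset.range K,
      ‖∫ x, mult (band (k + 3) (k + 4)) f x * mult (low (k + 7)) g x * mult (jap s) H x‖ ≤
      C * commBound s f g * L2Norm H := by
  obtain ⟨C₁, hC₁, H₁⟩ := supNorm_mult_low_le
  obtain ⟨C₂, hC₂, H₂⟩ := exists_sum_band_le s (a := 3) (b := 4) (by norm_num)
  obtain ⟨C₃, hC₃, H₃⟩ := exists_sum_mul_low_le (σ := -s) (by linarith) 9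
  refine ⟨C₁ * (C₂ * C₃), by positivity, fun f g H K => ?_⟩
  have hb := supNorm_nonneg g
  have h3 := H₃ s (jap s) (hasTemperateGrowth_jap s) (fun _ => le_rfl) H K
  rw [add_neg_cancel, mult_jap_zero] at h3
  have hl : ∀ k ξ η, band (k + 3) (k + 4) ξ ≠ 0 → low (k + 7) η ≠ 0 → low (k + 9) (ξ + η) = 1 :=
    fun k ξ η hξ hη => by
      have h1 := (mem_of_band_ne_zero (by omega) hξ).2
      have h2 := lt_of_low_ne_zero hη
      have h3 := abs_add_le ξ η
      have h6 : (0 : ℝ) < 2 ^ k := by positivity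
      apply low_of_le
      simp only [pow_add] at *
      linarith
  calc _ ≤ ∑ k ∈ Finset.range K, (C₁ * supNorm g) *
        ((((2 : ℝ) ^ k) ^ s * L2Norm (mult (band (k + 3) (k + 4)) f)) *
        (((2 : ℝ) ^ k) ^ (-s) * L2Norm (mult (jap s) (mult (low (k + 9)) H)))) := by
        refine Finset.sum_le_sum fun k _ => ?_
        rw [integral_localize (hasTemperateGrowth_band _ _) (hasTemperateGrowth_low _)
          (hasTemperateGrowth_low (k + 9)) (low_neg _) (hl k),
          mult_comm (hasTemperateGrowth_low _) (hasTemperateGrowth_jap s)]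
        refine (norm_integral_mul_mul_le' _ _ _).trans ?_
        refine (mul_le_mul_of_nonneg_right (H₁ _ g)
          (mul_nonneg (L2Norm_nonneg _) (L2Norm_nonneg _))).trans (le_of_eq ?_)
        have : (0 : ℝ) < (2 ^ k) ^ s := by positivity
        rw [Real.rpow_neg (by positivity)]
        field_simp
    _ ≤ (C₁ * supNorm g) * ((C₂ * L2Norm (mult (jap s) f)) * (C₃ * L2Norm H)) := by
        rw [← Finset.mul_sum]
        exact mul_le_mul_of_nonneg_left (sum_mul_le_of_sq _ (mul_nonneg hC₂ (L2Norm_nonneg _))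
          (mul_nonneg hC₃ (L2Norm_nonneg _)) (H₂ f K) h3) (by positivity)
    _ = C₁ * (C₂ * C₃) * (L2Norm (mult (jap s) f) * supNorm g) * L2Norm H := by ring
    _ ≤ _ := by
        have := L2Norm_nonneg H
        gcongr
        exact left_le_commBound s f g

theorem exists_highLow_input_le (s : ℝ) : ∃ C : ℝ, 0 ≤ C ∧
    ∀ (f g H : 𝓢(ℝ, ℂ)) (K : ℕ), ∑ k ∈ Finset.range K,
      ‖∫ x, mult (band (k + 3) (k + 4)) f x * mult (jap s) (mult (low k) g) x * H x‖ ≤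
      C * commBound s f g * L2Norm H := by
  obtain ⟨C₁, hC₁, H₁⟩ := exists_supNorm_mult_band_succ_le
  obtain ⟨C₂, hC₂, H₂⟩ := exists_sum_mul_low_le (σ := -1) (by norm_num) 0
  obtain ⟨C₃, hC₃, H₃⟩ := exists_sum_band_zero_le (a := 1) (b := 6) (by norm_num)
  refine ⟨C₁ * (C₂ * C₃), by positivity, fun f g H K => ?_⟩
  have hc := supNorm_nonneg (derivS f)
  have h2 := H₂ s (jap s) (hasTemperateGrowth_jap s) (fun _ => le_rfl) g K
  rw [← sub_eq_add_neg] at h2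
  have hl : ∀ k ξ η, band (k + 3) (k + 4) ξ ≠ 0 → low k η ≠ 0 → band (k + 1) (k + 6) (ξ + η) = 1 :=
    fun k ξ η hξ hη => by
      obtain ⟨h1, h2⟩ := mem_of_band_ne_zero (by omega) hξ
      have h3 := lt_of_low_ne_zero hη
      have h4 := abs_add_le ξ η
      have h5 : |ξ| ≤ |ξ + η| + |η| := by simpa using abs_sub (ξ + η) η
      have h6 : (0 : ℝ) < 2 ^ k := by positivity
      apply band_of_mem
      · simp only [pow_add] at *
        linarith
      · simp only [pow_add] at *
        linarith
  calc _ ≤ ∑ k ∈ Finset.range K, (C₁ * supNorm (derivS f)) *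
        ((((2 : ℝ) ^ k) ^ (-1 : ℝ) * L2Norm (mult (jap s) (mult (low (k + 0)) g))) *
        L2Norm (mult (band (k + 1) (k + 6)) H)) := by
        refine Finset.sum_le_sum fun k _ => ?_
        rw [mult_comm (hasTemperateGrowth_jap s) (hasTemperateGrowth_low _),
          integral_localize (hasTemperateGrowth_band _ _) (hasTemperateGrowth_low _)
          (hasTemperateGrowth_band (k + 1) (k + 6)) (band_neg _ _) (hl k),
          mult_comm (hasTemperateGrowth_low _) (hasTemperateGrowth_jap s)]
        refine (norm_integral_mul_mul_le _ _ _).trans ?_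
        have h5 : supNorm (mult (band (k + 3) (k + 4)) f) ≤
            C₁ * ((2 : ℝ) ^ k)⁻¹ * supNorm (derivS f) := by
          refine (H₁ (k + 3) f).trans ?_
          gcongr <;> norm_num
        refine (mul_le_mul_of_nonneg_right h5
          (mul_nonneg (L2Norm_nonneg _) (L2Norm_nonneg _))).trans (le_of_eq ?_)
        rw [Real.rpow_neg_one, add_zero]
        ring
    _ ≤ (C₁ * supNorm (derivS f)) * ((C₂ * L2Norm (mult (jap (s - 1)) g)) * (C₃ * L2Norm H)) := by
        rw [← Finset.mul_sum]
        exact mul_le_mul_of_nonneg_left (sum_mul_le_of_sq _ (mul_nonneg hC₂ (L2Norm_nonneg _))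
          (mul_nonneg hC₃ (L2Norm_nonneg _)) h2 (H₃ H K)) (by positivity)
    _ = C₁ * (C₂ * C₃) * (supNorm (derivS f) * L2Norm (mult (jap (s - 1)) g)) * L2Norm H := by ring
    _ ≤ _ := by
        have := L2Norm_nonneg H
        gcongr
        exact right_le_commBound s f g

theorem commForm_lowHigh_eq (s : ℝ) (k : ℕ) {κ : 𝓢(ℝ, ℂ)}
    (hκ : ∀ ξ, jap s ξ * band (k + 3) (k + 10) ξ =
      ((((2 : ℝ) ^ k) ^ s : ℝ) : ℂ) * dil κ ((1 / 2) ^ k) ξ) (f g H : 𝓢(ℝ, ℂ)) :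
    commForm s (mult (low (k + 3)) f) (mult (band (k + 6) (k + 7)) g) H =
      ((((2 : ℝ) ^ k) ^ s : ℝ) : ℂ) * ∫ x,
        (mult (dil κ ((1 / 2) ^ k))
          (mulS (mult (low (k + 3)) f) (mult (band (k + 6) (k + 7)) g)) x -
          mult (low (k + 3)) f x * mult (dil κ ((1 / 2) ^ k)) (mult (band (k + 6) (k + 7)) g) x) *
        mult (band (k + 4) (k + 9)) H x := by
  set c : ℂ := ((((2 : ℝ) ^ k) ^ s : ℝ) : ℂ) with hc
  have hc0 : c ≠ 0 := ofReal_ne_zero.2 (by positivity)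
  set D := dil κ ((1 / 2) ^ k) with hD
  have hDg : D.HasTemperateGrowth := hasTemperateGrowth_dil _ _
  have hneg : ∀ ξ, D (-ξ) = D ξ := fun ξ => by
    apply mul_left_cancel₀ hc0
    rw [← hκ, ← hκ, jap_neg, band_neg]
  have hjap : ∀ {m : ℝ → ℂ}, m.HasTemperateGrowth →
      (∀ ξ, m ξ ≠ 0 → 2 ^ (k + 4) ≤ |ξ| ∧ |ξ| ≤ 2 ^ (k + 10)) →
      ∀ u : 𝓢(ℝ, ℂ), mult (jap s) (mult m u) = c • mult D (mult m u) := fun {m} hm hm' u => by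
    apply eq_of_fourier_eq
    intro ξ
    rw [FourierTransform.fourier_smul, smul_apply, fourier_mult (hasTemperateGrowth_jap s),
      fourier_mult hDg, fourier_mult hm, smul_eq_mul]
    by_cases h : m ξ = 0
    · simp [h]
    · have := hκ ξ
      rw [band_of_mem (hm' ξ h).1 (hm' ξ h).2, mul_one] at this
      rw [this, mul_assoc]
  have hl : ∀ ξ η, low (k + 3) ξ ≠ 0 → band (k + 6) (k + 7) η ≠ 0 →
      band (k + 4) (k + 9) (ξ + η) = 1 := fun ξ η hξ hη => by
    have h3 := lt_of_low_ne_zero hξ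
    obtain ⟨h1, h2⟩ := mem_of_band_ne_zero (by omega) hη
    have h4 := abs_add_le ξ η
    have h5 : |η| ≤ |ξ + η| + |ξ| := by simpa using abs_sub (ξ + η) ξ
    have h6 : (0 : ℝ) < 2 ^ k := by positivity
    apply band_of_mem
    · simp only [pow_add] at *
      linarith
    · simp only [pow_add] at *
      linarith
  have hg := hjap (hasTemperateGrowth_band (k + 6) (k + 7)) (fun ξ h => by
    obtain ⟨h1, h2⟩ := mem_of_band_ne_zero (by omega) h
    exact ⟨(pow_le_pow_right₀ one_le_two (by omega)).trans h1.le,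
      h2.le.trans (pow_le_pow_right₀ one_le_two (by omega))⟩) g
  have hH := hjap (hasTemperateGrowth_band (k + 4) (k + 9)) (fun ξ h => by
    obtain ⟨h1, h2⟩ := mem_of_band_ne_zero (by omega) h
    exact ⟨h1.le, h2.le⟩) H
  have e2 : ∫ x, mult (low (k + 3)) f x * mult (jap s) (mult (band (k + 6) (k + 7)) g) x * H x =
      ∫ x, mult (low (k + 3)) f x * mult (jap s) (mult (band (k + 6) (k + 7)) g) x *
        mult (band (k + 4) (k + 9)) H x := by
    rw [mult_comm (hasTemperateGrowth_jap s) (hasTemperateGrowth_band _ _)]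
    exact integral_localize (hasTemperateGrowth_low _) (hasTemperateGrowth_band _ _)
      (hasTemperateGrowth_band _ _) (band_neg _ _) hl _ _ _
  rw [commForm, e2, integral_localize (hasTemperateGrowth_low _) (hasTemperateGrowth_band _ _)
    (hasTemperateGrowth_band (k + 4) (k + 9)) (band_neg _ _) hl,
    mult_comm (hasTemperateGrowth_band _ _) (hasTemperateGrowth_jap s), hg, hH]
  set a := mult (low (k + 3)) f
  set b := mult (band (k + 6) (k + 7)) g
  set ψ := mult (band (k + 4) (k + 9)) H
  have e3 := integral_mult_mul hDg (by simpa only [hneg] using hDg) (mulS a b) ψ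
  simp only [hneg] at e3
  have e4 : ∫ x, (mult D (mulS a b) x - a x * mult D b x) * ψ x =
      (∫ x, mult D (mulS a b) x * ψ x) - ∫ x, a x * mult D b x * ψ x := by
    simp_rw [sub_mul]
    refine integral_sub ?_ (integrable_mul_mul _ _ _)
    simpa only [← mulS_apply] using (mulS (mult D (mulS a b)) ψ).integrable (μ := volume)
  rw [e4, e3, mul_sub, ← integral_const_mul, ← integral_const_mul]
  congr 2
  · ext x
    simp only [smul_apply, smul_eq_mul, mulS_apply]
    ring
  · ext x
    simp only [smul_apply, smul_eq_mul]
    ring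

theorem exists_lowHigh_le (s : ℝ) : ∃ C : ℝ, 0 ≤ C ∧
    ∀ (f g H : 𝓢(ℝ, ℂ)) (K : ℕ), ∑ k ∈ Finset.range K,
      ‖commForm s (mult (low (k + 3)) f) (mult (band (k + 6) (k + 7)) g) H‖ ≤
      C * commBound s f g * L2Norm H := by
  obtain ⟨B, hB, Hκ⟩ := exists_bessel_band_kernel s (a := 3) (b := 10) (by norm_num)
  choose κ hκ hκ' using Hκ
  obtain ⟨C₁, hC₁, H₁⟩ := supNorm_mult_low_le
  obtain ⟨C₂, hC₂, H₂⟩ := exists_sum_band_le (s - 1) (a := 6) (b := 7) (by norm_num)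
  obtain ⟨C₃, hC₃, H₃⟩ := exists_sum_band_zero_le (a := 4) (b := 9) (by norm_num)
  refine ⟨B * Real.pi * C₁ * (C₂ * C₃), by positivity, fun f g H K => ?_⟩
  have hc := supNorm_nonneg (derivS f)
  calc _ ≤ ∑ k ∈ Finset.range K, (B * Real.pi * (C₁ * supNorm (derivS f))) *
        ((((2 : ℝ) ^ k) ^ (s - 1) * L2Norm (mult (band (k + 6) (k + 7)) g)) *
        L2Norm (mult (band (k + 4) (k + 9)) H)) := by
        refine Finset.sum_le_sum fun k _ => ?_
        rw [commForm_lowHigh_eq s k (hκ' k), norm_mul, norm_real,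
          Real.norm_of_nonneg (by positivity)]
        set b := mult (band (k + 6) (k + 7)) g
        set ψ := mult (band (k + 4) (k + 9)) H
        have h0 : 0 ≤ L2Norm b * L2Norm ψ := mul_nonneg (L2Norm_nonneg _) (L2Norm_nonneg _)
        have h1 : supNorm (derivS (mult (low (k + 3)) f)) ≤ C₁ * supNorm (derivS f) := by
          rw [derivS_mult (hasTemperateGrowth_low _)]
          exact H₁ _ _
        have h2 := integral_abs_mul_norm_le_of_decay (hκ k)
        calc _ ≤ ((2 : ℝ) ^ k) ^ s * ((1 / 2) ^ k * (∫ z, |z| * ‖κ k z‖) *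
              (supNorm (derivS (mult (low (k + 3)) f)) * (L2Norm b * L2Norm ψ))) := by
              gcongr
              exact norm_integral_commutator_le_sup _ _ _ _ (by positivity)
          _ ≤ ((2 : ℝ) ^ k) ^ s * ((1 / 2) ^ k * (B * Real.pi) *
              ((C₁ * supNorm (derivS f)) * (L2Norm b * L2Norm ψ))) := by
              have h3 := mul_nonneg (supNorm_nonneg (derivS (mult (low (k + 3)) f))) h0
              gcongr
          _ = _ := by
              rw [Real.rpow_sub_one (by positivity), one_div, inv_pow]
              ring
    _ ≤ (B * Real.pi * (C₁ * supNorm (derivS f))) *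
        ((C₂ * L2Norm (mult (jap (s - 1)) g)) * (C₃ * L2Norm H)) := by
        rw [← Finset.mul_sum]
        exact mul_le_mul_of_nonneg_left (sum_mul_le_of_sq _ (mul_nonneg hC₂ (L2Norm_nonneg _))
          (mul_nonneg hC₃ (L2Norm_nonneg _)) (H₂ g K) (H₃ H K)) (by positivity)
    _ = B * Real.pi * C₁ * (C₂ * C₃) *
        (supNorm (derivS f) * L2Norm (mult (jap (s - 1)) g)) * L2Norm H := by ring
    _ ≤ _ := by
        have := L2Norm_nonneg H
        gcongr
        exact right_le_commBound s f g

theorem commForm_sub_left (s : ℝ) (a a' b H : 𝓢(ℝ, ℂ)) :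
    commForm s (a - a') b H = commForm s a b H - commForm s a' b H := by
  simp only [commForm, sub_apply, sub_mul]
  rw [integral_sub (integrable_mul_mul _ _ _) (integrable_mul_mul _ _ _),
    integral_sub (integrable_mul_mul _ _ _) (integrable_mul_mul _ _ _)]
  ring

theorem commForm_sub_right (s : ℝ) (a b b' H : 𝓢(ℝ, ℂ)) :
    commForm s a (b - b') H = commForm s a b H - commForm s a b' H := by
  simp only [commForm, sub_apply, map_sub, sub_mul, mul_sub]
  rw [integral_sub (integrable_mul_mul _ _ _) (integrable_mul_mul _ _ _),
    integral_sub (integrable_mul_mul _ _ _) (integrable_mul_mul _ _ _)]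
  ring

theorem norm_commForm_high_le (s : ℝ) (k : ℕ) (f g H : 𝓢(ℝ, ℂ)) :
    ‖commForm s (mult (band (k + 3) (k + 4)) f) (mult (low (k + 7)) g) H‖ ≤
      ‖∫ x, mult (band (k + 3) (k + 4)) f x * mult (low (k + 7)) g x * mult (jap s) H x‖ +
      ‖∫ x, mult (band (k + 3) (k + 4)) f x * mult (jap s) (mult (low k) g) x * H x‖ +
      ∫ x, ‖mult (band (k + 3) (k + 4)) f x‖ *
        ‖mult (jap s) (mult (band k (k + 7)) g) x‖ * ‖H x‖ := by
  have h1 : ∫ x, mult (band (k + 3) (k + 4)) f x * mult (jap s) (mult (low (k + 7)) g) x * H x =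
      (∫ x, mult (band (k + 3) (k + 4)) f x * mult (jap s) (mult (low k) g) x * H x) +
      ∫ x, mult (band (k + 3) (k + 4)) f x * mult (jap s) (mult (band k (k + 7)) g) x * H x := by
    rw [← integral_add (integrable_mul_mul _ _ _) (integrable_mul_mul _ _ _)]
    congr 1
    ext x
    rw [mult_band k, map_sub, sub_apply]
    ring
  have h2 : ‖∫ x, mult (band (k + 3) (k + 4)) f x *
      mult (jap s) (mult (band k (k + 7)) g) x * H x‖ ≤
      ∫ x, ‖mult (band (k + 3) (k + 4)) f x‖ *
        ‖mult (jap s) (mult (band k (k + 7)) g) x‖ * ‖H x‖ := by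
    simpa only [norm_mul] using norm_integral_le_integral_norm (μ := volume)
      fun x => mult (band (k + 3) (k + 4)) f x * mult (jap s) (mult (band k (k + 7)) g) x * H x
  rw [commForm, h1]
  refine (norm_sub_le _ _).trans ?_
  rw [add_assoc]
  gcongr
  exact (norm_add_le _ _).trans (add_le_add_right h2 _)

theorem exists_commForm_truncated_le {s : ℝ} (hs : 0 < s) : ∃ C : ℝ, 0 ≤ C ∧
    ∀ (f g H : 𝓢(ℝ, ℂ)) (K : ℕ),
      ‖commForm s (mult (low (K + 3)) f) (mult (low (K + 6)) g) H‖ ≤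
        C * (commBound s f g * L2Norm H) := by
  obtain ⟨C₀, hC₀, H₀⟩ := exists_commForm_low_le hs
  obtain ⟨C₁, hC₁, H₁⟩ := exists_highLow_output_le hs
  obtain ⟨C₂, hC₂, H₂⟩ := exists_highLow_input_le s
  obtain ⟨C₃, hC₃, H₃⟩ := exists_highHigh_le s
  obtain ⟨C₄, hC₄, H₄⟩ := exists_lowHigh_le s
  refine ⟨C₀ + (C₁ + C₂ + C₃ + C₄), by positivity, fun f g H K => ?_⟩
  have htel := Finset.sum_range_sub
    (fun k => commForm s (mult (low (k + 3)) f) (mult (low (k + 6)) g) H) K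
  have hstep : ∀ k, commForm s (mult (low (k + 1 + 3)) f) (mult (low (k + 1 + 6)) g) H -
      commForm s (mult (low (k + 3)) f) (mult (low (k + 6)) g) H =
      commForm s (mult (band (k + 3) (k + 4)) f) (mult (low (k + 7)) g) H +
      commForm s (mult (low (k + 3)) f) (mult (band (k + 6) (k + 7)) g) H := fun k => by
    rw [mult_band, mult_band, commForm_sub_left, commForm_sub_right,
      show k + 1 + 3 = k + 4 by ring, show k + 1 + 6 = k + 7 by ring]
    ring
  simp_rw [hstep] at htel
  rw [zero_add, zero_add, eq_sub_iff_add_eq] at htel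
  rw [← htel]
  have hsum : ‖∑ k ∈ Finset.range K,
      (commForm s (mult (band (k + 3) (k + 4)) f) (mult (low (k + 7)) g) H +
      commForm s (mult (low (k + 3)) f) (mult (band (k + 6) (k + 7)) g) H)‖ ≤
      C₁ * commBound s f g * L2Norm H + C₂ * commBound s f g * L2Norm H +
      C₃ * commBound s f g * L2Norm H + C₄ * commBound s f g * L2Norm H := by
    refine (norm_sum_le _ _).trans ((Finset.sum_le_sum fun k _ => (norm_add_le _ _).trans
      (add_le_add_left (norm_commForm_high_le s k f g H) _)).trans ?_)
    rw [Finset.sum_add_distrib, Finset.sum_add_distrib, Finset.sum_add_distrib]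
    exact add_le_add (add_le_add (add_le_add (H₁ f g H K) (H₂ f g H K)) (H₃ f g H K)) (H₄ f g H K)
  refine (norm_add_le _ _).trans ((add_le_add hsum (H₀ f g H)).trans (le_of_eq ?_))
  ring

theorem L2Norm_low_sub_le (k : ℕ) (f : 𝓢(ℝ, ℂ)) :
    L2Norm (mult (low k) f - f : 𝓢(ℝ, ℂ)) ≤ 2 * (1 / 2) ^ k * L2Norm (mult (jap 1) f) := by
  have h1 := mult_sub (hasTemperateGrowth_low k) (hasTemperateGrowth_jap 0) f
  rw [mult_jap_zero] at h1
  rw [← h1]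
  refine L2Norm_mult_le (by positivity)
    ((hasTemperateGrowth_low k).sub (hasTemperateGrowth_jap 0)) (hasTemperateGrowth_jap 1)
    (fun ξ => ?_) f
  rw [jap_zero]
  change ‖low k ξ - 1‖ ≤ _
  by_cases h : |ξ| ≤ 2 ^ k
  · rw [low_of_le h, sub_self, norm_zero]
    positivity
  · have h2 : ‖low k ξ - 1‖ ≤ 2 := by
      refine (norm_sub_le _ _).trans ?_
      rw [norm_one]
      linarith [norm_low_le k ξ]
    have h3 : |ξ| ≤ ‖jap 1 ξ‖ := by
      refine le_trans ?_ (norm_derivSymb_le ξ)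
      have : ‖derivSymb ξ‖ = 2 * Real.pi * |ξ| := by
        simp [derivSymb, abs_of_pos Real.pi_pos]
      rw [this]
      nlinarith [Real.pi_gt_three, abs_nonneg ξ]
    have h4 : (1 : ℝ) ≤ (1 / 2) ^ k * ‖jap 1 ξ‖ := by
      rw [one_div, inv_pow, ← div_eq_inv_mul, le_div_iff₀ (by positivity), one_mul]
      exact (not_le.1 h).le.trans h3
    rw [mul_assoc]
    linarith

theorem tendsto_L2Norm_low_sub (a : ℕ) (f : 𝓢(ℝ, ℂ)) : Filter.Tendsto
    (fun k => L2Norm (mult (low (k + a)) f - f : 𝓢(ℝ, ℂ))) Filter.atTop (nhds 0) := by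
  refine squeeze_zero (fun k => L2Norm_nonneg _) (fun k => L2Norm_low_sub_le (k + a) f) ?_
  have h := (Filter.tendsto_add_atTop_iff_nat a).2
    (tendsto_pow_atTop_nhds_zero_of_lt_one (by norm_num : (0 : ℝ) ≤ 1 / 2) (by norm_num))
  simpa using (h.const_mul 2).mul_const (L2Norm (mult (jap 1) f))

/-- Trilinear integrals are stable under frequency truncation. -/
theorem tendsto_integral_low_mul_low {a b : ℕ} {m : ℝ → ℂ} (hm : m.HasTemperateGrowth)
    (f g w : 𝓢(ℝ, ℂ)) :
    Filter.Tendsto (fun k => ∫ x, mult (low (k + a)) f x * mult m (mult (low (k + b)) g) x * w x)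
      Filter.atTop (nhds (∫ x, f x * mult m g x * w x)) := by
  obtain ⟨C, hC, H⟩ := supNorm_mult_low_le
  rw [tendsto_iff_norm_sub_tendsto_zero]
  have h1 := (tendsto_L2Norm_low_sub a f).mul_const (C * supNorm (mult m g) * L2Norm w)
  have h2 := (tendsto_L2Norm_low_sub b (mult m g)).mul_const (supNorm f * L2Norm w)
  have h3 := h1.add h2
  rw [zero_mul, zero_mul, add_zero] at h3
  refine squeeze_zero (fun k => norm_nonneg _) (fun k => ?_) h3
  rw [mult_comm hm (hasTemperateGrowth_low _)]
  set f' := mult (low (k + a)) f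
  set G := mult m g
  set G' := mult (low (k + b)) G
  have e : (∫ x, f' x * G' x * w x) - ∫ x, f x * G x * w x =
      (∫ x, (f' - f : 𝓢(ℝ, ℂ)) x * G' x * w x) + ∫ x, f x * (G' - G : 𝓢(ℝ, ℂ)) x * w x := by
    rw [← integral_sub (integrable_mul_mul _ _ _) (integrable_mul_mul _ _ _),
      ← integral_add (integrable_mul_mul _ _ _) (integrable_mul_mul _ _ _)]
    congr 1
    ext x
    simp only [sub_apply]
    ring
  rw [e]
  refine (norm_add_le _ _).trans (add_le_add ?_ ?_)
  · refine (norm_integral_mul_mul_le' _ _ _).trans ?_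
    refine (mul_le_mul_of_nonneg_right (H _ G)
      (mul_nonneg (L2Norm_nonneg _) (L2Norm_nonneg _))).trans (le_of_eq ?_)
    ring
  · refine (norm_integral_mul_mul_le _ _ _).trans (le_of_eq ?_)
    ring

theorem exists_norm_commForm_le {s : ℝ} (hs : 0 < s) : ∃ C : ℝ, 0 ≤ C ∧ ∀ f g H : 𝓢(ℝ, ℂ),
    ‖commForm s f g H‖ ≤ C * (commBound s f g * L2Norm H) := by
  obtain ⟨C, hC, h⟩ := exists_commForm_truncated_le hs
  refine ⟨C, hC, fun f g H => ?_⟩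
  have h1 := tendsto_integral_low_mul_low (a := 3) (b := 6) (hasTemperateGrowth_jap 0) f g
    (mult (jap s) H)
  simp only [mult_jap_zero] at h1
  have h2 := tendsto_integral_low_mul_low (a := 3) (b := 6) (hasTemperateGrowth_jap s) f g H
  exact le_of_tendsto (h1.sub h2).norm (Filter.Eventually.of_forall fun K => h f g H K)

/-- The commutator estimate in terms of Schwartz-space multipliers. -/
theorem exists_L2Norm_commutator_le {s : ℝ} (hs : 0 < s) : ∃ C : ℝ, 0 ≤ C ∧ ∀ f g : 𝓢(ℝ, ℂ),
    L2Norm (mult (jap s) (mulS f g) - mulS f (mult (jap s) g) : 𝓢(ℝ, ℂ)) ≤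
      C * commBound s f g := by
  obtain ⟨C, hC, h⟩ := exists_norm_commForm_le hs
  refine ⟨C, hC, fun f g => ?_⟩
  set G : 𝓢(ℝ, ℂ) := mult (jap s) (mulS f g) - mulS f (mult (jap s) g) with hG
  have h1 : commForm s f g (conjS G) = ((L2Norm G ^ 2 : ℝ) : ℂ) := by
    have e := integral_mult_mul (hasTemperateGrowth_jap s)
      (by simpa only [jap_neg] using hasTemperateGrowth_jap s) (mulS f g) (conjS G)
    simp only [jap_neg, mulS_apply] at e
    have i1 : Integrable fun x => mult (jap s) (mulS f g) x * conjS G x := by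
      simpa only [← mulS_apply] using
        (mulS (mult (jap s) (mulS f g)) (conjS G)).integrable (μ := volume)
    rw [commForm, ← e, ← integral_sub i1 (integrable_mul_mul _ _ _), sq_L2Norm,
      ← integral_complex_ofReal]
    congr 1
    ext x
    have : ((‖G x‖ ^ 2 : ℝ) : ℂ) = G x * conj (G x) := by
      rw [Complex.mul_conj, Complex.normSq_eq_norm_sq]
    rw [ofReal_pow] at this
    push_cast
    rw [this, conjS_apply, hG]
    simp only [sub_apply, mulS_apply]
    ring
  have h2 := h f g (conjS G)
  rw [h1, norm_real, Real.norm_of_nonneg (sq_nonneg _), L2Norm_conjS] at h2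
  rcases (L2Norm_nonneg G).eq_or_lt with h0 | h0
  · rw [← h0]
    exact mul_nonneg hC (add_nonneg (mul_nonneg (L2Norm_nonneg _) (supNorm_nonneg _))
      (mul_nonneg (supNorm_nonneg _) (L2Norm_nonneg _)))
  · refine le_of_mul_le_mul_right ?_ h0
    linarith

theorem fourierT_eq (f : 𝓢(ℝ, ℂ)) (ξ : ℝ) : fourierT f ξ = 𝓕 f (ξ / (2 * Real.pi)) := by
  rw [fourierT, fourier_coe, Real.fourier_real_eq_integral_exp_smul]
  congr 1
  ext x
  rw [smul_eq_mul]
  congr 2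
  push_cast
  have : (Real.pi : ℂ) ≠ 0 := ofReal_ne_zero.2 Real.pi_ne_zero
  field_simp

theorem bessel_eq (σ : ℝ) (f : 𝓢(ℝ, ℂ)) : bessel σ f = mult (jap σ) f := by
  ext x
  have h1 : mult (jap σ) f x =
      ∫ ξ : ℝ, Complex.exp (2 * Real.pi * I * ξ * x) * (jap σ ξ * 𝓕 f ξ) := by
    simp_rw [← fourier_mult (hasTemperateGrowth_jap σ)]
    rw [← fourierInv_fourier_apply]
    congr 1
    ext ξ
    rw [Real.fourierChar_apply]
    congr 2
    push_cast
    ring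
  have h2 := Measure.integral_comp_div
    (fun ξ : ℝ => Complex.exp (2 * Real.pi * I * ξ * x) * (jap σ ξ * 𝓕 f ξ)) (2 * Real.pi)
  rw [h1, bessel, invFourierT]
  have h3 : ∀ ξ : ℝ, Complex.exp (I * ξ * x) *
      ((((1 + ξ ^ 2) ^ (σ / 2) : ℝ) : ℂ) * fourierT f ξ) =
      Complex.exp (2 * Real.pi * I * ((ξ / (2 * Real.pi) : ℝ) : ℂ) * x) *
        (jap σ (ξ / (2 * Real.pi)) * 𝓕 f (ξ / (2 * Real.pi))) := fun ξ => by
    rw [fourierT_eq, jap]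
    have : (Real.pi : ℂ) ≠ 0 := ofReal_ne_zero.2 Real.pi_ne_zero
    congr 2
    · push_cast
      field_simp
    · rw [mul_div_cancel₀ _ Real.two_pi_pos.ne']
  simp_rw [h3]
  rw [h2, abs_of_pos Real.two_pi_pos, real_smul, ← mul_assoc]
  have : (Real.pi : ℂ) ≠ 0 := ofReal_ne_zero.2 Real.pi_ne_zero
  push_cast
  generalize (∫ y : ℝ, Complex.exp (2 * Real.pi * I * y * x) * (jap σ y * 𝓕 f y)) = A
  field_simp

end KatoPonce

/-- Kato–Ponce commutator estimate: for `s > 0` there is `c_s > 0` with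
`‖Λ^s(fg) - f Λ^s g‖_{L²} ≤ c_s (‖Λ^s f‖_{L²} ‖g‖_{L^∞} + ‖∂ₓ f‖_{L^∞} ‖Λ^{s-1} g‖_{L²})`
for all Schwartz functions `f, g`. -/
theorem kato_ponce_commutator (s : ℝ) (hs : 0 < s) :
    ∃ c > (0 : ℝ), ∀ f g : 𝓢(ℝ, ℂ),
      L2Norm (fun x => bessel s (fun y => f y * g y) x - f x * bessel s (⇑g) x) ≤
        c * (L2Norm (bessel s (⇑f)) * supNorm (⇑g) +
          supNorm (deriv (⇑f)) * L2Norm (bessel (s - 1) (⇑g))) := by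
  obtain ⟨C, hC, h⟩ := KatoPonce.exists_L2Norm_commutator_le hs
  refine ⟨C + 1, by positivity, fun f g => ?_⟩
  have h1 : (fun y => f y * g y) = KatoPonce.mulS f g := by
    ext y
    simp
  rw [h1, KatoPonce.bessel_eq, KatoPonce.bessel_eq, KatoPonce.bessel_eq, KatoPonce.bessel_eq,
    ← KatoPonce.coe_derivS]
  have h2 := h f g
  have h3 : 0 ≤ KatoPonce.commBound s f g := (mul_nonneg (KatoPonce.L2Norm_nonneg _)
    (KatoPonce.supNorm_nonneg _)).trans (KatoPonce.left_le_commBound s f g)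
  calc _ = L2Norm (KatoPonce.mult (KatoPonce.jap s) (KatoPonce.mulS f g) -
        KatoPonce.mulS f (KatoPonce.mult (KatoPonce.jap s) g) : 𝓢(ℝ, ℂ)) := by
        rfl
    _ ≤ C * KatoPonce.commBound s f g := h2
    _ ≤ (C + 1) * KatoPonce.commBound s f g := by linarith
end

section
/- (Product estimate in Sobolev spaces.) Let r > 1/2. There exists a constant c_r > 0 such that for all Schwartz functions f, g : ℝ → ℂ, ‖fg‖_{H^{r-1}(ℝ)} ≤ c_r ‖f‖_{H^r(ℝ)} ‖g‖_{H^{r-1}(ℝ)}. -/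
open MeasureTheory SchwartzMap

/-- The Sobolev norm `‖f‖_{H^σ} = (∫_ℝ (1+ξ²)^σ |𝓕f(ξ)|² dξ)^{1/2}`. -/
noncomputable def HsNorm (σ : ℝ) (f : ℝ → ℂ) : ℝ :=
  Real.sqrt (∫ ξ : ℝ, (1 + ξ ^ 2) ^ σ * ‖fourierT f ξ‖ ^ 2)

open scoped ENNReal FourierTransform Convolution

lemma one_add_sq_le_two_mul_add (ξ η : ℝ) :
    1 + η ^ 2 ≤ 2 * ((1 + ξ ^ 2) + (1 + (ξ - η) ^ 2)) := by
  nlinarith [sq_nonneg (2 * ξ - η)]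

lemma one_add_sq_le_two_mul_mul (ξ η : ℝ) :
    1 + ξ ^ 2 ≤ 2 * ((1 + η ^ 2) * (1 + (ξ - η) ^ 2)) := by
  nlinarith [sq_nonneg (2 * η - ξ), sq_nonneg (η * (ξ - η))]

lemma rpow_mul_rpow_neg_le_of_one_le {x y z r : ℝ} (hx : 0 < x) (hy : 0 < y) (hz : 0 < z)
    (hr : 1 ≤ r) (h : x ≤ 2 * (z * y)) :
    x ^ (r - 1) * y ^ (-r) ≤ 2 ^ (r - 1) * z ^ (r - 1) * y ^ (-1 : ℝ) := by
  calc x ^ (r - 1) * y ^ (-r) ≤ (2 * (z * y)) ^ (r - 1) * y ^ (-r) := by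
        gcongr
    _ = 2 ^ (r - 1) * z ^ (r - 1) * (y ^ (r - 1) * y ^ (-r)) := by
        rw [Real.mul_rpow (by positivity) (by positivity), Real.mul_rpow hz.le hy.le]
        ring
    _ = _ := by
        rw [← Real.rpow_add hy]
        congr 2
        ring

lemma rpow_mul_rpow_neg_le_of_lt_one {x y z r : ℝ} (hx : 0 < x) (hy : 0 < y) (hz : 0 < z)
    (hr : 1 / 2 < r) (hr1 : r < 1) (h : z ≤ 2 * (x + y)) :
    x ^ (r - 1) * y ^ (-r) ≤ 4 ^ (1 - r) * z ^ (r - 1) * (x ^ (-r) + y ^ (-r)) := by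
  have key : z ^ (1 - r) * (x ^ (r - 1) * y ^ (-r)) ≤ 4 ^ (1 - r) * (x ^ (-r) + y ^ (-r)) := by
    rcases le_total x y with hxy | hxy
    · calc z ^ (1 - r) * (x ^ (r - 1) * y ^ (-r))
          ≤ (4 * y) ^ (1 - r) * (x ^ (r - 1) * y ^ (-r)) := by
            gcongr
            all_goals linarith
        _ = 4 ^ (1 - r) * (x ^ (r - 1) * y ^ (1 - r + -r)) := by
            rw [Real.mul_rpow (by positivity) hy.le, Real.rpow_add hy]
            ring
        _ ≤ 4 ^ (1 - r) * (x ^ (r - 1) * x ^ (1 - r + -r)) := by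
            gcongr 4 ^ (1 - r) * (x ^ (r - 1) * ?_)
            exact Real.rpow_le_rpow_of_nonpos hx hxy (by linarith)
        _ = 4 ^ (1 - r) * x ^ (-r) := by
            rw [← Real.rpow_add hx]
            congr 2
            ring
        _ ≤ _ := by
            gcongr
            exact le_add_of_nonneg_right (by positivity)
    · calc z ^ (1 - r) * (x ^ (r - 1) * y ^ (-r))
          ≤ (4 * x) ^ (1 - r) * (x ^ (r - 1) * y ^ (-r)) := by
            gcongr
            all_goals linarith
        _ = 4 ^ (1 - r) * (x ^ (1 - r + (r - 1)) * y ^ (-r)) := by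
            rw [Real.mul_rpow (by positivity) hx.le, Real.rpow_add hx]
            ring
        _ = 4 ^ (1 - r) * y ^ (-r) := by simp
        _ ≤ _ := by
            gcongr
            exact le_add_of_nonneg_left (by positivity)
  calc x ^ (r - 1) * y ^ (-r) = z ^ (r - 1) * (z ^ (1 - r) * (x ^ (r - 1) * y ^ (-r))) := by
        rw [← mul_assoc, ← Real.rpow_add hz]
        simp
    _ ≤ z ^ (r - 1) * (4 ^ (1 - r) * (x ^ (-r) + y ^ (-r))) := by gcongr
    _ = _ := by ring

/-- Pointwise splitting of the kernel into integrable pieces. -/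
lemma exists_kernel_le {r : ℝ} (hr : 1 / 2 < r) : ∃ C > (0 : ℝ), ∃ t > (1 / 2 : ℝ), ∀ ξ η : ℝ,
    (1 + ξ ^ 2) ^ (r - 1) * (1 + (ξ - η) ^ 2) ^ (-r) ≤
      C * (1 + η ^ 2) ^ (r - 1) * ((1 + ξ ^ 2) ^ (-t) + (1 + (ξ - η) ^ 2) ^ (-t)) := by
  rcases le_or_gt 1 r with h | h
  · refine ⟨2 ^ (r - 1), by positivity, 1, by norm_num, fun ξ η => ?_⟩
    refine (rpow_mul_rpow_neg_le_of_one_le (by positivity) (by positivity) (by positivity) h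
      (one_add_sq_le_two_mul_mul ξ η)).trans ?_
    gcongr
    exact le_add_of_nonneg_left (by positivity)
  · exact ⟨4 ^ (1 - r), by positivity, r, hr, fun ξ η => rpow_mul_rpow_neg_le_of_lt_one
      (by positivity) (by positivity) (by positivity) hr h (one_add_sq_le_two_mul_add ξ η)⟩

/-- The weight `(1 + ξ²)^σ` as an extended nonnegative real. -/
noncomputable def sobolevWeight (σ ξ : ℝ) : ℝ≥0∞ := ENNReal.ofReal ((1 + ξ ^ 2) ^ σ)

@[fun_prop]
lemma measurable_sobolevWeight (σ : ℝ) : Measurable (sobolevWeight σ) := by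
  unfold sobolevWeight
  fun_prop

lemma sobolevWeight_mul_neg (σ ξ : ℝ) : sobolevWeight σ ξ * sobolevWeight (-σ) ξ = 1 := by
  have h : (0 : ℝ) < 1 + ξ ^ 2 := by positivity
  rw [sobolevWeight, sobolevWeight, ← ENNReal.ofReal_mul (by positivity), ← Real.rpow_add h]
  simp

lemma lintegral_sobolevWeight_neg_lt_top {t : ℝ} (ht : 1 / 2 < t) :
    ∫⁻ ξ, sobolevWeight (-t) ξ < ∞ := by
  have h : Integrable (fun x : ℝ => ((1 : ℝ) + ‖x‖ ^ 2) ^ (-(2 * t) / 2)) volume :=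
    integrable_rpow_neg_one_add_norm_sq (by simp; linarith)
  have e : -(2 * t) / 2 = -t := by ring
  simp only [Real.norm_eq_abs, sq_abs, e] at h
  exact h.lintegral_lt_top

lemma exists_lintegral_kernel_le {r : ℝ} (hr : 1 / 2 < r) : ∃ C : ℝ≥0∞, C ≠ ∞ ∧ ∀ η : ℝ,
    ∫⁻ ξ, sobolevWeight (r - 1) ξ * sobolevWeight (-r) (ξ - η) ≤ C * sobolevWeight (r - 1) η := by
  obtain ⟨C, hC, t, ht, h⟩ := exists_kernel_le hr
  have hfin := (lintegral_sobolevWeight_neg_lt_top ht).ne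
  refine ⟨ENNReal.ofReal C * ((∫⁻ ξ, sobolevWeight (-t) ξ) + ∫⁻ ξ, sobolevWeight (-t) ξ),
    by finiteness, fun η => ?_⟩
  calc ∫⁻ ξ, sobolevWeight (r - 1) ξ * sobolevWeight (-r) (ξ - η)
      ≤ ∫⁻ ξ, ENNReal.ofReal C * sobolevWeight (r - 1) η *
          (sobolevWeight (-t) ξ + sobolevWeight (-t) (ξ - η)) := by
        refine lintegral_mono fun ξ => ?_
        simp only [sobolevWeight]
        rw [← ENNReal.ofReal_mul (by positivity), ← ENNReal.ofReal_mul (by positivity),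
          ← ENNReal.ofReal_add (by positivity) (by positivity),
          ← ENNReal.ofReal_mul (by positivity)]
        exact ENNReal.ofReal_le_ofReal (h ξ η)
    _ = _ := by
        rw [lintegral_const_mul _ (by fun_prop), lintegral_add_left (by fun_prop),
          lintegral_sub_right_eq_self (sobolevWeight (-t)) η]
        ring

lemma lintegral_mul_sq_le {α : Type*} [MeasurableSpace α] {μ : Measure α} {f g : α → ℝ≥0∞}
    (hf : AEMeasurable f μ) (hg : AEMeasurable g μ) :
    (∫⁻ a, f a * g a ∂μ) ^ 2 ≤ (∫⁻ a, f a ^ 2 ∂μ) * ∫⁻ a, g a ^ 2 ∂μ := by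
  have h := ENNReal.lintegral_mul_le_Lp_mul_Lq μ Real.HolderConjugate.two_two hf hg
  simp only [Pi.mul_apply, ENNReal.rpow_two] at h
  refine (pow_le_pow_left₀ zero_le h 2).trans_eq ?_
  rw [mul_pow, ← ENNReal.rpow_two, ← ENNReal.rpow_two, ← ENNReal.rpow_mul, ← ENNReal.rpow_mul]
  norm_num

lemma lintegral_conv_sq_le (r : ℝ) {F G : ℝ → ℝ≥0∞} (hF : Measurable F) (hG : Measurable G)
    (ξ : ℝ) : (∫⁻ η, F (ξ - η) * G η) ^ 2 ≤
      (∫⁻ η, sobolevWeight r η * F η ^ 2) * ∫⁻ η, sobolevWeight (-r) (ξ - η) * G η ^ 2 := by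
  have hsq : ∀ σ η, (sobolevWeight (σ / 2) η) ^ 2 = sobolevWeight σ η := fun σ η => by
    rw [sobolevWeight, sobolevWeight, ← ENNReal.ofReal_pow (by positivity), ← Real.rpow_natCast,
      ← Real.rpow_mul (by positivity)]
    norm_num
  calc (∫⁻ η, F (ξ - η) * G η) ^ 2
      = (∫⁻ η, (sobolevWeight (r / 2) (ξ - η) * F (ξ - η)) *
          (sobolevWeight (-r / 2) (ξ - η) * G η)) ^ 2 := by
        congr 2 with η
        rw [mul_mul_mul_comm, neg_div, sobolevWeight_mul_neg, one_mul]
    _ ≤ (∫⁻ η, (sobolevWeight (r / 2) (ξ - η) * F (ξ - η)) ^ 2) *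
          ∫⁻ η, (sobolevWeight (-r / 2) (ξ - η) * G η) ^ 2 :=
        lintegral_mul_sq_le (by fun_prop) (by fun_prop)
    _ = _ := by
        simp only [mul_pow, hsq]
        rw [lintegral_sub_left_eq_self (fun η => sobolevWeight r η * F η ^ 2) ξ]

lemma exists_lintegral_weight_conv_sq_le {r : ℝ} (hr : 1 / 2 < r) : ∃ C : ℝ≥0∞, C ≠ ∞ ∧
    ∀ F G : ℝ → ℝ≥0∞, Measurable F → Measurable G →
      ∫⁻ ξ, sobolevWeight (r - 1) ξ * (∫⁻ η, F (ξ - η) * G η) ^ 2 ≤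
        C * (∫⁻ η, sobolevWeight r η * F η ^ 2) * ∫⁻ η, sobolevWeight (r - 1) η * G η ^ 2 := by
  obtain ⟨C, hC, h⟩ := exists_lintegral_kernel_le hr
  refine ⟨C, hC, fun F G hF hG => ?_⟩
  set A := ∫⁻ η, sobolevWeight r η * F η ^ 2
  calc ∫⁻ ξ, sobolevWeight (r - 1) ξ * (∫⁻ η, F (ξ - η) * G η) ^ 2
      ≤ ∫⁻ ξ, A * ∫⁻ η, sobolevWeight (r - 1) ξ * sobolevWeight (-r) (ξ - η) * G η ^ 2 := by
        refine lintegral_mono fun ξ => ?_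
        dsimp only
        grw [lintegral_conv_sq_le r hF hG ξ]
        simp only [mul_assoc]
        rw [lintegral_const_mul _ (by fun_prop), mul_left_comm]
    _ = A * ∫⁻ ξ, ∫⁻ η, sobolevWeight (r - 1) ξ * sobolevWeight (-r) (ξ - η) * G η ^ 2 := by
        refine lintegral_const_mul _ (Measurable.lintegral_prod_right' (f := fun p : ℝ × ℝ =>
          sobolevWeight (r - 1) p.1 * sobolevWeight (-r) (p.1 - p.2) * G p.2 ^ 2) ?_)
        fun_prop
    _ = A * ∫⁻ η, (∫⁻ ξ, sobolevWeight (r - 1) ξ * sobolevWeight (-r) (ξ - η)) * G η ^ 2 := by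
        rw [lintegral_lintegral_swap (by fun_prop)]
        congr 2 with η
        rw [lintegral_mul_const _ (by fun_prop)]
    _ ≤ A * ∫⁻ η, C * (sobolevWeight (r - 1) η * G η ^ 2) := by
        simp only [← mul_assoc C]
        gcongr with η
        exact h η
    _ = _ := by
        rw [lintegral_const_mul _ (by fun_prop)]
        ring

lemma fourierT_eq (f : 𝓢(ℝ, ℂ)) (ξ : ℝ) : fourierT f ξ = 𝓕 f (ξ / (2 * Real.pi)) := by
  rw [SchwartzMap.fourier_coe, Real.fourier_real_eq_integral_exp_smul, fourierT]
  congr 1 with x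
  rw [smul_eq_mul]
  congr 2
  push_cast
  field_simp

lemma continuous_fourierT (f : 𝓢(ℝ, ℂ)) : Continuous (fourierT f) := by
  rw [funext (fourierT_eq f)]
  exact (𝓕 f).continuous.comp (by fun_prop)

/-- The pointwise product of two Schwartz functions, as a Schwartz function. -/
noncomputable def schwartzMul (f g : 𝓢(ℝ, ℂ)) : 𝓢(ℝ, ℂ) :=
  pairing (ContinuousLinearMap.mul ℂ ℂ) f g

lemma fourier_schwartzMul (f g : 𝓢(ℝ, ℂ)) (x : ℝ) :
    𝓕 (schwartzMul f g) x = ∫ t, 𝓕 f (x - t) * 𝓕 g t := by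
  have hneg : ∀ (h : 𝓢(ℝ, ℂ)) (y : ℝ), 𝓕⁻ h y = 𝓕 h (-y) := fun h y => by
    rw [SchwartzMap.fourierInv_coe, SchwartzMap.fourier_coe, Real.fourierInv_eq_fourier_neg]
  have hc : SchwartzMap.convolution (ContinuousLinearMap.mul ℂ ℂ) (𝓕⁻ f) (𝓕⁻ g) =
      𝓕⁻ (schwartzMul f g) := by
    simp [SchwartzMap.convolution, schwartzMul]
  rw [← neg_neg x, ← hneg, ← hc, SchwartzMap.convolution_apply, convolution_def,
    ← integral_sub_right_eq_self _ x, neg_neg]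
  congr 1 with t
  simp only [ContinuousLinearMap.mul_apply', hneg]
  congr 2 <;> ring

lemma enorm_fourierT_mul_le (f g : 𝓢(ℝ, ℂ)) (ξ : ℝ) :
    ‖fourierT (fun x => f x * g x) ξ‖ₑ ≤ ∫⁻ η, ‖fourierT f (ξ - η)‖ₑ * ‖fourierT g η‖ₑ := by
  have hint : ∫ η, fourierT f (ξ - η) * fourierT g η =
      (2 * Real.pi) • fourierT (schwartzMul f g) ξ := by
    rw [fourierT_eq, fourier_schwartzMul]
    simp only [fourierT_eq, sub_div]
    rw [Measure.integral_comp_div (fun t => 𝓕 f (ξ / (2 * Real.pi) - t) * 𝓕 g t),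
      abs_of_pos Real.two_pi_pos]
  calc ‖fourierT (schwartzMul f g) ξ‖ₑ
      ≤ ‖(2 * Real.pi) • fourierT (schwartzMul f g) ξ‖ₑ := by
        rw [enorm_le_iff_norm_le, norm_smul, Real.norm_of_nonneg Real.two_pi_pos.le]
        exact le_mul_of_one_le_left (norm_nonneg _) (by linarith [Real.pi_gt_three])
    _ ≤ _ := by
        rw [← hint]
        simpa only [enorm_mul] using
          enorm_integral_le_lintegral_enorm (fun η => fourierT f (ξ - η) * fourierT g η)

lemma integrable_weight_mul_fourierT_sq (σ : ℝ) (f : 𝓢(ℝ, ℂ)) :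
    Integrable (fun ξ : ℝ => (1 + ξ ^ 2) ^ σ * ‖fourierT f ξ‖ ^ 2) := by
  let e : ℝ ≃L[ℝ] ℝ := ContinuousLinearEquiv.unitsEquivAut ℝ
    (Units.mk0 (2 * Real.pi)⁻¹ (by positivity))
  let h := smulLeftCLM ℂ (fun x : ℝ => (1 + ‖x‖ ^ 2) ^ (σ / 2))
    (compCLMOfContinuousLinearEquiv ℂ e (𝓕 f))
  refine ((h.memLp 2).integrable_norm_pow two_ne_zero).congr (Filter.Eventually.of_forall fun ξ => ?_)
  have hpos : (0 : ℝ) < 1 + ξ ^ 2 := by positivity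
  have he : e ξ = ξ / (2 * Real.pi) := rfl
  have hh : h ξ = ((1 + ξ ^ 2) ^ (σ / 2) : ℝ) • fourierT f ξ := by
    simp only [h]
    rw [smulLeftCLM_apply_apply (by fun_prop), Real.norm_eq_abs, sq_abs,
      compCLMOfContinuousLinearEquiv_apply, Function.comp_apply, he, fourierT_eq]
  dsimp only
  rw [hh, norm_smul, mul_pow, Real.norm_of_nonneg (by positivity), ← Real.rpow_mul_natCast hpos.le]
  norm_num

lemma ofReal_hsNorm_sq (σ : ℝ) (f : 𝓢(ℝ, ℂ)) :
    ENNReal.ofReal (HsNorm σ f ^ 2) = ∫⁻ ξ, sobolevWeight σ ξ * ‖fourierT f ξ‖ₑ ^ 2 := by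
  rw [HsNorm, Real.sq_sqrt (integral_nonneg fun ξ => by positivity),
    ofReal_integral_eq_lintegral_ofReal (integrable_weight_mul_fourierT_sq σ f)
      (Filter.Eventually.of_forall fun ξ => by positivity)]
  congr 1 with ξ
  rw [ENNReal.ofReal_mul (by positivity), ENNReal.ofReal_pow (norm_nonneg _), ofReal_norm,
    sobolevWeight]

/-- Product estimate in Sobolev spaces: for `r > 1/2` there is `c_r > 0` with
`‖fg‖_{H^{r-1}} ≤ c_r ‖f‖_{H^r} ‖g‖_{H^{r-1}}` for all Schwartz functions `f, g`. -/
theorem sobolev_product_estimate (r : ℝ) (hr : 1 / 2 < r) :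
    ∃ c > (0 : ℝ), ∀ f g : 𝓢(ℝ, ℂ),
      HsNorm (r - 1) (fun x => f x * g x) ≤ c * HsNorm r (⇑f) * HsNorm (r - 1) (⇑g) := by
  obtain ⟨C, hC, h⟩ := exists_lintegral_weight_conv_sq_le hr
  have hnn : ∀ σ u, 0 ≤ HsNorm σ u := fun σ u => Real.sqrt_nonneg _
  refine ⟨Real.sqrt (C.toReal + 1), by positivity, fun f g => ?_⟩
  refine (sq_le_sq₀ (hnn _ _) (mul_nonneg (mul_nonneg (by positivity) (hnn _ _)) (hnn _ _))).1 ?_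
  rw [mul_pow, mul_pow, Real.sq_sqrt (by positivity)]
  have hsq : ENNReal.ofReal (HsNorm (r - 1) (fun x => f x * g x) ^ 2) ≤
      ENNReal.ofReal (C.toReal * HsNorm r f ^ 2 * HsNorm (r - 1) g ^ 2) := by
    rw [ENNReal.ofReal_mul (by positivity), ENNReal.ofReal_mul (by positivity),
      ENNReal.ofReal_toReal hC, ofReal_hsNorm_sq, ofReal_hsNorm_sq]
    refine (ofReal_hsNorm_sq (r - 1) (schwartzMul f g)).trans_le (le_trans ?_ (h _ _
      (continuous_fourierT f).enorm.measurable (continuous_fourierT g).enorm.measurable))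
    gcongr with ξ
    exact enorm_fourierT_mul_le f g ξ
  refine ((ENNReal.ofReal_le_ofReal_iff (by positivity)).1 hsq).trans ?_
  gcongr
  linarith
end
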